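/- arXiv:math/0007136 — 5 statements merged into one kernel-verified Lean document; each statement's English description precedes it below -/
import Mathlib

section
/- Let G be a finite subgraph of the square lattice with equally many white and black vertices v_1,...,v_N and w_1,...,w_N, and let K(G) be its Kasteleyn–Wilson matrix. Let e_1,...,e_m be pairwise vertex-disjoint edges of G, where e_s joins the white vertex v_{b_s} to the black vertex w_{c_s} (so b_1,...,b_m are distinct and c_1,...,c_m are distinct). Then the number of perfect matchings of the induced subgraph of G on the complement of the 2m vertices {v_{b_1},...,v_{b_m}, w_{c_1},...,w_{c_m}} equals the absolute value of the determinant of the (N-m)×(N-m) submatrix of K(G) obtained by deleting rows b_1,...,b_m and columns c_1,...,c_m. -/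
open scoped Classical

/-- Two lattice points are at Euclidean distance 1. -/
def latAdj (p q : ℤ × ℤ) : Prop := |p.1 - q.1| + |p.2 - q.2| = 1

/-- The graph on `Fin N ⊕ Fin N` (left: white vertices, right: black vertices) determined by
the adjacency relation `E` between white and black indices. -/
def latGraph (N : ℕ) (E : Fin N → Fin N → Prop) : SimpleGraph (Fin N ⊕ Fin N) where
  Adj x y := (∃ i j, x = Sum.inl i ∧ y = Sum.inr j ∧ E i j) ∨
             (∃ i j, x = Sum.inr j ∧ y = Sum.inl i ∧ E i j)
  symm := by
    constructor
    rintro x y (⟨i, j, h1, h2, he⟩ | ⟨i, j, h1, h2, he⟩)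
    · exact Or.inr ⟨i, j, h2, h1, he⟩
    · exact Or.inl ⟨i, j, h2, h1, he⟩
  loopless := by
    constructor
    rintro x (⟨i, j, h1, h2, -⟩ | ⟨i, j, h1, h2, -⟩) <;> subst h1 <;> simp at h2

/-- The Kasteleyn–Wilson matrix entry at `(i,j)`: `0` if `{v i, w j}` is not an edge;
`1` if it is a horizontal edge; `(-1)^k` if it is a vertical edge joining `(a,l)` to
`(a,l+1)`, where `k` is the number of vertices of the graph with second coordinate `l`
and first coordinate strictly less than `a`. -/
noncomputable def kastEntry (N : ℕ) (v w : Fin N → ℤ × ℤ) (E : Fin N → Fin N → Prop)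
    (i j : Fin N) : ℤ :=
  if E i j then
    if (v i).2 = (w j).2 then 1
    else (-1) ^ (Nat.card {u : Fin N ⊕ Fin N //
        (Sum.elim v w u).2 = min (v i).2 (w j).2 ∧ (Sum.elim v w u).1 < (v i).1})
  else 0

/-- The number of perfect matchings of the induced subgraph of `G` on the vertex set `S`. -/
noncomputable def matchCount {V : Type*} (G : SimpleGraph V) (S : Set V) : ℕ :=
  Nat.card {M : G.Subgraph // M.verts = S ∧ M.IsMatching}

/-- The sign of the comparison of `p` and `q` in the row-by-row order of the lattice. -/
def rowOrderSign (p q : ℤ × ℤ) : ℤ :=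
  if p.2 < q.2 ∨ (p.2 = q.2 ∧ p.1 < q.1) then 1
  else if q.2 < p.2 ∨ (p.2 = q.2 ∧ q.1 < p.1) then -1 else 0

/-- The contribution of the vertex `u` to the Kasteleyn–Wilson sign of the edge `{p, q}`. -/
def leftSign (p q u : ℤ × ℤ) : ℤ :=
  if p.2 = q.2 then 1 else if u.2 = min p.2 q.2 ∧ u.1 < p.1 then -1 else 1

/-- `-1` if both edges are vertical and `{p', q'}` lies one row above `{p, q}`, else `1`. -/
def stackSign (p q p' q' : ℤ × ℤ) : ℤ :=
  if p.2 ≠ q.2 ∧ p'.2 ≠ q'.2 ∧ min p'.2 q'.2 = min p.2 q.2 + 1 then -1 else 1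

/-- For four distinct points, `-1` if the chords `{p, q}` and `{p', q'}` cross when the lattice
points are placed on a line in row-by-row order, else `1`. -/
def crossSign (p q p' q' : ℤ × ℤ) : ℤ :=
  rowOrderSign p p' * rowOrderSign q q' * (rowOrderSign p q' * rowOrderSign q p')

theorem latAdj_cases {p q : ℤ × ℤ} (h : latAdj p q) :
    q = (p.1 + 1, p.2) ∨ q = (p.1 - 1, p.2) ∨ q = (p.1, p.2 + 1) ∨ q = (p.1, p.2 - 1) := by
  obtain ⟨a, b⟩ := p
  obtain ⟨c, d⟩ := q
  simp only [latAdj, Prod.mk.injEq] at *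
  grind

theorem leftSign_mul_crossSign {p q p' q' : ℤ × ℤ} (h : latAdj p q) (h' : latAdj p' q')
    (h₁ : p ≠ p') (h₂ : q ≠ q') (h₃ : p ≠ q') (h₄ : q ≠ p') :
    (leftSign p q p' * leftSign p q q') * (leftSign p' q' p * leftSign p' q' q) *
      crossSign p q p' q' = stackSign p q p' q' * stackSign p' q' p q := by
  obtain ⟨a, b⟩ := p
  obtain ⟨c, d⟩ := p'
  rcases latAdj_cases h with rfl | rfl | rfl | rfl <;>
  rcases latAdj_cases h' with rfl | rfl | rfl | rfl <;>
  simp only [leftSign, stackSign, crossSign, rowOrderSign, Prod.mk.injEq, ne_eq] at * <;>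
  grind (splits := 40)

theorem leftSign_left (p q : ℤ × ℤ) : leftSign p q p = 1 := by
  simp [leftSign]

theorem leftSign_right {p q : ℤ × ℤ} (h : latAdj p q) : leftSign p q q = 1 := by
  rcases latAdj_cases h with rfl | rfl | rfl | rfl <;> simp [leftSign]

theorem stackSign_self (p q : ℤ × ℤ) : stackSign p q p q = 1 := by
  simp [stackSign]

theorem rowOrderSign_antisymm (p q : ℤ × ℤ) : rowOrderSign p q = -rowOrderSign q p := by
  simp only [rowOrderSign]
  grind

theorem rowOrderSign_ne_zero {p q : ℤ × ℤ} (h : p ≠ q) : rowOrderSign p q ≠ 0 := by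
  rw [ne_eq, Prod.ext_iff] at h
  simp only [rowOrderSign]
  grind

theorem rowOrderSign_eq_one_or {p q : ℤ × ℤ} (h : latAdj p q) :
    rowOrderSign p q = 1 ∨ rowOrderSign p q = -1 := by
  rcases latAdj_cases h with rfl | rfl | rfl | rfl <;> simp [rowOrderSign]

theorem rowOrderSign_of_latAdj {p q : ℤ × ℤ} (h : latAdj p q) :
    rowOrderSign p q = (q.1 + q.2) - (p.1 + p.2) := by
  rcases latAdj_cases h with rfl | rfl | rfl | rfl <;> simp [rowOrderSign]

/-- The number of endpoints of the edge `{p, q}` in row `l` or below. -/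
def belowCount (p q : ℤ × ℤ) (l : ℤ) : ℕ :=
  (if p.2 ≤ l then 1 else 0) + (if q.2 ≤ l then 1 else 0)

theorem neg_one_pow_belowCount {p q p' q' : ℤ × ℤ} (h : latAdj p q) (h' : latAdj p' q') (l : ℤ) :
    (-1 : ℤ) ^ (belowCount p q l * belowCount p' q' (l + 1)) =
      if min p.2 q.2 = l then stackSign p q p' q' else 1 := by
  have key : ∀ {p q : ℤ × ℤ}, latAdj p q → ∀ l,
      (belowCount p q l = 1 ∧ p.2 ≠ q.2 ∧ min p.2 q.2 = l) ∨
      (Even (belowCount p q l) ∧ ¬ (p.2 ≠ q.2 ∧ min p.2 q.2 = l)) := by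
    intro p q h l
    simp only [latAdj] at h
    simp only [belowCount]
    split_ifs <;> simp <;> grind
  rcases key h l with ⟨e, hn, hl⟩ | ⟨e, hn⟩
  · rcases key h' (l + 1) with ⟨e', hn', hl'⟩ | ⟨e', hn'⟩
    · simp [e, e', hl, hl', hn, hn', stackSign]
    · rw [(e'.mul_left _).neg_one_pow, if_pos hl, stackSign, if_neg]
      rw [hl]
      tauto
  · rw [(e.mul_right _).neg_one_pow]
    split_ifs with hl
    · rw [stackSign, if_neg]
      tauto
    · rfl

theorem stackSign_eq_neg_one_pow {p q p' q' : ℤ × ℤ} (h : latAdj p q) (h' : latAdj p' q')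
    {S : Finset ℤ} (hp : p.2 ∈ S) (hq : q.2 ∈ S) :
    stackSign p q p' q' =
      (-1) ^ ∑ l ∈ S, belowCount p q l * belowCount p' q' (l + 1) := by
  have hS : min p.2 q.2 ∈ S := by
    rcases min_choice p.2 q.2 with e | e <;> rwa [e]
  rw [← Finset.prod_pow_eq_pow_sum]
  simp_rw [neg_one_pow_belowCount h h']
  rw [Finset.prod_ite_eq, if_pos hS]

theorem prod_prod_eq_prod_diag_mul {n : ℕ} {M : Type*} [CommMonoid M] (f : Fin n → Fin n → M) :
    ∏ i, ∏ j, f i j = (∏ i, f i i) * ∏ i, ∏ j ∈ Finset.Ioi i, f i j * f j i := by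
  rw [Finset.prod_prod_Ioi_mul_eq_prod_prod_off_diag (fun i j => f j i), ← Finset.prod_mul_distrib]
  exact Finset.prod_congr rfl fun i _ => Fintype.prod_eq_mul_prod_compl i _

theorem exists_prod_eq_neg_one_pow {ι : Type*} (s : Finset ι) (f : ι → ℤ)
    (hf : ∀ i, f i = 1 ∨ f i = -1) :
    ∃ k : ℕ, ∏ i ∈ s, f i = (-1) ^ k ∧ ∑ i ∈ s, f i = s.card - 2 * k := by
  induction s using Finset.induction_on with
  | empty => exact ⟨0, by simp⟩
  | insert a s ha ih =>
    obtain ⟨k, hk, hk'⟩ := ih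
    rw [Finset.prod_insert ha, Finset.sum_insert ha, Finset.card_insert_of_notMem ha, hk, hk']
    rcases hf a with e | e
    · exact ⟨k, by rw [e, one_mul], by rw [e]; push_cast; ring⟩
    · exact ⟨k + 1, by rw [e, pow_succ'], by rw [e]; push_cast; ring⟩

/-- The product of a family of signs is determined by its sum. -/
theorem prod_eq_prod_of_sum_eq {ι : Type*} (s : Finset ι) (f g : ι → ℤ)
    (hf : ∀ i, f i = 1 ∨ f i = -1) (hg : ∀ i, g i = 1 ∨ g i = -1)
    (h : ∑ i ∈ s, f i = ∑ i ∈ s, g i) : ∏ i ∈ s, f i = ∏ i ∈ s, g i := by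
  obtain ⟨k, hk, hk'⟩ := exists_prod_eq_neg_one_pow s f hf
  obtain ⟨l, hl, hl'⟩ := exists_prod_eq_neg_one_pow s g hg
  obtain rfl : k = l := by omega
  rw [hk, hl]

theorem neg_one_pow_natCard {α : Type*} [Fintype α] {P : α → Prop} {f : α → ℤ}
    (hP : ∀ u, P u → f u = -1) (hn : ∀ u, ¬ P u → f u = 1) :
    (-1) ^ Nat.card {u // P u} = ∏ u, f u := by
  have hf : ∀ u, f u = if P u then -1 else 1 := fun u => by
    split_ifs with h
    exacts [hP u h, hn u h]
  simp_rw [Nat.card_eq_fintype_card, Fintype.card_subtype, hf, Finset.prod_ite]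
  simp

section Constancy

variable {N : ℕ} {v w : Fin N → ℤ × ℤ} {E : Fin N → Fin N → Prop}

theorem kastEntry_eq_prod {σ : Equiv.Perm (Fin N)} {i : Fin N} (h : E i (σ i)) :
    kastEntry N v w E i (σ i) =
      ∏ j, leftSign (v i) (w (σ i)) (v j) * leftSign (v i) (w (σ i)) (w (σ j)) := by
  rw [kastEntry, if_pos h]
  split_ifs with he
  · simp [leftSign, he]
  · rw [neg_one_pow_natCard (f := fun u => leftSign (v i) (w (σ i)) (Sum.elim v w u))
      (fun u hu => by simp only [leftSign, if_neg he, if_pos hu])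
      (fun u hu => by simp only [leftSign, if_neg he, if_neg hu]), Fintype.prod_sum_type,
      Finset.prod_mul_distrib, Equiv.prod_comp σ (fun j => leftSign (v i) (w (σ i)) (w j))]
    rfl

theorem prod_kastEntry_mul_prod_crossSign
    (hv : Function.Injective v) (hw : Function.Injective w) (hvw : ∀ i j, v i ≠ w j)
    (hE : ∀ i j, E i j → latAdj (v i) (w j)) {σ : Equiv.Perm (Fin N)} (hσ : ∀ i, E i (σ i)) :
    (∏ i, kastEntry N v w E i (σ i)) *
        ∏ i, ∏ j ∈ Finset.Ioi i, crossSign (v i) (w (σ i)) (v j) (w (σ j)) =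
      ∏ i, ∏ j, stackSign (v i) (w (σ i)) (v j) (w (σ j)) := by
  have hA := fun i => hE i (σ i) (hσ i)
  rw [Finset.prod_congr rfl fun i _ => kastEntry_eq_prod (hσ i), prod_prod_eq_prod_diag_mul,
    prod_prod_eq_prod_diag_mul]
  simp only [leftSign_left, leftSign_right (hA _), stackSign_self, mul_one, Finset.prod_const_one,
    one_mul, ← Finset.prod_mul_distrib]
  refine Finset.prod_congr rfl fun i _ => Finset.prod_congr rfl fun j hj => ?_
  have hij : i ≠ j := (Finset.mem_Ioi.1 hj).ne
  exact leftSign_mul_crossSign (hA i) (hA j) (hv.ne hij) (hw.ne (σ.injective.ne hij)) (hvw _ _)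
    (hvw _ _).symm

theorem sum_belowCount (v w : Fin N → ℤ × ℤ) (σ : Equiv.Perm (Fin N)) (l : ℤ) :
    ∑ i, belowCount (v i) (w (σ i)) l = ∑ i, belowCount (v i) (w i) l := by
  simp only [belowCount, Finset.sum_add_distrib]
  rw [Equiv.sum_comp σ (fun j => if (w j).2 ≤ l then 1 else 0)]

theorem prod_stackSign_eq (hE : ∀ i j, E i j → latAdj (v i) (w j)) {σ : Equiv.Perm (Fin N)}
    (hσ : ∀ i, E i (σ i)) :
    ∏ i, ∏ j, stackSign (v i) (w (σ i)) (v j) (w (σ j)) =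
      (-1) ^ ∑ l ∈ Finset.univ.image (fun i => (v i).2) ∪ Finset.univ.image (fun j => (w j).2),
        (∑ i, belowCount (v i) (w i) l) * ∑ i, belowCount (v i) (w i) (l + 1) := by
  have hA := fun i => hE i (σ i) (hσ i)
  rw [Finset.prod_congr rfl fun i _ => Finset.prod_congr rfl fun j _ =>
    stackSign_eq_neg_one_pow (hA i) (hA j)
      (S := Finset.univ.image (fun i => (v i).2) ∪ Finset.univ.image (fun j => (w j).2))
      (by simp) (by simp)]
  simp_rw [Finset.prod_pow_eq_pow_sum, ← sum_belowCount v w σ, Finset.sum_mul_sum]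
  congr 1
  symm
  rw [Finset.sum_comm]
  exact Finset.sum_congr rfl fun i _ => Finset.sum_comm

theorem prod_rowOrderSign_mul_prod_crossSign (v w : Fin N → ℤ × ℤ) (σ : Equiv.Perm (Fin N)) :
    (∏ i, rowOrderSign (v i) (w (σ i))) *
        ∏ i, ∏ j ∈ Finset.Ioi i, crossSign (v i) (w (σ i)) (v j) (w (σ j)) =
      Equiv.Perm.sign σ * ((∏ i, ∏ j ∈ Finset.Ioi i, rowOrderSign (v i) (v j)) *
        (∏ i, ∏ j ∈ Finset.Ioi i, rowOrderSign (w i) (w j)) *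
        (∏ i : Fin N, ∏ _j ∈ Finset.Ioi i, (-1)) * ∏ i, ∏ j, rowOrderSign (v i) (w j)) := by
  have hX : ∏ i, ∏ j, rowOrderSign (v i) (w j) = ∏ i, ∏ j, rowOrderSign (v i) (w (σ j)) :=
    Finset.prod_congr rfl fun i _ => (Equiv.prod_comp σ fun j => rowOrderSign (v i) (w j)).symm
  have hW := σ.prod_Ioi_comp_eq_sign_mul_prod (f := fun i j => rowOrderSign (w i) (w j))
    fun i j => rowOrderSign_antisymm _ _
  have hY : ∏ i, ∏ j ∈ Finset.Ioi i,
        (rowOrderSign (v i) (w (σ j)) * rowOrderSign (w (σ i)) (v j)) =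
      (∏ i : Fin N, ∏ _j ∈ Finset.Ioi i, (-1)) * ∏ i, ∏ j ∈ Finset.Ioi i,
        (rowOrderSign (v i) (w (σ j)) * rowOrderSign (v j) (w (σ i))) := by
    simp only [← Finset.prod_mul_distrib]
    refine Finset.prod_congr rfl fun i _ => Finset.prod_congr rfl fun j _ => ?_
    rw [rowOrderSign_antisymm (w (σ i))]
    ring
  rw [hX, prod_prod_eq_prod_diag_mul]
  simp only [crossSign, Finset.prod_mul_distrib] at *
  simp only [Int.cast_id] at hW
  rw [hW, hY]
  ring

theorem prod_rowOrderSign_eq (hE : ∀ i j, E i j → latAdj (v i) (w j)) {σ τ : Equiv.Perm (Fin N)}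
    (hσ : ∀ i, E i (σ i)) (hτ : ∀ i, E i (τ i)) :
    ∏ i, rowOrderSign (v i) (w (σ i)) = ∏ i, rowOrderSign (v i) (w (τ i)) := by
  refine prod_eq_prod_of_sum_eq _ _ _ (fun i => rowOrderSign_eq_one_or (hE _ _ (hσ i)))
    (fun i => rowOrderSign_eq_one_or (hE _ _ (hτ i))) ?_
  simp_rw [rowOrderSign_of_latAdj (hE _ _ (hσ _)), rowOrderSign_of_latAdj (hE _ _ (hτ _)),
    Finset.sum_sub_distrib]
  rw [Equiv.sum_comp σ (fun j => (w j).1 + (w j).2), Equiv.sum_comp τ (fun j => (w j).1 + (w j).2)]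

/-- All perfect matchings contribute with the same sign to the determinant of the
Kasteleyn–Wilson matrix. -/
theorem sign_mul_prod_kastEntry_eq
    (hv : Function.Injective v) (hw : Function.Injective w) (hvw : ∀ i j, v i ≠ w j)
    (hE : ∀ i j, E i j → latAdj (v i) (w j)) {σ τ : Equiv.Perm (Fin N)}
    (hσ : ∀ i, E i (σ i)) (hτ : ∀ i, E i (τ i)) :
    (Equiv.Perm.sign σ : ℤ) * ∏ i, kastEntry N v w E i (σ i) =
      Equiv.Perm.sign τ * ∏ i, kastEntry N v w E i (τ i) := by
  have hσ₁ := prod_kastEntry_mul_prod_crossSign hv hw hvw hE hσ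
  have hτ₁ := prod_kastEntry_mul_prod_crossSign hv hw hvw hE hτ
  have hσ₂ := prod_rowOrderSign_mul_prod_crossSign v w σ
  have hτ₂ := prod_rowOrderSign_mul_prod_crossSign v w τ
  rw [prod_stackSign_eq hE hσ] at hσ₁
  rw [prod_stackSign_eq hE hτ, ← hσ₁] at hτ₁
  rw [prod_rowOrderSign_eq hE hσ hτ] at hσ₂
  have hne : (∏ i, ∏ j ∈ Finset.Ioi i, rowOrderSign (v i) (v j)) *
        (∏ i, ∏ j ∈ Finset.Ioi i, rowOrderSign (w i) (w j)) *
        (∏ i : Fin N, ∏ _j ∈ Finset.Ioi i, (-1)) * ∏ i, ∏ j, rowOrderSign (v i) (w j) ≠ 0 := by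
    refine mul_ne_zero (mul_ne_zero (mul_ne_zero ?_ ?_) ?_) ?_ <;>
      refine Finset.prod_ne_zero_iff.2 fun i _ => Finset.prod_ne_zero_iff.2 fun j hj => ?_
    · exact rowOrderSign_ne_zero (hv.ne (Finset.mem_Ioi.1 hj).ne)
    · exact rowOrderSign_ne_zero (hw.ne (Finset.mem_Ioi.1 hj).ne)
    · norm_num
    · exact rowOrderSign_ne_zero (hvw i j)
  refine mul_right_cancel₀ hne ?_
  rw [mul_right_comm, ← hσ₂, mul_right_comm _ _ (_ * _), ← hτ₂]
  linear_combination (- ∏ i, rowOrderSign (v i) (w (τ i))) * hτ₁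

end Constancy

theorem kastEntry_of_not {N : ℕ} {v w : Fin N → ℤ × ℤ} {E : Fin N → Fin N → Prop} {i j : Fin N}
    (h : ¬ E i j) : kastEntry N v w E i j = 0 := if_neg h

theorem abs_kastEntry {N : ℕ} {v w : Fin N → ℤ × ℤ} {E : Fin N → Fin N → Prop} {i j : Fin N}
    (h : E i j) : |kastEntry N v w E i j| = 1 := by
  rw [kastEntry, if_pos h]
  split_ifs <;> simp

/-- If all nonzero terms of a determinant equal one common sign, then the absolute value of the
determinant is the number of these terms. -/
theorem abs_det_eq_natCard {n : ℕ} (M : Matrix (Fin n) (Fin n) ℤ) (P : Fin n → Fin n → Prop)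
    (h₀ : ∀ i j, ¬ P i j → M i j = 0) (h₁ : ∀ i j, P i j → |M i j| = 1)
    (hc : ∀ σ τ : Equiv.Perm (Fin n), (∀ i, P i (σ i)) → (∀ i, P i (τ i)) →
      (Equiv.Perm.sign σ : ℤ) * ∏ i, M i (σ i) = Equiv.Perm.sign τ * ∏ i, M i (τ i)) :
    |M.det| = Nat.card {σ : Equiv.Perm (Fin n) // ∀ i, P i (σ i)} := by
  have hdet : M.det = ∑ σ : Equiv.Perm (Fin n) with ∀ i, P i (σ i),
      (Equiv.Perm.sign σ : ℤ) * ∏ i, M i (σ i) := by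
    rw [← Matrix.det_transpose, Matrix.det_apply', Finset.sum_filter]
    refine Finset.sum_congr rfl fun σ _ => ?_
    split_ifs with h
    · rfl
    · push Not at h
      obtain ⟨i, hi⟩ := h
      exact mul_eq_zero_of_right _ (Finset.prod_eq_zero (Finset.mem_univ i) (h₀ i (σ i) hi))
  rw [Nat.card_eq_fintype_card, Fintype.card_subtype, hdet]
  by_cases hne : ∃ τ : Equiv.Perm (Fin n), ∀ i, P i (τ i)
  · obtain ⟨τ, hτ⟩ := hne
    rw [Finset.sum_congr rfl fun σ hσ => hc σ τ (Finset.mem_filter.1 hσ).2 hτ, Finset.sum_const,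
      nsmul_eq_mul, abs_mul, abs_mul, Finset.abs_prod]
    simp [h₁ _ _ (hτ _)]
  · rw [Finset.filter_false_of_mem fun σ _ hσ => hne ⟨σ, hσ⟩]
    simp

/-- The enumeration of a type by two injections with complementary ranges. -/
noncomputable def sumEquivOfRange {α β γ : Type*} (r : α → γ) (b : β → γ)
    (hr : Function.Injective r) (hb : Function.Injective b)
    (h : Set.range r = (Set.range b)ᶜ) : α ⊕ β ≃ γ :=
  Equiv.ofBijective (Sum.elim r b) <| by
    refine ⟨hr.sumElim hb fun x y e => ?_, fun z => ?_⟩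
    · have : r x ∈ (Set.range b)ᶜ := h ▸ Set.mem_range_self x
      exact this ⟨y, e.symm⟩
    · by_cases hz : z ∈ Set.range b
      · obtain ⟨y, rfl⟩ := hz
        exact ⟨Sum.inr y, rfl⟩
      · obtain ⟨x, rfl⟩ : z ∈ Set.range r := h ▸ hz
        exact ⟨Sum.inl x, rfl⟩

/-- The matching of `latGraph N E` that joins row `r p` to column `s (π p)`. -/
def permMatching {N n : ℕ} (E : Fin N → Fin N → Prop) (r s : Fin n → Fin N)
    (π : Equiv.Perm (Fin n)) (hπ : ∀ p, E (r p) (s (π p))) : (latGraph N E).Subgraph where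
  verts := Set.range (Sum.inl ∘ r) ∪ Set.range (Sum.inr ∘ s)
  Adj x y := ∃ p, (x = Sum.inl (r p) ∧ y = Sum.inr (s (π p))) ∨
    (x = Sum.inr (s (π p)) ∧ y = Sum.inl (r p))
  adj_sub := by
    rintro x y ⟨p, ⟨rfl, rfl⟩ | ⟨rfl, rfl⟩⟩
    · exact Or.inl ⟨_, _, rfl, rfl, hπ p⟩
    · exact Or.inr ⟨_, _, rfl, rfl, hπ p⟩
  edge_vert := by
    rintro x y ⟨p, ⟨rfl, rfl⟩ | ⟨rfl, rfl⟩⟩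
    · exact Or.inl ⟨p, rfl⟩
    · exact Or.inr ⟨π p, rfl⟩
  symm := by
    constructor
    rintro x y ⟨p, h⟩
    exact ⟨p, by tauto⟩

theorem permMatching_isMatching {N n : ℕ} {E : Fin N → Fin N → Prop} {r s : Fin n → Fin N}
    (hr : Function.Injective r) (hs : Function.Injective s)
    {π : Equiv.Perm (Fin n)} (hπ : ∀ p, E (r p) (s (π p))) :
    (permMatching E r s π hπ).IsMatching := by
  rintro x (⟨p, rfl⟩ | ⟨q, rfl⟩)
  · refine ⟨Sum.inr (s (π p)), ⟨p, Or.inl ⟨rfl, rfl⟩⟩, ?_⟩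
    rintro y ⟨p', ⟨h, rfl⟩ | ⟨h, rfl⟩⟩
    · rw [hr (Sum.inl_injective h)]
    · cases h
  · refine ⟨Sum.inl (r (π.symm q)), ⟨π.symm q, Or.inr ⟨by simp, rfl⟩⟩, ?_⟩
    rintro y ⟨p', ⟨h, rfl⟩ | ⟨h, rfl⟩⟩
    · cases h
    · rw [hs (Sum.inr_injective h), Equiv.symm_apply_apply]

theorem exists_permMatching_eq {N n : ℕ} {E : Fin N → Fin N → Prop} {r s : Fin n → Fin N}
    (hr : Function.Injective r) {M : (latGraph N E).Subgraph}
    (hM : M.verts = Set.range (Sum.inl ∘ r) ∪ Set.range (Sum.inr ∘ s)) (hm : M.IsMatching) :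
    ∃ π hπ, permMatching E r s π hπ = M := by
  have hex : ∀ p, ∃ q, M.Adj (Sum.inl (r p)) (Sum.inr (s q)) := by
    intro p
    obtain ⟨y, hy, -⟩ := hm (v := Sum.inl (r p)) (hM ▸ Or.inl ⟨p, rfl⟩)
    rcases M.adj_sub hy with ⟨i, j, h, rfl, -⟩ | ⟨i, j, h, rfl, -⟩
    · rcases hM ▸ M.edge_vert hy.symm with ⟨q, hq⟩ | ⟨q, hq⟩
      · cases hq
      · exact ⟨q, by rw [← hq] at hy; exact hy⟩
    · cases h
  choose f hf using hex
  have hinj : Function.Injective f := fun p p' h =>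
    hr (Sum.inl_injective (hm.eq_of_adj_right (hf p) (h ▸ hf p')))
  refine ⟨Equiv.ofBijective f (Finite.injective_iff_bijective.1 hinj), fun p => ?_, ?_⟩
  · rcases M.adj_sub (hf p) with ⟨i, j, h, h', he⟩ | ⟨i, j, h, h', he⟩
    · rw [Sum.inl_injective h]
      exact Sum.inr_injective h' ▸ he
    · cases h
  · have hone : ∀ x y, M.Adj (Sum.inl x) y → ∃ p, x = r p ∧ y = Sum.inr (s (f p)) := by
      intro x y h
      rcases hM ▸ M.edge_vert h with ⟨p, hp⟩ | ⟨p, hp⟩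
      · cases hp
        exact ⟨p, rfl, hm.eq_of_adj_left h (hf p)⟩
      · cases hp
    refine SimpleGraph.Subgraph.ext hM.symm ?_
    ext x y
    constructor
    · rintro ⟨p, ⟨rfl, rfl⟩ | ⟨rfl, rfl⟩⟩
      · exact hf p
      · exact (hf p).symm
    · intro h
      rcases x with x | x
      · obtain ⟨p, rfl, rfl⟩ := hone x y h
        exact ⟨p, Or.inl ⟨rfl, rfl⟩⟩
      · rcases M.adj_sub h with ⟨i, j, h', -⟩ | ⟨i, j, h', rfl, -⟩
        · cases h'
        · obtain ⟨p, rfl, hp⟩ := hone _ _ h.symm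
          exact ⟨p, Or.inr ⟨hp, rfl⟩⟩

theorem matchCount_eq_natCard {N n : ℕ} {E : Fin N → Fin N → Prop} {r s : Fin n → Fin N}
    (hr : Function.Injective r) (hs : Function.Injective s) :
    matchCount (latGraph N E) (Set.range (Sum.inl ∘ r) ∪ Set.range (Sum.inr ∘ s)) =
      Nat.card {π : Equiv.Perm (Fin n) // ∀ p, E (r p) (s (π p))} := by
  refine (Nat.card_congr (Equiv.ofBijective (fun π => ⟨permMatching E r s π.1 π.2, rfl,
    permMatching_isMatching hr hs π.2⟩) ⟨?_, ?_⟩)).symm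
  · rintro ⟨π, hπ⟩ ⟨π', hπ'⟩ h
    refine Subtype.ext (Equiv.ext fun p => ?_)
    have hadj : (permMatching E r s π' hπ').Adj (Sum.inl (r p)) (Sum.inr (s (π p))) := by
      rw [← show permMatching E r s π hπ = permMatching E r s π' hπ' from congrArg Subtype.val h]
      exact ⟨p, Or.inl ⟨rfl, rfl⟩⟩
    obtain ⟨p', ⟨h₁, h₂⟩ | ⟨h₁, -⟩⟩ := hadj
    · rw [hr (Sum.inl_injective h₁)] at h₂ ⊢
      exact hs (Sum.inr_injective h₂)
    · cases h₁
  · rintro ⟨M, hM, hm⟩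
    obtain ⟨π, hπ, rfl⟩ := exists_permMatching_eq hr hM hm
    exact ⟨⟨π, hπ⟩, rfl⟩

theorem compl_range_inl_union_range_inr {α β α' β' γ δ : Type*} {b : α → γ} {c : β → δ}
    {r : α' → γ} {s : β' → δ} (hr : Set.range r = (Set.range b)ᶜ)
    (hs : Set.range s = (Set.range c)ᶜ) :
    (Set.range (Sum.inl ∘ b) ∪ Set.range (Sum.inr ∘ c) : Set (γ ⊕ δ))ᶜ =
      Set.range (Sum.inl ∘ r) ∪ Set.range (Sum.inr ∘ s) := by
  ext (x | x)
  · have := Set.ext_iff.1 hr x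
    simpa using this.symm
  · have := Set.ext_iff.1 hs x
    simpa using this.symm

/-- If `e 1, …, e m` are pairwise vertex-disjoint edges of `G`, with `e s` joining the white
vertex `v (b s)` to the black vertex `w (c s)`, then the number of perfect matchings of the
induced subgraph of `G` on the complement of these `2m` vertices equals the absolute value of
the determinant of the `(N-m)×(N-m)` submatrix of the Kasteleyn–Wilson matrix obtained by
deleting rows `b 1, …, b m` and columns `c 1, …, c m` (here `r` and `s` are the increasing
enumerations of the remaining rows and columns). -/
theorem kasteleyn_wilson_minor (N m : ℕ) (v w : Fin N → ℤ × ℤ) (E : Fin N → Fin N → Prop)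
    (hwhite : ∀ i, Even ((v i).1 + (v i).2)) (hblack : ∀ j, Odd ((w j).1 + (w j).2))
    (hv : Function.Injective v) (hw : Function.Injective w)
    (hE : ∀ i j, E i j → latAdj (v i) (w j))
    (b c : Fin m → Fin N) (hb : Function.Injective b) (hc : Function.Injective c)
    (hbc : ∀ s, E (b s) (c s))
    (r : Fin (N - m) → Fin N) (s : Fin (N - m) → Fin N)
    (hr : StrictMono r) (hs : StrictMono s)
    (hrrange : Set.range r = (Set.range b)ᶜ) (hsrange : Set.range s = (Set.range c)ᶜ) :
    (matchCount (latGraph N E)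
        ((Set.range (Sum.inl ∘ b) ∪ Set.range (Sum.inr ∘ c))ᶜ) : ℤ)
      = |(Matrix.of fun p q : Fin (N - m) => kastEntry N v w E (r p) (s q)).det| := by
  have hvw : ∀ i j, v i ≠ w j := fun i j h =>
    Int.not_even_iff_odd.2 (hblack j) (h ▸ hwhite i)
  rw [compl_range_inl_union_range_inr hrrange hsrange,
    matchCount_eq_natCard hr.injective hs.injective]
  refine (abs_det_eq_natCard _ (fun p q => E (r p) (s q)) (fun i j h => kastEntry_of_not h)
    (fun i j h => abs_kastEntry h) fun σ τ hσ hτ => ?_).symm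
  let e := sumEquivOfRange r b hr.injective hb hrrange
  let e' := sumEquivOfRange s c hs.injective hc hsrange
  let ext (π : Equiv.Perm (Fin (N - m))) : Equiv.Perm (Fin N) :=
    (e.symm.trans ((Equiv.Perm.sumCongr π 1).trans e) : Equiv.Perm (Fin N)).trans (e.symm.trans e')
  have hl : ∀ π p, ext π (r p) = s (π p) := fun π p => by
    have : r p = e (Sum.inl p) := rfl
    simp [ext, this]
    rfl
  have hrt : ∀ π t, ext π (b t) = c t := fun π t => by
    have : b t = e (Sum.inr t) := rfl
    simp [ext, this]
    rfl
  have hext : ∀ π, (∀ p, E (r p) (s (π p))) → ∀ i, E i (ext π i) := by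
    intro π hπ i
    obtain ⟨p | t, rfl⟩ := e.surjective i
    · exact (hl π p).symm ▸ hπ p
    · exact (hrt π t).symm ▸ hbc t
  have hprod : ∀ π, ∏ i, kastEntry N v w E i (ext π i) =
      (∏ p, kastEntry N v w E (r p) (s (π p))) * ∏ t, kastEntry N v w E (b t) (c t) := by
    intro π
    rw [← Equiv.prod_comp e, Fintype.prod_sum_type]
    congr 1
    · exact Finset.prod_congr rfl fun p _ => congrArg _ (hl π p)
    · exact Finset.prod_congr rfl fun t _ => congrArg _ (hrt π t)
  have hsign : ∀ π, Equiv.Perm.sign (ext π) =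
      Equiv.Perm.sign (e.symm.trans e') * Equiv.Perm.sign π := by
    intro π
    rw [Equiv.Perm.sign_trans, ← Equiv.trans_assoc, Equiv.Perm.sign_symm_trans_trans,
      Equiv.Perm.sign_sumCongr, Equiv.Perm.sign_one, mul_one]
  have key := sign_mul_prod_kastEntry_eq hv hw hvw hE (hext σ hσ) (hext τ hτ)
  rw [hprod, hprod, hsign, hsign] at key
  push_cast at key
  have hne : ∏ t, kastEntry N v w E (b t) (c t) ≠ 0 := Finset.prod_ne_zero_iff.2 fun t _ h => by
    simpa [h] using abs_kastEntry (v := v) (w := w) (hbc t)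
  refine mul_left_cancel₀ (mul_ne_zero (Equiv.Perm.sign (e.symm.trans e')).ne_zero hne) ?_
  linear_combination key
end

section
/- (EKLP Lemma, second part.) For all integers n ≥ 1, 1 ≤ m ≤ n and 1 ≤ y_1 < y_2 < ... < y_m ≤ n, the number of perfect matchings of the n×m white-edged Aztec rectangle with teeth at y_1,...,y_m equals 2^{m(m+1)/2} · (∏_{1 ≤ i < j ≤ m} (y_j - y_i)) / (∏_{k=1}^{m-1} k!). -/
open scoped Classical

/-- Adjacency between the coordinates of a white vertex `p` and a black vertex `q` in the
(tilted) square grid: the black vertex `(i',j')` is adjacent to the white vertex `(i,j)`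
iff `i' ∈ {i, i+1}` and `j' ∈ {j-1, j}`. -/
def adjC (p q : ℕ × ℕ) : Prop :=
  (q.1 = p.1 ∨ q.1 = p.1 + 1) ∧ (q.2 + 1 = p.2 ∨ q.2 = p.2)

/-- The bipartite grid graph on `Bool × ℕ × ℕ`: `(false, p)` is a white vertex with
coordinates `p`, `(true, q)` is a black vertex with coordinates `q`. -/
def coloredGrid : SimpleGraph (Bool × ℕ × ℕ) where
  Adj u v := (u.1 = false ∧ v.1 = true ∧ adjC u.2 v.2) ∨
             (v.1 = false ∧ u.1 = true ∧ adjC v.2 u.2)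
  symm := by constructor; intro u v h; tauto
  loopless := by constructor; intro u h; rcases h with ⟨h1, h2, -⟩ | ⟨h1, h2, -⟩ <;> simp [h1] at h2

/-- Vertex set of the `n × m` black-edged Aztec rectangle with the given set of dents:
white vertices `(i,j)` with `1 ≤ i ≤ n`, `1 ≤ j ≤ m`; black vertices `(i,j)` with
`1 ≤ i ≤ n+1`, `1 ≤ j ≤ m-1`, together with the black vertices `(i,m)`, `1 ≤ i ≤ n+1`,
for `i` not a dent. -/
def blackRectVerts (n m : ℕ) (dents : Set ℕ) : Set (Bool × ℕ × ℕ) :=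
  {v | (v.1 = false ∧ 1 ≤ v.2.1 ∧ v.2.1 ≤ n ∧ 1 ≤ v.2.2 ∧ v.2.2 ≤ m) ∨
       (v.1 = true ∧ 1 ≤ v.2.1 ∧ v.2.1 ≤ n + 1 ∧
         ((1 ≤ v.2.2 ∧ v.2.2 ≤ m - 1) ∨ (v.2.2 = m ∧ v.2.1 ∉ dents)))}

/-- Vertex set of the `n × m` white-edged Aztec rectangle with the given set of teeth:
white vertices `(i,j)` with `1 ≤ i ≤ n`, `1 ≤ j ≤ m`, together with the white vertices
`(i, m+1)` for `i` a tooth; black vertices `(i,j)` with `1 ≤ i ≤ n+1`, `1 ≤ j ≤ m`. -/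
def whiteRectVerts (n m : ℕ) (teeth : Set ℕ) : Set (Bool × ℕ × ℕ) :=
  {v | (v.1 = false ∧ ((1 ≤ v.2.1 ∧ v.2.1 ≤ n ∧ 1 ≤ v.2.2 ∧ v.2.2 ≤ m) ∨
         (v.2.2 = m + 1 ∧ v.2.1 ∈ teeth))) ∨
       (v.1 = true ∧ 1 ≤ v.2.1 ∧ v.2.1 ≤ n + 1 ∧ 1 ≤ v.2.2 ∧ v.2.2 ≤ m)}

/-- The binomial determinant `det (z i choose j)`. -/
def chooseDet {m : ℕ} (z : Fin m → ℕ) : ℚ :=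
  (Matrix.of fun i j : Fin m => ((z i).choose j : ℚ)).det

theorem chooseDet_eq_zero_of_not_injective {m : ℕ} {z : Fin m → ℕ}
    (hz : ¬ Function.Injective z) : chooseDet z = 0 := by
  simp only [Function.Injective, not_forall] at hz
  obtain ⟨i, j, hij, hne⟩ := hz
  exact Matrix.det_zero_of_row_eq hne (by ext k; simp [hij])

theorem sum_piFinset_chooseDet {m : ℕ} (A : Fin m → Finset ℕ) :
    ∑ z ∈ Fintype.piFinset A, chooseDet z =
      (Matrix.of fun i j : Fin m => ∑ t ∈ A i, (t.choose j : ℚ)).det := by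
  have h := (Matrix.detRowAlternating (n := Fin m) (R := ℚ)).toMultilinearMap.map_sum_finset
    (fun _ t => fun j : Fin m => (t.choose j : ℚ)) A
  have e : (Matrix.of fun i j : Fin m => ∑ t ∈ A i, (t.choose j : ℚ)) =
      fun i => ∑ t ∈ A i, fun j : Fin m => (t.choose j : ℚ) := by
    ext i j
    simp [Finset.sum_apply]
  rw [e]
  exact h.symm

theorem sum_chooseDet_pair {m : ℕ} (y : Fin m → ℕ) :
    ∑ z ∈ Fintype.piFinset (fun i => ({y i, y i + 1} : Finset ℕ)), chooseDet z =
      2 ^ m * chooseDet y := by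
  rw [sum_piFinset_chooseDet, chooseDet]
  have e : (Matrix.of fun i j : Fin m => ∑ t ∈ ({y i, y i + 1} : Finset ℕ), (t.choose j : ℚ)) =
      (Matrix.of fun i j : Fin m => ((y i).choose j : ℚ)) *
        (Matrix.of fun k j : Fin m => if k = j then (2 : ℚ) else
          if (k : ℕ) + 1 = j then 1 else 0) := by
    ext i j
    rw [Matrix.mul_apply]
    have hsplit : ∀ k : Fin m, (if k = j then (2 : ℚ) else if (k : ℕ) + 1 = j then 1 else 0) =
        (if k = j then 2 else 0) + (if (k : ℕ) + 1 = j then 1 else 0) := by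
      intro k
      by_cases hk : k = j
      · subst hk; simp
      · simp [hk]
    simp only [Matrix.of_apply, hsplit, mul_add, Finset.sum_add_distrib]
    rw [Finset.sum_pair (by omega)]
    obtain ⟨j, hj⟩ := j
    cases j with
    | zero => simp; norm_num
    | succ j =>
      have : ∑ k : Fin m, ((y i).choose k : ℚ) * (if (k : ℕ) + 1 = j + 1 then 1 else 0) =
          (y i).choose j := by
        rw [Finset.sum_eq_single ⟨j, by omega⟩]
        · simp
        · intro b _ hb
          have : (b : ℕ) ≠ j := fun h => hb (Fin.ext h)
          simp [this]
        · simp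
      rw [this]
      simp [Nat.choose_succ_succ]
      ring
  rw [e, Matrix.det_mul, mul_comm, Matrix.det_of_isUpperTriangular]
  · simp
  · intro i j hij
    have hij' : j < i := hij
    have h1 : i ≠ j := hij'.ne'
    have h2 : (i : ℕ) + 1 ≠ j := by have := Fin.lt_def.mp hij'; omega
    simp [h1, h2]

theorem sum_choose_Ico {a b : ℕ} (hab : a ≤ b) (k : ℕ) :
    ∑ t ∈ Finset.Ico a b, (t.choose k : ℚ) = b.choose (k + 1) - a.choose (k + 1) := by
  induction b, hab using Nat.le_induction with
  | base => simp
  | succ b hb ih =>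
    rw [Finset.sum_Ico_succ_top hb, ih, Nat.choose_succ_succ]
    push_cast
    ring

theorem sum_chooseDet_interlacing {m : ℕ} (b : Fin (m + 1) → ℕ) (hb : Monotone b) :
    ∑ x ∈ Fintype.piFinset (fun j : Fin m => Finset.Ico (b j.castSucc) (b j.succ)), chooseDet x =
      chooseDet b := by
  rw [sum_piFinset_chooseDet, chooseDet]
  let B : Matrix (Fin (m + 1)) (Fin (m + 1)) ℚ := Matrix.of (Fin.cons
    (fun j : Fin (m + 1) => ((b 0).choose j : ℚ)) fun i j =>
      ((b i.succ).choose j : ℚ) - ((b i.castSucc).choose j : ℚ))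
  rw [Matrix.det_eq_of_forall_row_eq_smul_add_pred (B := B) (fun _ => 1)
    (by intro j; simp [B]) (by intro i j; simp [B]), Matrix.det_succ_column_zero,
    Finset.sum_eq_single 0]
  · simp only [B, Fin.val_zero, pow_zero, one_mul, Matrix.of_apply, Fin.cons_zero,
      Nat.choose_zero_right, Nat.cast_one]
    congr 1
    ext i j
    simp [sum_choose_Ico (hb i.castSucc_le_succ)]
  · intro i _ hi
    obtain ⟨i, rfl⟩ := Fin.exists_succ_eq.mpr hi
    simp [B]
  · simp

theorem chooseDet_eq {m : ℕ} (y : Fin m → ℕ) :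
    chooseDet y = (∏ p ∈ Finset.univ.filter (fun p : Fin m × Fin m => p.1 < p.2),
        ((y p.2 : ℚ) - (y p.1 : ℚ))) / ∏ k ∈ Finset.Icc 1 (m - 1), (Nat.factorial k : ℚ) := by
  have hfac : ∏ k ∈ Finset.Icc 1 (m - 1), (Nat.factorial k : ℚ) =
      ∏ k : Fin m, (Nat.factorial k : ℚ) := by
    rw [Fin.prod_univ_eq_prod_range (fun k => (Nat.factorial k : ℚ))]
    cases m with
    | zero => simp
    | succ m =>
      rw [← Nat.cast_prod, ← Nat.cast_prod, Nat.prod_range_succ_factorial, Nat.add_sub_cancel,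
        Nat.prod_Icc_factorial]
  have hvan : (∏ p ∈ Finset.univ.filter (fun p : Fin m × Fin m => p.1 < p.2),
      ((y p.2 : ℚ) - (y p.1 : ℚ))) = (Matrix.vandermonde fun i => (y i : ℚ)).det := by
    rw [Matrix.det_vandermonde, Finset.prod_sigma']
    refine Finset.prod_bij' (fun p _ => ⟨p.1, p.2⟩) (fun p _ => (p.1, p.2)) ?_ ?_ ?_ ?_ ?_ <;>
      simp
  rw [hfac, hvan, Matrix.det_eval_matrixOfPolynomials_eq_det_vandermonde _
    (fun j : Fin m => descPochhammer ℚ j) (fun j => descPochhammer_natDegree ℚ j)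
    (fun j => monic_descPochhammer ℚ j), eq_div_iff (by positivity), chooseDet, mul_comm,
    ← Matrix.det_mul_row]
  congr 1
  ext i j
  simp [descPochhammer_eval_eq_descFactorial, Nat.descFactorial_eq_factorial_mul_choose]

/-- Perfect matchings of the subgraph induced on `S`, encoded as the involution sending every
vertex of `S` to its partner and fixing all other vertices. -/
def matchingMaps {V : Type*} (G : SimpleGraph V) (S : Set V) : Set (V → V) :=
  {p | (∀ v ∈ S, p v ∈ S ∧ G.Adj v (p v) ∧ p (p v) = v) ∧ ∀ v ∉ S, p v = v}

theorem matchCount_eq_card_matchingMaps {V : Type*} (G : SimpleGraph V) (S : Set V) :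
    matchCount G S = Nat.card (matchingMaps G S) := by
  symm
  refine Nat.card_eq_of_bijective (fun p => ⟨
    { verts := S
      Adj := fun v w => v ∈ S ∧ p.1 v = w
      adj_sub := ?_
      edge_vert := fun h => h.1
      symm := ⟨?_⟩ }, rfl, ?_⟩) ⟨?_, ?_⟩
  · rintro v w ⟨hv, rfl⟩
    exact (p.2.1 v hv).2.1
  · rintro v w ⟨hv, rfl⟩
    exact ⟨(p.2.1 v hv).1, (p.2.1 v hv).2.2⟩
  · intro v hv
    exact ⟨p.1 v, ⟨hv, rfl⟩, fun w hw => hw.2.symm⟩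
  · rintro ⟨p, hp⟩ ⟨q, hq⟩ h
    simp only [Subtype.mk.injEq, SimpleGraph.Subgraph.mk.injEq, true_and] at h
    refine Subtype.ext (funext fun v => ?_)
    by_cases hv : v ∈ S
    · have := congrFun (congrFun h v) (p v)
      simp only [hv, true_and, eq_iff_iff, true_iff] at this
      exact this.symm
    · exact (hp.2 v hv).trans (hq.2 v hv).symm
  · rintro ⟨M, hMS, hM⟩
    subst hMS
    have hex : ∀ v, ∃ w, (v ∈ M.verts → M.Adj v w) ∧ (v ∉ M.verts → w = v) := by
      intro v
      by_cases hv : v ∈ M.verts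
      · obtain ⟨w, hw, -⟩ := hM hv
        exact ⟨w, fun _ => hw, fun h => absurd hv h⟩
      · exact ⟨v, fun h => absurd h hv, fun _ => rfl⟩
    choose p hp hp' using hex
    refine ⟨⟨p, fun v hv => ⟨?_, (hp v hv).adj_sub, ?_⟩, hp'⟩, ?_⟩
    · exact M.edge_vert (hp v hv).symm
    · have hpv := M.edge_vert (hp v hv).symm
      exact (hM hpv).unique (hp _ hpv) (hp v hv).symm
    · refine Subtype.ext (SimpleGraph.Subgraph.ext rfl ?_)
      ext v w
      constructor
      · rintro ⟨hv, rfl⟩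
        exact hp v hv
      · intro h
        exact ⟨M.edge_vert h, (hM (M.edge_vert h)).unique (hp v (M.edge_vert h)) h⟩

theorem finite_matchingMaps {V : Type*} (G : SimpleGraph V) {S : Set V} (hS : S.Finite) :
    Finite (matchingMaps G S) := by
  have := hS.to_subtype
  refine Finite.of_injective
    (fun (p : matchingMaps G S) (v : S) => (⟨p.1 v, (p.2.1 v v.2).1⟩ : S)) ?_
  rintro ⟨p, hp⟩ ⟨q, hq⟩ h
  refine Subtype.ext (funext fun v => ?_)
  by_cases hv : v ∈ S
  · simpa using congrFun h ⟨v, hv⟩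
  · exact (hp.2 v hv).trans (hq.2 v hv).symm

theorem matchCount_empty {V : Type*} (G : SimpleGraph V) : matchCount G ∅ = 1 := by
  rw [matchCount_eq_card_matchingMaps]
  have : matchingMaps G ∅ = {id} := by
    ext p
    simp [matchingMaps, funext_iff]
  rw [this]
  simp

/-- Sum over the possible partners of an independent family of vertices `t i`. The neighbours of
`t i` in `S` are labelled injectively as `e k` with `k ∈ C i`. -/
theorem matchCount_eq_sum_partners {V ι κ : Type*} [Fintype ι] [DecidableEq ι]
    [DecidablePred (Function.Injective : (ι → κ) → Prop)]
    (G : SimpleGraph V) {S : Set V} (hS : S.Finite) (t : ι → V) (ht : Function.Injective t)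
    (htS : ∀ i, t i ∈ S) (hind : ∀ i j, ¬ G.Adj (t i) (t j)) (e : κ → V)
    (he : Function.Injective e) (C : ι → Finset κ)
    (hC : ∀ i v, (v ∈ S ∧ G.Adj (t i) v) ↔ ∃ k ∈ C i, v = e k) :
    matchCount G S = ∑ b ∈ (Fintype.piFinset C).filter Function.Injective,
      matchCount G (S \ (Set.range t ∪ Set.range (e ∘ b))) := by
  simp only [matchCount_eq_card_matchingMaps]
  have hfin : ∀ b : {b // b ∈ (Fintype.piFinset C).filter Function.Injective},
      Finite (matchingMaps G (S \ (Set.range t ∪ Set.range (e ∘ b.1)))) :=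
    fun b => finite_matchingMaps G hS.sdiff
  rw [← Finset.sum_coe_sort, ← Nat.card_sigma]
  have hadj : ∀ b ∈ (Fintype.piFinset C).filter Function.Injective, ∀ i,
      e (b i) ∈ S ∧ G.Adj (t i) (e (b i)) := fun b hb i =>
    (hC i _).mpr ⟨b i, Fintype.mem_piFinset.mp (Finset.mem_filter.mp hb).1 i, rfl⟩
  have hinj : ∀ b ∈ (Fintype.piFinset C).filter Function.Injective,
      Function.Injective (e ∘ b) := fun b hb => he.comp (Finset.mem_filter.mp hb).2
  have hne : ∀ b ∈ (Fintype.piFinset C).filter Function.Injective, ∀ i j, t j ≠ e (b i) :=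
    fun b hb i j h => hind i j (h ▸ (hadj b hb i).2)
  let Φ : (ι → κ) → (V → V) → V → V := fun b q =>
    Function.extend t (e ∘ b) (Function.extend (e ∘ b) t q)
  have Φt : ∀ b q i, Φ b q (t i) = e (b i) := fun b q i => ht.extend_apply _ _ i
  have Φe : ∀ b ∈ (Fintype.piFinset C).filter Function.Injective, ∀ q i,
      Φ b q (e (b i)) = t i := by
    intro b hb q i
    have h1 : ¬ ∃ j, t j = e (b i) := fun ⟨j, hj⟩ => hne b hb i j hj
    simp only [Φ]
    rw [Function.extend_apply' _ _ _ h1]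
    exact (hinj b hb).extend_apply _ _ i
  have Φo : ∀ b q v, v ∉ Set.range t ∪ Set.range (e ∘ b) → Φ b q v = q v := by
    intro b q v hv
    simp only [Set.mem_union, not_or] at hv
    simp only [Φ]
    rw [Function.extend_apply' _ _ _ hv.1, Function.extend_apply' _ _ _ hv.2]
  symm
  refine Nat.card_eq_of_bijective (fun s => ⟨Φ s.1.1 s.2.1, ?_⟩) ⟨?_, ?_⟩
  · obtain ⟨⟨b, hb⟩, q, hq⟩ := s
    simp only at hq ⊢
    constructor
    · intro v hv
      by_cases hU : v ∈ Set.range t ∪ Set.range (e ∘ b)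
      · rcases hU with ⟨i, rfl⟩ | ⟨i, rfl⟩
        · rw [Φt, Φe b hb]
          exact ⟨(hadj b hb i).1, (hadj b hb i).2, rfl⟩
        · simp only [Function.comp_apply]
          rw [Φe b hb, Φt]
          exact ⟨htS i, (hadj b hb i).2.symm, rfl⟩
      · obtain ⟨h1, h2, h3⟩ := hq.1 v ⟨hv, hU⟩
        rw [Φo b q v hU, Φo b q _ h1.2]
        exact ⟨h1.1, h2, h3⟩
    · intro v hv
      have hU : v ∉ Set.range t ∪ Set.range (e ∘ b) := by
        rintro (⟨i, rfl⟩ | ⟨i, rfl⟩)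
        · exact hv (htS i)
        · exact hv (hadj b hb i).1
      rw [Φo b q v hU]
      exact hq.2 v fun h => hv h.1
  · rintro ⟨⟨b, hb⟩, q, hq⟩ ⟨⟨b', hb'⟩, q', hq'⟩ h
    have h' : Φ b q = Φ b' q' := congrArg Subtype.val h
    have hbb : b = b' := funext fun i => he (by rw [← Φt b q, h', Φt])
    subst hbb
    have hqq : q = q' := by
      funext v
      by_cases hU : v ∈ Set.range t ∪ Set.range (e ∘ b)
      · rw [hq.2 v fun h => h.2 hU, hq'.2 v fun h => h.2 hU]
      · rw [← Φo b q v hU, h', Φo b q' v hU]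
    subst hqq
    rfl
  · rintro ⟨p, hp⟩
    have hex : ∀ i, ∃ k ∈ C i, p (t i) = e k := fun i =>
      (hC i _).mp ⟨(hp.1 _ (htS i)).1, (hp.1 _ (htS i)).2.1⟩
    choose b hbC hbe using hex
    have hpe : ∀ i, p (e (b i)) = t i := fun i => by rw [← hbe, (hp.1 _ (htS i)).2.2]
    have hb : b ∈ (Fintype.piFinset C).filter Function.Injective := by
      refine Finset.mem_filter.mpr ⟨Fintype.mem_piFinset.mpr hbC, fun i j hij => ht ?_⟩
      rw [← hpe i, hij, hpe j]
    refine ⟨⟨⟨b, hb⟩, fun v => if v ∈ Set.range t ∪ Set.range (e ∘ b) then v else p v, ?_, ?_⟩,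
      Subtype.ext (funext fun v => ?_)⟩
    · rintro v ⟨hv, hU⟩
      obtain ⟨h1, h2, h3⟩ := hp.1 v hv
      have hU' : p v ∉ Set.range t ∪ Set.range (e ∘ b) := by
        rintro (⟨i, hi⟩ | ⟨i, hi⟩)
        · exact hU (Or.inr ⟨i, by rw [← h3, ← hi]; exact (hbe i).symm⟩)
        · exact hU (Or.inl ⟨i, by rw [← h3, ← hi]; exact (hpe i).symm⟩)
      simp only [if_neg hU, if_neg hU', h3]
      exact ⟨⟨h1, hU'⟩, h2, trivial⟩
    · intro v hv
      by_cases hU : v ∈ Set.range t ∪ Set.range (e ∘ b)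
      · simp only [if_pos hU]
      · simp only [if_neg hU]
        exact hp.2 v fun h => hv ⟨h, hU⟩
    · by_cases hU : v ∈ Set.range t ∪ Set.range (e ∘ b)
      · rcases hU with ⟨i, rfl⟩ | ⟨i, rfl⟩
        · exact (Φt _ _ i).trans (hbe i).symm
        · exact (Φe b hb _ i).trans (hpe i).symm
      · exact (Φo _ _ v hU).trans (if_neg hU)

/-- `shift b u i` is the partner of the black vertex at position `i`, in a row of black vertices
with dents `b`, when the segment between two consecutive dents is split at `u`. -/
noncomputable def shift {k : ℕ} (b u : Fin k → ℕ) (i : ℕ) : ℕ :=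
  if ∃ j, b j < i ∧ i ≤ u j then i - 1 else i

/-- The non-dent positions of a row of `n + 1` black vertices. -/
noncomputable def nonDents {k : ℕ} (n : ℕ) (b : Fin k → ℕ) : Finset ℕ :=
  (Finset.Icc 1 (n + 1)).filter (· ∉ Set.range b)

theorem mem_nonDents {k n i : ℕ} {b : Fin k → ℕ} :
    i ∈ nonDents n b ↔ (1 ≤ i ∧ i ≤ n + 1) ∧ ∀ j, b j ≠ i := by
  simp [nonDents]

theorem shift_mem {m n : ℕ} {b u : Fin (m + 1) → ℕ} (hb1 : ∀ j, 1 ≤ b j)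
    (hlast : u (Fin.last m) = n + 1) (hbu : ∀ j, b j ≤ u j) {i : ℕ} (hi : i ∈ nonDents n b) :
    (1 ≤ shift b u i ∧ shift b u i ≤ n) ∧ (shift b u i = i ∨ shift b u i + 1 = i) := by
  obtain ⟨⟨hi1, hin⟩, hne⟩ := mem_nonDents.mp hi
  unfold shift
  split_ifs with h
  · obtain ⟨j, hj, -⟩ := h
    have := hb1 j
    omega
  · have h' : ¬ (b (Fin.last m) < i ∧ i ≤ u (Fin.last m)) := fun hc => h ⟨Fin.last m, hc⟩
    have := hne (Fin.last m)
    have := hbu (Fin.last m)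
    omega

theorem shift_injOn {k n : ℕ} {b u : Fin k → ℕ} :
    Set.InjOn (shift b u) (nonDents n b) := by
  have key : ∀ i ∈ nonDents n b, ∀ l, i < l → shift b u i ≠ shift b u l := by
    intro i hi l hil heq
    obtain ⟨-, hne⟩ := mem_nonDents.mp hi
    unfold shift at heq
    split_ifs at heq with h1 h2 h2
    · omega
    · omega
    · obtain ⟨j, hj1, hj2⟩ := h2
      have := hne j
      exact h1 ⟨j, by omega, by omega⟩
    · omega
  intro i hi l hl heq
  rcases lt_trichotomy i l with h | h | h
  · exact absurd heq (key i hi l h)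
  · exact h
  · exact absurd heq.symm (key l hl i h)

theorem exists_shift_eq_iff {m n : ℕ} {b u : Fin (m + 1) → ℕ} (hb : StrictMono b)
    (hbu : ∀ j, b j ≤ u j) (hub : ∀ j l, j < l → u j < b l)
    {w : ℕ} (hw1 : 1 ≤ w) (hwn : w ≤ n) :
    (∃ i ∈ nonDents n b, shift b u i = w) ↔ ∀ j, u j ≠ w := by
  constructor
  · rintro ⟨i, hi, hiw⟩ j rfl
    obtain ⟨-, hne⟩ := mem_nonDents.mp hi
    unfold shift at hiw
    split_ifs at hiw with h
    · obtain ⟨l, hl1, hl2⟩ := h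
      rcases lt_or_ge j l with hjl | hjl
      · have := hub j l hjl
        omega
      · rcases hjl.lt_or_eq with hlj | rfl
        · have := hub l j hlj
          have := hbu j
          omega
        · omega
    · have := hne j
      have := hbu j
      exact h ⟨j, by omega, by omega⟩
  · intro hu
    by_cases h : ∃ j, b j < w + 1 ∧ w + 1 ≤ u j
    · refine ⟨w + 1, mem_nonDents.mpr ⟨by omega, fun l hl => ?_⟩, if_pos h⟩
      obtain ⟨j, hj1, hj2⟩ := h
      rcases lt_or_ge j l with hjl | hjl
      · have := hub j l hjl
        omega
      · have := hb.monotone hjl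
        omega
    · refine ⟨w, mem_nonDents.mpr ⟨by omega, fun l hl => ?_⟩, ?_⟩
      · have := hu l
        have := hbu l
        exact h ⟨l, by omega, by omega⟩
      · unfold shift
        rw [if_neg]
        rintro ⟨j, hj1, hj2⟩
        have := hu j
        exact h ⟨j, by omega, by omega⟩

/-- Every matching of the non-dents into a row of `n` white vertices is a `shift`. -/
theorem exists_eq_shift {m n : ℕ} {b : Fin (m + 1) → ℕ} (hb : StrictMono b)
    (hbn : ∀ j, 1 ≤ b j ∧ b j ≤ n + 1) (F : ℕ → ℕ)
    (hF : ∀ i ∈ nonDents n b, (1 ≤ F i ∧ F i ≤ n) ∧ (F i = i ∨ F i + 1 = i))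
    (hinj : Set.InjOn F (nonDents n b)) :
    ∃ x : Fin m → ℕ, (∀ j, b j.castSucc ≤ x j ∧ x j < b j.succ) ∧
      ∀ i ∈ nonDents n b, F i = shift b (Fin.snoc x (n + 1) : Fin (m + 1) → ℕ) i := by
  have up : ∀ i l, i ≤ l → (∀ k, i ≤ k → k ≤ l → k ∈ nonDents n b) → F i = i → F l = l := by
    intro i l hil
    induction l, hil using Nat.le_induction with
    | base => exact fun _ h => h
    | succ l hl ih =>
      intro hk hi
      have h := ih (fun k h1 h2 => hk k h1 (by omega)) hi
      rcases (hF (l + 1) (hk _ (by omega) le_rfl)).2 with h' | h'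
      · exact h'
      · have := hinj (hk l hl (by omega)) (hk _ (by omega) le_rfl) (by omega)
        omega
  have mid : ∀ j : Fin m, ∃ x, (b j.castSucc ≤ x ∧ x < b j.succ) ∧
      ∀ i, b j.castSucc < i → i < b j.succ → F i = if i ≤ x then i - 1 else i := by
    intro j
    have hlt := hb j.castSucc_lt_succ
    have hnd : ∀ i, b j.castSucc < i → i < b j.succ → i ∈ nonDents n b := by
      intro i h1 h2
      have := hbn j.succ
      refine mem_nonDents.mpr ⟨by omega, fun l hl => ?_⟩
      subst hl
      rw [hb.lt_iff_lt] at h1 h2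
      rw [Fin.lt_def] at h1 h2
      simp at h1 h2
      omega
    by_cases hex : ∃ i, b j.castSucc < i ∧ i < b j.succ ∧ F i = i
    · have hs := Nat.find_spec hex
      refine ⟨Nat.find hex - 1, by omega, fun i h1 h2 => ?_⟩
      split_ifs with hle
      · have := Nat.find_min hex (m := i) (by omega)
        have := (hF i (hnd i h1 h2)).2
        omega
      · exact up _ i (by omega) (fun k h3 h4 => hnd k (by omega) (by omega)) hs.2.2
    · refine ⟨b j.succ - 1, by omega, fun i h1 h2 => ?_⟩
      rw [if_pos (by omega)]
      have := (hF i (hnd i h1 h2)).2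
      have : F i ≠ i := fun h => hex ⟨i, h1, h2, h⟩
      omega
  choose x hx hFx using mid
  refine ⟨x, hx, fun i hi => ?_⟩
  obtain ⟨⟨hi1, hin⟩, hne⟩ := mem_nonDents.mp hi
  have hlow : (∀ j, i < b j) → F i = i := by
    intro h
    have hnd : ∀ k, 1 ≤ k → k ≤ i → k ∈ nonDents n b := fun k h1 h2 =>
      mem_nonDents.mpr ⟨by omega, fun l hl => by have := h l; omega⟩
    have := hF 1 (hnd 1 le_rfl hi1)
    exact up 1 i hi1 hnd (by omega)
  have hhigh : b (Fin.last m) < i → F i = i - 1 := by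
    intro h
    have hnd : ∀ k, i ≤ k → k ≤ n + 1 → k ∈ nonDents n b := fun k h1 h2 =>
      mem_nonDents.mpr ⟨by omega, fun l hl => by
        have := hb.monotone (Fin.le_last l); omega⟩
    have h1 := hF (n + 1) (hnd _ hin le_rfl)
    have h2 := (hF i hi).2
    have h3 := up i (n + 1) hin hnd
    omega
  unfold shift
  split_ifs with h
  · obtain ⟨j, hj1, hj2⟩ := h
    induction j using Fin.lastCases with
    | last => exact hhigh hj1
    | cast j =>
      rw [Fin.snoc_castSucc] at hj2
      rw [hFx j i hj1 (by have := hx j; omega), if_pos hj2]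
  · by_cases hex : ∃ j, b j < i
    · have hne' : (Finset.univ.filter fun j => b j < i).Nonempty := by
        obtain ⟨j, hj⟩ := hex
        exact ⟨j, by simp [hj]⟩
      obtain ⟨j, hj, hmax⟩ := Finset.exists_max_image _ id hne'
      simp only [Finset.mem_filter, Finset.mem_univ, true_and, id_eq] at hj hmax
      induction j using Fin.lastCases with
      | last => exact absurd ⟨Fin.last m, hj, by simpa using hin⟩ h
      | cast j =>
        have h1 : i < b j.succ := by
          by_contra hc
          have := hmax j.succ (by have := hne j.succ; omega)
          exact absurd this (not_le.mpr j.castSucc_lt_succ)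
        have h2 : ¬ i ≤ x j := fun hc => h ⟨j.castSucc, hj, by simpa using hc⟩
        rw [hFx j i hj h1, if_neg h2]
    · exact hlow fun j => by
        have := hne j
        have : ¬ b j < i := fun hc => hex ⟨j, hc⟩
        omega

theorem sum_nonDents_matchings {m n : ℕ} {b : Fin (m + 1) → ℕ} (hb : StrictMono b)
    (hbn : ∀ j, 1 ≤ b j ∧ b j ≤ n + 1) (g : Set ℕ → ℕ) :
    ∑ f ∈ (Fintype.piFinset fun i : nonDents n b =>
        (Finset.Icc 1 n).filter fun w => w = (i : ℕ) ∨ w + 1 = (i : ℕ)).filter Function.Injective,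
      g {w | (1 ≤ w ∧ w ≤ n) ∧ w ∉ Set.range f} =
    ∑ x ∈ Fintype.piFinset fun j : Fin m => Finset.Ico (b j.castSucc) (b j.succ),
      g (Set.range x) := by
  have hext : ∀ x ∈ Fintype.piFinset fun j : Fin m => Finset.Ico (b j.castSucc) (b j.succ),
      (∀ j, b j ≤ (Fin.snoc x (n + 1) : Fin (m + 1) → ℕ) j) ∧
      (∀ j l, j < l → (Fin.snoc x (n + 1) : Fin (m + 1) → ℕ) j < b l) ∧ StrictMono x := by
    intro x hx
    simp only [Fintype.mem_piFinset, Finset.mem_Ico] at hx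
    have hxb : ∀ (j : Fin m) l, j.castSucc < l → x j < b l := fun j l hjl =>
      (hx j).2.trans_le (hb.monotone (Fin.castSucc_lt_iff_succ_le.mp hjl))
    refine ⟨fun j => ?_, fun j l hjl => ?_, fun j l hjl => ?_⟩
    · induction j using Fin.lastCases with
      | last => simpa using (hbn _).2
      | cast j => simpa using (hx j).1
    · induction j using Fin.lastCases with
      | last => exact absurd hjl (not_lt.mpr (Fin.le_last l))
      | cast j => simpa using hxb j l hjl
    · exact (hxb j l.castSucc (by simpa using hjl)).trans_le (hx l).1
  have hrange : ∀ x ∈ Fintype.piFinset fun j : Fin m => Finset.Ico (b j.castSucc) (b j.succ),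
      {w | (1 ≤ w ∧ w ≤ n) ∧ w ∉ Set.range fun i : nonDents n b =>
        shift b (Fin.snoc x (n + 1) : Fin (m + 1) → ℕ) i} = Set.range x := by
    intro x hx
    obtain ⟨h1, h2, -⟩ := hext x hx
    simp only [Fintype.mem_piFinset, Finset.mem_Ico] at hx
    ext w
    have key := exists_shift_eq_iff (n := n) (w := w) hb h1 h2
    simp only [Set.mem_ofPred_eq, Set.mem_range, Subtype.exists, exists_prop]
    constructor
    · rintro ⟨⟨hw1, hwn⟩, hw⟩
      rw [key hw1 hwn] at hw
      push Not at hw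
      obtain ⟨j, hj⟩ := hw
      induction j using Fin.lastCases with
      | last => simp at hj; omega
      | cast j => exact ⟨j, by simpa using hj⟩
    · rintro ⟨j, rfl⟩
      have := hx j
      have := hbn j.castSucc
      have := hbn j.succ
      refine ⟨by omega, ?_⟩
      rw [key (by omega) (by omega)]
      exact fun h => h j.castSucc (Fin.snoc_castSucc ..)
  symm
  refine Finset.sum_bij (fun x _ => fun i : nonDents n b =>
    shift b (Fin.snoc x (n + 1) : Fin (m + 1) → ℕ) i) ?_ ?_ ?_ ?_
  · intro x hx
    obtain ⟨h1, h2, -⟩ := hext x hx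
    refine Finset.mem_filter.mpr ⟨Fintype.mem_piFinset.mpr fun i => ?_, fun i l hil => ?_⟩
    · simpa using shift_mem (fun j => (hbn j).1) (Fin.snoc_last ..) h1 i.2
    · exact Subtype.ext (shift_injOn i.2 l.2 hil)
  · intro x hx x' hx' h
    refine ((hext x hx).2.2.range_inj (hext x' hx').2.2).mp ?_
    rw [← hrange x hx, ← hrange x' hx', h]
  · intro f hf
    simp only [Finset.mem_filter, Fintype.mem_piFinset, Finset.mem_Icc] at hf
    let F : ℕ → ℕ := fun i => if h : i ∈ nonDents n b then f ⟨i, h⟩ else 0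
    have hFf : ∀ i (h : i ∈ nonDents n b), F i = f ⟨i, h⟩ := fun i h => dif_pos h
    obtain ⟨x, hx, hFx⟩ := exists_eq_shift hb hbn F
      (fun i hi => by rw [hFf i hi]; exact hf.1 ⟨i, hi⟩)
      (fun i hi l hl h => by
        rw [hFf i hi, hFf l hl] at h
        exact congrArg Subtype.val (hf.2 h))
    refine ⟨x, by simpa using hx, funext fun i => ?_⟩
    rw [← hFx i i.2, hFf]
  · intro x hx
    rw [hrange x hx]

theorem finite_of_coord_le {S : Set (Bool × ℕ × ℕ)} (N : ℕ)
    (h : ∀ v ∈ S, v.2.1 ≤ N ∧ v.2.2 ≤ N) : S.Finite :=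
  (Set.finite_univ.prod ((Set.finite_Iic N).prod (Set.finite_Iic N))).subset
    fun v hv => ⟨trivial, h v hv⟩

/-- Removing the teeth of a white-edged rectangle together with their partners. -/
theorem matchCount_whiteRectVerts {m n : ℕ} {y : Fin (m + 1) → ℕ} (hy : Function.Injective y)
    (hyn : ∀ i, 1 ≤ y i ∧ y i ≤ n) :
    matchCount coloredGrid (whiteRectVerts n (m + 1) (Set.range y)) =
      ∑ b ∈ (Fintype.piFinset fun i => ({y i, y i + 1} : Finset ℕ)).filter Function.Injective,
        matchCount coloredGrid (blackRectVerts n (m + 1) (Set.range b)) := by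
  rw [matchCount_eq_sum_partners coloredGrid
    (S := whiteRectVerts n (m + 1) (Set.range y)) ?_ (fun i => (false, y i, m + 2)) ?_ ?_ ?_
    (fun k => (true, k, m + 1)) ?_ (fun i => ({y i, y i + 1} : Finset ℕ)) ?_]
  · refine Finset.sum_congr rfl fun b hb => ?_
    congr 1
    simp only [Finset.mem_filter, Fintype.mem_piFinset, Finset.mem_insert,
      Finset.mem_singleton] at hb
    ext ⟨c, i, j⟩
    simp only [whiteRectVerts, blackRectVerts, Set.mem_sdiff, Set.mem_ofPred_eq, Set.mem_union,
      Set.mem_range, Function.comp_apply, Prod.mk.injEq]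
    cases c
    · simp only [true_and, false_and, or_false, Bool.true_eq_false, Bool.false_eq_true,
        exists_false]
      constructor
      · rintro ⟨h | ⟨h, k, hk⟩, h'⟩
        · exact h
        · exact absurd ⟨k, hk, by omega⟩ h'
      · intro h
        exact ⟨Or.inl h, fun ⟨k, _, hk⟩ => by omega⟩
    · simp only [true_and, false_and, false_or, Bool.true_eq_false, Bool.false_eq_true,
        exists_false]
      constructor
      · rintro ⟨⟨h1, h2, h3, h4⟩, h'⟩
        refine ⟨h1, h2, ?_⟩
        by_cases hj : j = m + 1
        · exact Or.inr ⟨hj, fun ⟨k, hk⟩ => h' ⟨k, hk, hj.symm⟩⟩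
        · exact Or.inl ⟨h3, by omega⟩
      · rintro ⟨h1, h2, ⟨h3, h4⟩ | ⟨h3, h4⟩⟩
        · exact ⟨⟨h1, h2, h3, by omega⟩, fun ⟨k, _, hk⟩ => by omega⟩
        · exact ⟨⟨h1, h2, by omega, by omega⟩, fun ⟨k, hk, _⟩ => h4 ⟨k, hk⟩⟩
  · refine finite_of_coord_le (n + m + 2) ?_
    rintro ⟨c, i, j⟩ (⟨-, h | ⟨h, k, hk⟩⟩ | ⟨-, h⟩)
    · simp only at h ⊢; omega
    · have := hyn k
      simp only at h hk ⊢; omega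
    · simp only at h ⊢; omega
  · intro i j h
    exact hy (by simpa using h)
  · exact fun i => Or.inl ⟨rfl, Or.inr ⟨rfl, i, rfl⟩⟩
  · simp [coloredGrid]
  · intro i j h
    simpa using h
  · rintro i ⟨c, k, l⟩
    have := hyn i
    cases c <;> simp [coloredGrid, adjC, whiteRectVerts] <;> omega

/-- Removing the last row of black vertices of a black-edged rectangle together with their
partners. -/
theorem matchCount_blackRectVerts {m n : ℕ} {b : Fin (m + 1) → ℕ} (hb : StrictMono b)
    (hbn : ∀ j, 1 ≤ b j ∧ b j ≤ n + 1) :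
    matchCount coloredGrid (blackRectVerts n (m + 1) (Set.range b)) =
      ∑ x ∈ Fintype.piFinset fun j : Fin m => Finset.Ico (b j.castSucc) (b j.succ),
        matchCount coloredGrid (whiteRectVerts n m (Set.range x)) := by
  rw [← sum_nonDents_matchings hb hbn fun T => matchCount coloredGrid (whiteRectVerts n m T),
    matchCount_eq_sum_partners coloredGrid
    (S := blackRectVerts n (m + 1) (Set.range b)) ?_
    (fun i : nonDents n b => (true, i.1, m + 1)) ?_ ?_ ?_
    (fun w => (false, w, m + 1)) ?_
    (fun i => (Finset.Icc 1 n).filter fun w => w = (i : ℕ) ∨ w + 1 = (i : ℕ)) ?_]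
  · refine Finset.sum_congr rfl fun f hf => ?_
    congr 1
    ext ⟨c, i, j⟩
    simp only [whiteRectVerts, blackRectVerts, Set.mem_sdiff, Set.mem_ofPred_eq, Set.mem_union,
      Set.mem_range, Function.comp_apply, Prod.mk.injEq]
    cases c
    · simp only [true_and, false_and, or_false, false_or, Bool.true_eq_false,
        Bool.false_eq_true, exists_false]
      constructor
      · rintro ⟨h, h'⟩
        by_cases hj : j = m + 1
        · exact Or.inr ⟨hj, by omega, fun ⟨k, hk⟩ => h' ⟨k, hk, hj.symm⟩⟩
        · exact Or.inl (by omega)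
      · rintro (h | ⟨h1, h2, h3⟩)
        · exact ⟨by omega, fun ⟨k, _, hk⟩ => by omega⟩
        · exact ⟨by omega, fun ⟨k, hk, _⟩ => h3 ⟨k, hk⟩⟩
    · simp only [true_and, false_and, or_false, false_or, Bool.true_eq_false,
        Bool.false_eq_true, exists_false]
      constructor
      · rintro ⟨⟨h1, h2, h3 | ⟨h3, h4⟩⟩, h'⟩
        · exact ⟨h1, h2, by omega⟩
        · refine absurd ⟨⟨i, mem_nonDents.mpr ⟨⟨h1, h2⟩, fun k hk => h4 ⟨k, hk⟩⟩⟩, rfl, ?_⟩ h'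
          exact h3.symm
      · rintro ⟨h1, h2, h3⟩
        exact ⟨⟨h1, h2, Or.inl (by omega)⟩, fun ⟨k, _, hk⟩ => by omega⟩
  · refine finite_of_coord_le (n + m + 1) ?_
    rintro ⟨c, i, j⟩ (⟨-, h⟩ | ⟨-, h1, h2, h | ⟨h, -⟩⟩)
    · simp only at h ⊢; omega
    · simp only at h h1 h2 ⊢; omega
    · simp only at h h1 h2 ⊢; omega
  · intro i j h
    exact Subtype.ext (by simpa using h)
  · rintro ⟨i, hi⟩
    obtain ⟨hi1, hi2⟩ := mem_nonDents.mp hi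
    exact Or.inr ⟨rfl, hi1.1, hi1.2, Or.inr ⟨rfl, fun ⟨k, hk⟩ => hi2 k hk⟩⟩
  · simp [coloredGrid]
  · intro i j h
    simpa using h
  · rintro ⟨i, hi⟩ ⟨c, k, l⟩
    obtain ⟨hi1, -⟩ := mem_nonDents.mp hi
    cases c <;> simp [coloredGrid, adjC, blackRectVerts] <;> omega

theorem matchCount_whiteRectVerts_eq_chooseDet {n m : ℕ} (y : Fin m → ℕ) (hy : StrictMono y)
    (hyn : ∀ i, 1 ≤ y i ∧ y i ≤ n) :
    (matchCount coloredGrid (whiteRectVerts n m (Set.range y)) : ℚ) =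
      2 ^ (m * (m + 1) / 2) * chooseDet y := by
  induction m with
  | zero =>
    have : whiteRectVerts n 0 (Set.range y) = ∅ := by
      ext ⟨c, i, j⟩
      simp [whiteRectVerts]
      omega
    rw [this, matchCount_empty]
    simp [chooseDet]
  | succ m ih =>
    have hblack : ∀ b ∈ (Fintype.piFinset fun i => ({y i, y i + 1} : Finset ℕ)).filter
        Function.Injective,
        (matchCount coloredGrid (blackRectVerts n (m + 1) (Set.range b)) : ℚ) =
          2 ^ (m * (m + 1) / 2) * chooseDet b := by
      intro b hb
      simp only [Finset.mem_filter, Fintype.mem_piFinset, Finset.mem_insert,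
        Finset.mem_singleton] at hb
      have hmono : StrictMono b := by
        refine Monotone.strictMono_of_injective (fun i j hij => ?_) hb.2
        rcases hij.lt_or_eq with h | rfl
        · have := hy h
          have := hb.1 i
          have := hb.1 j
          omega
        · exact le_rfl
      have hbn : ∀ j, 1 ≤ b j ∧ b j ≤ n + 1 := fun j => by
        have := hb.1 j
        have := hyn j
        omega
      rw [matchCount_blackRectVerts hmono hbn, ← sum_chooseDet_interlacing b hmono.monotone,
        Nat.cast_sum, Finset.mul_sum]
      refine Finset.sum_congr rfl fun x hx => ?_
      simp only [Fintype.mem_piFinset, Finset.mem_Ico] at hx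
      refine ih x (fun j l hjl => ?_) fun j => ?_
      · have := hmono.monotone (Fin.succ_le_castSucc_iff.mpr hjl)
        have := (hx j).2
        have := (hx l).1
        omega
      · have := hx j
        have := hbn j.castSucc
        have := hbn j.succ
        omega
    have hexp : (m + 1) * (m + 1 + 1) / 2 = m * (m + 1) / 2 + (m + 1) := by
      have : (m + 1) * (m + 1 + 1) = m * (m + 1) + (m + 1) * 2 := by ring
      rw [this, Nat.add_mul_div_right _ _ two_pos]
    rw [matchCount_whiteRectVerts hy.injective hyn, Nat.cast_sum, Finset.sum_congr rfl hblack,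
      ← Finset.mul_sum, Finset.sum_filter_of_ne, sum_chooseDet_pair, hexp, pow_add _ _ (m + 1), mul_assoc]
    intro b _ hne
    by_contra h
    exact hne (chooseDet_eq_zero_of_not_injective h)

/-- EKLP Lemma, second part: the number of perfect matchings of the `n × m` white-edged Aztec
rectangle with teeth at `y 1 < y 2 < … < y m` is
`2^(m(m+1)/2) · (∏_{i<j} (y j - y i)) / (∏_{k=1}^{m-1} k!)`. -/
theorem eklp_white_rectangle (n m : ℕ) (hn : 1 ≤ n) (hm : 1 ≤ m) (hmn : m ≤ n)
    (y : Fin m → ℕ) (hy : StrictMono y) (hyb : ∀ i, 1 ≤ y i ∧ y i ≤ n) :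
    (matchCount coloredGrid (whiteRectVerts n m (Set.range y)) : ℚ)
      = 2 ^ (m * (m + 1) / 2) *
          (∏ p ∈ Finset.univ.filter (fun p : Fin m × Fin m => p.1 < p.2),
            ((y p.2 : ℚ) - (y p.1 : ℚ)))
        / (∏ k ∈ Finset.Icc 1 (m - 1), (Nat.factorial k : ℚ)) := by
  rw [matchCount_whiteRectVerts_eq_chooseDet y hy hyb, chooseDet_eq, mul_div_assoc]
end

section
/- For all integers n ≥ 1, 1 ≤ m ≤ n and 1 ≤ y_1 < y_2 < ... < y_m ≤ n, the number of perfect matchings E_{n,m}(y_1,...,y_m) of the n×m white-edged Aztec rectangle with teeth at y_1,...,y_m equals the sum, over all m-tuples (x_1,...,x_m) with x_i ∈ {y_i, y_i + 1} for each i, of D_{n,m}(x_1,...,x_m), with the convention that D_{n,m}(x_1,...,x_m) = 0 whenever the x_i are not pairwise distinct. -/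
open scoped Classical

namespace SimpleGraph.Subgraph

variable {V : Type*} {G : SimpleGraph V}

/-- An edge of a matching meeting a submatching belongs to that submatching. -/
theorem IsMatching.adj_of_le {M N : G.Subgraph} (hM : M.IsMatching) (hN : N.IsMatching)
    (hle : N ≤ M) {v w : V} (hv : v ∈ N.verts) (h : M.Adj v w) : N.Adj v w := by
  obtain ⟨u, hu, -⟩ := hN hv
  rwa [hM.eq_of_adj_left h (hle.2 hu)]

/-- Deleting a submatching from a matching leaves a matching. -/
theorem IsMatching.deleteVerts_of_le {M N : G.Subgraph} (hM : M.IsMatching) (hN : N.IsMatching)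
    (hle : N ≤ M) : (M.deleteVerts N.verts).IsMatching := by
  intro v hv
  rw [deleteVerts_verts] at hv
  obtain ⟨w, hw, huniq⟩ := hM hv.1
  refine ⟨w, ?_, fun u hu => huniq u (deleteVerts_adj.mp hu).2.2.2.2⟩
  refine deleteVerts_adj.mpr ⟨hv.1, hv.2, M.edge_vert hw.symm, fun hwN => hv.2 ?_, hw⟩
  exact N.edge_vert (hM.adj_of_le hN hle hwN hw.symm).symm

/-- The matchings of `S` extending a matching `N` correspond to the matchings of the complement
of `N` in `S`. -/
def extensionEquiv (S : Set V) (N : G.Subgraph) (hN : N.IsMatching) (hS : N.verts ⊆ S) :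
    {M : G.Subgraph // (M.verts = S ∧ M.IsMatching) ∧ N ≤ M} ≃
      {M : G.Subgraph // M.verts = S \ N.verts ∧ M.IsMatching} where
  toFun M := ⟨M.1.deleteVerts N.verts, by rw [deleteVerts_verts, M.2.1.1],
    M.2.1.2.deleteVerts_of_le hN M.2.2⟩
  invFun M := ⟨M.1 ⊔ N, ⟨by rw [verts_sup, M.2.1, Set.sdiff_union_of_subset hS],
    M.2.2.sup hN (by
      rw [M.2.2.support_eq_verts, hN.support_eq_verts, M.2.1]
      exact Set.disjoint_sdiff_left)⟩, le_sup_right⟩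
  left_inv := by
    rintro ⟨M, ⟨hv, hM⟩, hle⟩
    refine Subtype.ext (Subgraph.ext ?_ ?_)
    · simp [Set.union_eq_left.mpr hle.1]
    · ext v w
      simp only [sup_adj, deleteVerts_adj]
      constructor
      · rintro (h | h)
        · exact h.2.2.2.2
        · exact hle.2 h
      · intro h
        by_cases h1 : v ∈ N.verts
        · exact Or.inr (hM.adj_of_le hN hle h1 h)
        by_cases h2 : w ∈ N.verts
        · exact Or.inr (hM.adj_of_le hN hle h2 h.symm).symm
        exact Or.inl ⟨M.edge_vert h, h1, M.edge_vert h.symm, h2, h⟩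
  right_inv := by
    rintro ⟨M, hv, hM⟩
    refine Subtype.ext (Subgraph.ext ?_ ?_)
    · simp [hv]
    · ext v w
      simp only [sup_adj, deleteVerts_adj, verts_sup]
      constructor
      · rintro ⟨-, h1, -, -, h | h⟩
        · exact h
        · exact absurd (N.edge_vert h) h1
      · intro h
        have h1 := M.edge_vert h
        have h2 := M.edge_vert h.symm
        refine ⟨Or.inl h1, ?_, Or.inl h2, ?_, Or.inl h⟩
        · rw [hv] at h1; exact h1.2
        · rw [hv] at h2; exact h2.2

/-- The subgraph formed by a family of edges `t i — b i`. -/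
def ofPairs {ι : Type*} (t b : ι → V) (h : ∀ i, G.Adj (t i) (b i)) : G.Subgraph where
  verts := Set.range t ∪ Set.range b
  Adj u v := ∃ i, (u = t i ∧ v = b i) ∨ (u = b i ∧ v = t i)
  adj_sub := by
    rintro u v ⟨i, ⟨rfl, rfl⟩ | ⟨rfl, rfl⟩⟩
    exacts [h i, (h i).symm]
  edge_vert := by
    rintro u v ⟨i, ⟨rfl, rfl⟩ | ⟨rfl, rfl⟩⟩
    exacts [Or.inl ⟨i, rfl⟩, Or.inr ⟨i, rfl⟩]
  symm := by
    constructor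
    rintro u v ⟨i, h⟩
    exact ⟨i, by tauto⟩

theorem isMatching_ofPairs {ι : Type*} {t b : ι → V} (h : ∀ i, G.Adj (t i) (b i))
    (ht : Function.Injective t) (hb : Function.Injective b) (htb : ∀ i j, t i ≠ b j) :
    (ofPairs t b h).IsMatching := by
  rintro v (⟨i, rfl⟩ | ⟨i, rfl⟩)
  · refine ⟨b i, ⟨i, Or.inl ⟨rfl, rfl⟩⟩, ?_⟩
    rintro w ⟨j, ⟨h1, rfl⟩ | ⟨h1, -⟩⟩
    · rw [ht h1]
    · exact absurd h1 (htb i j)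
  · refine ⟨t i, ⟨i, Or.inr ⟨rfl, rfl⟩⟩, ?_⟩
    rintro w ⟨j, ⟨h1, -⟩ | ⟨h1, rfl⟩⟩
    · exact absurd h1.symm (htb j i)
    · rw [hb h1]

theorem ofPairs_le_iff {ι : Type*} {t b : ι → V} (h : ∀ i, G.Adj (t i) (b i)) {M : G.Subgraph} :
    ofPairs t b h ≤ M ↔ ∀ i, M.Adj (t i) (b i) := by
  constructor
  · intro hle i
    exact hle.2 ⟨i, Or.inl ⟨rfl, rfl⟩⟩
  · intro hM
    constructor
    · rintro v (⟨i, rfl⟩ | ⟨i, rfl⟩)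
      exacts [M.edge_vert (hM i), M.edge_vert (hM i).symm]
    · rintro u v ⟨i, ⟨rfl, rfl⟩ | ⟨rfl, rfl⟩⟩
      exacts [hM i, (hM i).symm]

theorem finite_of_verts_eq {S : Set V} (hS : S.Finite) :
    Finite {M : G.Subgraph // M.verts = S} := by
  have := hS.to_subtype
  refine Finite.of_injective
    (fun M : {M : G.Subgraph // M.verts = S} => {p : S × S | M.1.Adj p.1 p.2}) ?_
  have key : ∀ M N : {M : G.Subgraph // M.verts = S},
      {p : S × S | M.1.Adj p.1 p.2} = {p : S × S | N.1.Adj p.1 p.2} →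
      ∀ u v, M.1.Adj u v → N.1.Adj u v := by
    intro M N h u v huv
    have hu : u ∈ S := M.2 ▸ M.1.edge_vert huv
    have hv : v ∈ S := M.2 ▸ M.1.edge_vert huv.symm
    exact (Set.ext_iff.mp h (⟨u, hu⟩, ⟨v, hv⟩)).mp huv
  intro M N h
  refine Subtype.ext (Subgraph.ext (M.2.trans N.2.symm) ?_)
  ext u v
  exact ⟨key M N h u v, key N M h.symm u v⟩

end SimpleGraph.Subgraph

/-- Expansion of the number of perfect matchings according to the partners of the vertices `t i`,
each of which has only the two neighbours `b i false` and `b i true` in `S`. -/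
theorem matchCount_eq_sum_partners_s6 {V ι : Type*} [Fintype ι] [DecidableEq ι] {G : SimpleGraph V}
    {S : Set V} (hS : S.Finite) (t : ι → V) (b : ι → Bool → V) (ht : Function.Injective t)
    (hb : ∀ i, b i false ≠ b i true) (htb : ∀ i j c, t i ≠ b j c)
    (htS : ∀ i, t i ∈ S) (hbS : ∀ i c, b i c ∈ S) (hadj : ∀ i c, G.Adj (t i) (b i c))
    (hnbr : ∀ i, ∀ v ∈ S, G.Adj (t i) v → ∃ c, v = b i c) :
    matchCount G S = ∑ ε : ι → Bool,
      if Function.Injective (fun i => b i (ε i)) then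
        matchCount G (S \ (Set.range t ∪ Set.range fun i => b i (ε i))) else 0 := by
  have hpartner : ∀ M : {M : G.Subgraph // M.verts = S ∧ M.IsMatching},
      ∃! ε : ι → Bool, ∀ i, M.1.Adj (t i) (b i (ε i)) := by
    rintro ⟨M, hv, hM⟩
    have : ∀ i, ∃ c, M.Adj (t i) (b i c) := fun i => by
      obtain ⟨w, hw, -⟩ := hM (hv ▸ htS i : t i ∈ M.verts)
      obtain ⟨c, rfl⟩ := hnbr i w (hv ▸ M.edge_vert hw.symm) hw.adj_sub
      exact ⟨c, hw⟩
    choose ε hε using this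
    refine ⟨ε, hε, fun δ hδ => funext fun i => ?_⟩
    have h := hM.eq_of_adj_left (hδ i) (hε i)
    have hbi := hb i
    cases hd : δ i <;> cases he : ε i <;> simp_all
  choose partner hpart huniq using hpartner
  have hfin : ∀ ε : ι → Bool, Finite {M : {M : G.Subgraph // M.verts = S ∧ M.IsMatching} //
      partner M = ε} := fun ε => by
    have := SimpleGraph.Subgraph.finite_of_verts_eq (G := G) hS
    have : Finite {M : G.Subgraph // M.verts = S ∧ M.IsMatching} :=
      Finite.of_injective (β := {M : G.Subgraph // M.verts = S}) (fun M => ⟨M.1, M.2.1⟩)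
        fun M N h => Subtype.ext (congrArg (fun K => K.1) h)
    infer_instance
  rw [matchCount, ← Nat.card_congr (Equiv.sigmaFiberEquiv partner), Nat.card_sigma]
  refine Finset.sum_congr rfl fun ε _ => ?_
  have hiff : ∀ M, partner M = ε ↔ ∀ i, M.1.Adj (t i) (b i (ε i)) := fun M =>
    ⟨fun h => h ▸ hpart M, fun h => (huniq M ε h).symm⟩
  split_ifs with hinj
  · let N := SimpleGraph.Subgraph.ofPairs (G := G) t (fun i => b i (ε i)) fun i => hadj i (ε i)
    have hN : N.IsMatching :=
      SimpleGraph.Subgraph.isMatching_ofPairs _ ht hinj fun i j => htb i j _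
    have hNS : N.verts ⊆ S := by
      rintro v (⟨i, rfl⟩ | ⟨i, rfl⟩)
      exacts [htS i, hbS i _]
    refine Nat.card_congr (Equiv.trans ?_ (SimpleGraph.Subgraph.extensionEquiv S N hN hNS))
    refine (Equiv.subtypeEquivRight fun M => ?_).trans
      (Equiv.subtypeSubtypeEquivSubtypeInter _ fun M => N ≤ M)
    exact (hiff M).trans (SimpleGraph.Subgraph.ofPairs_le_iff _).symm
  · have : IsEmpty {M : {M : G.Subgraph // M.verts = S ∧ M.IsMatching} // partner M = ε} := by
      refine ⟨fun ⟨M, hMε⟩ => hinj fun i j hij => ht ?_⟩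
      have h := (hiff M).mp hMε
      have hj := h j
      simp only at hij
      rw [← hij] at hj
      exact M.2.2.eq_of_adj_right (h i) hj
    exact Nat.card_of_isEmpty

theorem finite_whiteRectVerts {n m : ℕ} {teeth : Set ℕ} (hteeth : ∀ k ∈ teeth, k ≤ n) :
    (whiteRectVerts n m teeth).Finite := by
  refine (Set.finite_univ.prod ((Set.finite_Iic (n + 1)).prod (Set.finite_Iic (m + 1)))).subset ?_
  rintro ⟨c, i, j⟩ h
  simp only [Set.mem_prod, Set.mem_univ, Set.mem_Iic, true_and]
  rcases h with ⟨-, h | ⟨h1, h2⟩⟩ | h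
  · dsimp only at h; omega
  · have := hteeth _ h2
    dsimp only at h1 this; omega
  · dsimp only at h; omega

theorem whiteRectVerts_diff {n m : ℕ} (hm : 1 ≤ m) {ι : Type*} (y x : ι → ℕ) :
    whiteRectVerts n m (Set.range y) \
      (Set.range (fun i => (false, y i, m + 1)) ∪ Set.range fun i => (true, x i, m))
      = blackRectVerts n m (Set.range x) := by
  ext ⟨c, i, j⟩
  cases c
  · simp only [whiteRectVerts, blackRectVerts, Set.mem_sdiff, Set.mem_ofPred_eq, Set.mem_union,
      Set.mem_range, Prod.mk.injEq]
    constructor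
    · rintro ⟨⟨-, h | ⟨rfl, k, rfl⟩⟩ | h, h'⟩
      · exact Or.inl ⟨trivial, h⟩
      · exact absurd (Or.inl ⟨k, trivial, rfl, rfl⟩) h'
      · simp at h
    · rintro (h | h)
      · refine ⟨Or.inl ⟨trivial, Or.inl h.2⟩, ?_⟩
        rintro (⟨k, -, -, hk⟩ | ⟨k, hk, -⟩)
        · omega
        · simp at hk
      · simp at h
  · simp only [whiteRectVerts, blackRectVerts, Set.mem_sdiff, Set.mem_ofPred_eq, Set.mem_union,
      Set.mem_range, Prod.mk.injEq]
    constructor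
    · rintro ⟨h | ⟨-, h1, h2, h3, h4⟩, h'⟩
      · simp at h
      · refine Or.inr ⟨trivial, h1, h2, ?_⟩
        rcases Nat.lt_or_ge j m with hj | hj
        · left; omega
        · have hjm : j = m := le_antisymm h4 hj
          exact Or.inr ⟨hjm, fun ⟨k, hk⟩ => h' (Or.inr ⟨k, trivial, hk, hjm.symm⟩)⟩
    · rintro (h | ⟨-, h1, h2, h | ⟨h3, h4⟩⟩)
      · simp at h
      · refine ⟨Or.inr ⟨trivial, h1, h2, by omega, by omega⟩, ?_⟩
        rintro (⟨k, hk, -⟩ | ⟨k, -, -, hk⟩)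
        · simp at hk
        · omega
      · refine ⟨Or.inr ⟨trivial, h1, h2, by omega, by omega⟩, ?_⟩
        rintro (⟨k, hk, -⟩ | ⟨k, -, hk, -⟩)
        · simp at hk
        · exact h4 ⟨k, hk⟩

/-- `E_{n,m}(y 1, …, y m)` equals the sum, over all choices `x i ∈ {y i, y i + 1}`, of
`D_{n,m}(x 1, …, x m)`, with the convention that `D_{n,m}` vanishes when the `x i` are not
pairwise distinct. -/
theorem white_rect_as_sum_of_black_rects (n m : ℕ) (hn : 1 ≤ n) (hm : 1 ≤ m) (hmn : m ≤ n)
    (y : Fin m → ℕ) (hy : StrictMono y) (hyb : ∀ i, 1 ≤ y i ∧ y i ≤ n) :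
    matchCount coloredGrid (whiteRectVerts n m (Set.range y))
      = ∑ ε : Fin m → Bool,
          (if Function.Injective (fun i => y i + (ε i).toNat)
           then matchCount coloredGrid
             (blackRectVerts n m (Set.range (fun i => y i + (ε i).toNat)))
           else 0) := by
  rw [matchCount_eq_sum_partners_s6 (finite_whiteRectVerts ?_)
    (fun i => (false, y i, m + 1)) (fun i c => (true, y i + c.toNat, m))]
  · refine Finset.sum_congr rfl fun ε _ => ?_
    rw [whiteRectVerts_diff hm y fun i => y i + (ε i).toNat]
    have hiff : Function.Injective (fun i => (true, y i + (ε i).toNat, m)) ↔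
        Function.Injective (fun i => y i + (ε i).toNat) := by
      simp [Function.Injective]
    simp only [hiff]
  · intro i j h
    exact hy.injective (by simpa using h)
  · simp
  · simp
  · exact fun i => Or.inl ⟨rfl, Or.inr ⟨rfl, i, rfl⟩⟩
  · intro i c
    have := hyb i
    have := c.toNat_le
    exact Or.inr ⟨rfl, by dsimp only; omega, by dsimp only; omega, hm, le_rfl⟩
  · intro i c
    refine Or.inl ⟨rfl, rfl, ?_, Or.inl rfl⟩
    cases c <;> simp
  · rintro i ⟨c, k, l⟩ hS (⟨-, hc, h1, h2⟩ | ⟨-, hc, -⟩)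
    · dsimp only at hc h1 h2
      subst hc
      have hl : l ≤ m := by
        rcases hS with ⟨hS, -⟩ | hS
        · simp at hS
        · exact hS.2.2.2.2
      obtain rfl : l = m := by omega
      rcases h1 with rfl | rfl
      exacts [⟨false, rfl⟩, ⟨true, rfl⟩]
    · simp at hc
  · rintro - ⟨i, rfl⟩
    exact (hyb i).2
end

section
/- For all integers n ≥ 1, 1 ≤ m ≤ n and 1 ≤ x_1 < x_2 < ... < x_{m+1} ≤ n+1, the number of perfect matchings D_{n,m+1}(x_1,...,x_{m+1}) of the n×(m+1) black-edged Aztec rectangle with dents at x_1,...,x_{m+1} equals the sum, over all m-tuples (y_1,...,y_m) of integers with x_i ≤ y_i ≤ x_{i+1} - 1 for each i = 1,...,m, of E_{n,m}(y_1,...,y_m). -/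
open scoped Classical

/-- The indicator function of a set, with values in `ℕ`. -/
noncomputable def indicatorNat {α : Type*} (A : Set α) (a : α) : ℕ := if a ∈ A then 1 else 0

lemma indicatorNat_of_mem {α : Type*} {A : Set α} {a : α} (h : a ∈ A) : indicatorNat A a = 1 :=
  if_pos h

lemma indicatorNat_of_notMem {α : Type*} {A : Set α} {a : α} (h : a ∉ A) :
    indicatorNat A a = 0 :=
  if_neg h

open Finset in
/-- The number of entries of the tuple `x` that are at most `k`. -/
noncomputable def countLE {r : ℕ} (x : Fin r → ℕ) (k : ℕ) : ℕ := #{i | x i ≤ k}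

section countLE

variable {r : ℕ} {x : Fin r → ℕ}

lemma le_iff_lt_countLE (hx : StrictMono x) (i : Fin r) (k : ℕ) :
    x i ≤ k ↔ (i : ℕ) < countLE x k := by
  constructor
  · intro h
    have hsub : Finset.Iic i ⊆ Finset.univ.filter (fun j => x j ≤ k) := by
      intro j hj
      simpa using (hx.monotone (Finset.mem_Iic.1 hj)).trans h
    have := Finset.card_le_card hsub
    rw [Fin.card_Iic] at this
    unfold countLE
    omega
  · intro h
    by_contra hlt
    have hsub : Finset.univ.filter (fun j => x j ≤ k) ⊆ Finset.Iio i := by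
      intro j hj
      have hj' : x j ≤ k := by simpa using hj
      exact Finset.mem_Iio.2 (hx.lt_iff_lt.1 (by omega))
    have := Finset.card_le_card hsub
    rw [Fin.card_Iio] at this
    unfold countLE at h
    omega

lemma countLE_le (k : ℕ) : countLE x k ≤ r := by
  simpa [countLE] using Finset.card_filter_le (Finset.univ : Finset (Fin r)) (fun i => x i ≤ k)

lemma countLE_eq_zero {k : ℕ} (h : ∀ i, k < x i) : countLE x k = 0 := by
  simpa [countLE, Finset.filter_eq_empty_iff] using h

lemma countLE_eq_self {k : ℕ} (h : ∀ i, x i ≤ k) : countLE x k = r := by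
  simp [countLE, h]

lemma countLE_succ (hx : StrictMono x) (k : ℕ) :
    countLE x (k + 1) = countLE x k + indicatorNat (Set.range x) (k + 1) := by
  have hsplit : countLE x (k + 1)
      = countLE x k + (Finset.univ.filter (fun i => x i = k + 1)).card := by
    unfold countLE
    rw [← Finset.card_union_of_disjoint]
    · congr 1
      ext i
      simp
      omega
    · rw [Finset.disjoint_filter]
      intro i _ h
      omega
  rw [hsplit]
  by_cases h : k + 1 ∈ Set.range x
  · obtain ⟨i, hi⟩ := h
    have : Finset.univ.filter (fun j => x j = k + 1) = {i} := by
      ext j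
      simp [← hi, hx.injective.eq_iff]
    simp [this, indicatorNat_of_mem (Set.mem_range.2 ⟨i, hi⟩)]
  · have : Finset.univ.filter (fun j => x j = k + 1) = ∅ := by
      ext j
      simpa using fun hj => h ⟨j, hj⟩
    simp [this, indicatorNat_of_notMem h]

end countLE

section interlacing

variable {m : ℕ} {x : Fin (m + 1) → ℕ} {y : Fin m → ℕ}

lemma strictMono_of_interlacing (hx : StrictMono x)
    (h : ∀ i : Fin m, x i.castSucc ≤ y i ∧ y i < x i.succ) : StrictMono y := by
  intro i j hij
  have h1 := (h i).2
  have h2 := (h j).1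
  have h3 : x i.succ ≤ x j.castSucc := hx.monotone (by
    rw [Fin.le_def]
    simp only [Fin.val_succ, Fin.val_castSucc]
    exact hij)
  omega

/-- Two strictly increasing tuples interlace iff their counting functions do. -/
lemma interlacing_iff_countLE (hx : StrictMono x) (hy : StrictMono y) :
    (∀ i : Fin m, x i.castSucc ≤ y i ∧ y i < x i.succ) ↔
      ∀ k, countLE y k ≤ countLE x k ∧ countLE x (k + 1) ≤ countLE y k + 1 := by
  constructor
  · intro h k
    constructor
    · by_contra! hlt
      have hm := countLE_le (x := y) k
      let i : Fin m := ⟨countLE x k, by omega⟩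
      have h1 : y i ≤ k := (le_iff_lt_countLE hy i k).2 hlt
      have h2 := (le_iff_lt_countLE hx i.castSucc k).1 ((h i).1.trans h1)
      simp [i] at h2
    · by_contra! hlt
      have hm := countLE_le (x := x) (k + 1)
      let i : Fin m := ⟨countLE y k, by omega⟩
      have h1 : x i.succ ≤ k + 1 := (le_iff_lt_countLE hx i.succ (k + 1)).2 hlt
      have h2 := (le_iff_lt_countLE hy i k).1 (by have := (h i).2; omega)
      simp [i] at h2
  · intro h i
    constructor
    · rw [le_iff_lt_countLE hx]
      exact ((le_iff_lt_countLE hy i _).1 le_rfl).trans_le (h _).1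
    · have h1 := (le_iff_lt_countLE hx i.succ _).1 le_rfl
      rcases hk : x i.succ with _ | k
      · have := hx (Fin.castSucc_lt_succ (i := i))
        omega
      · rw [hk] at h1
        have h2 := (h k).2
        have h3 := (le_iff_lt_countLE hy i k).2 (by simp at h1; omega)
        omega

end interlacing

section matchings

variable {V : Type*} {G : SimpleGraph V}

lemma SimpleGraph.Subgraph.IsMatching.eq_of_le {M N : G.Subgraph} (hM : M.IsMatching)
    (hN : N.IsMatching) (hle : M ≤ N) (hverts : M.verts = N.verts) : M = N := by
  refine SimpleGraph.Subgraph.ext hverts ?_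
  funext u v
  refine propext ⟨fun h => hle.2 h, fun h => ?_⟩
  obtain ⟨w, hw, -⟩ := hM (hverts ▸ N.edge_vert h)
  obtain rfl : w = v := hN.eq_of_adj_left (hle.2 hw) h
  exact hw

lemma finite_matchings {S : Set V} (hS : S.Finite) :
    Finite {M : G.Subgraph // M.verts = S ∧ M.IsMatching} := by
  have := hS.to_subtype
  refine Finite.of_injective
    (fun M => ({p | M.1.Adj p.1 p.2} : Set (S × S))) ?_
  rintro ⟨M, hM, hM'⟩ ⟨N, hN, hN'⟩ h
  refine Subtype.ext (SimpleGraph.Subgraph.ext (hM.trans hN.symm) ?_)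
  funext u v
  refine propext ⟨fun hu => ?_, fun hu => ?_⟩
  · have := Set.ext_iff.1 h (⟨u, hM ▸ M.edge_vert hu⟩, ⟨v, hM ▸ M.edge_vert hu.symm⟩)
    exact this.1 hu
  · have := Set.ext_iff.1 h (⟨u, hN ▸ N.edge_vert hu⟩, ⟨v, hN ▸ N.edge_vert hu.symm⟩)
    exact this.2 hu

/-- Restricting a matching to a set of vertices closed under taking partners. -/
lemma SimpleGraph.Subgraph.IsMatching.induce {M : G.Subgraph} (hM : M.IsMatching) {A : Set V}
    (hA : A ⊆ M.verts) (hclosed : ∀ u ∈ A, ∀ v, M.Adj u v → v ∈ A) :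
    (M.induce A).IsMatching := by
  intro u hu
  obtain ⟨v, hv, huniq⟩ := hM (hA hu)
  exact ⟨v, ⟨hu, hclosed u hu v hv, hv⟩, fun w hw => huniq w hw.2.2⟩

end matchings

lemma whiteRectVerts_finite (n m : ℕ) {teeth : Set ℕ} (h : teeth.Finite) :
    (whiteRectVerts n m teeth).Finite := by
  refine (Set.finite_univ.prod
    (((Set.finite_Iic (n + 1)).union h).prod (Set.finite_Iic (m + 1)))).subset ?_
  rintro ⟨b, i, j⟩ hv
  simp only [whiteRectVerts, Set.mem_ofPred_eq] at hv
  simp only [Set.mem_prod, Set.mem_univ, Set.mem_union, Set.mem_Iic, true_and]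
  rcases hv with ⟨-, ⟨_, _, _, _⟩ | ⟨_, hi⟩⟩ | ⟨-, _, _, _, _⟩
  · exact ⟨Or.inl (by omega), by omega⟩
  · exact ⟨Or.inr hi, by omega⟩
  · exact ⟨Or.inl (by omega), by omega⟩

/-- The edges of column `c` between white vertices outside `Y` and black vertices outside `X`,
where the white vertex `(i, c)` is joined to `(i, c)` if `d i = 0` and to `(i + 1, c)`
otherwise. -/
def columnGraph (n c : ℕ) (X Y : Set ℕ) (d : ℕ → ℕ) : coloredGrid.Subgraph where
  verts := {v | (v.1 = false ∧ v.2.2 = c ∧ 1 ≤ v.2.1 ∧ v.2.1 ≤ n ∧ v.2.1 ∉ Y) ∨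
    (v.1 = true ∧ v.2.2 = c ∧ 1 ≤ v.2.1 ∧ v.2.1 ≤ n + 1 ∧ v.2.1 ∉ X)}
  Adj u v := u.2.2 = c ∧ v.2.2 = c ∧
    ((u.1 = false ∧ v.1 = true ∧ 1 ≤ u.2.1 ∧ u.2.1 ≤ n ∧ u.2.1 ∉ Y ∧ v.2.1 ∉ X ∧
        v.2.1 = u.2.1 + if d u.2.1 = 0 then 0 else 1) ∨
      (v.1 = false ∧ u.1 = true ∧ 1 ≤ v.2.1 ∧ v.2.1 ≤ n ∧ v.2.1 ∉ Y ∧ u.2.1 ∉ X ∧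
        u.2.1 = v.2.1 + if d v.2.1 = 0 then 0 else 1))
  adj_sub := by
    rintro ⟨a, i, j⟩ ⟨b, k, l⟩ ⟨rfl, rfl, ⟨rfl, rfl, -, -, -, -, h⟩ | ⟨rfl, rfl, -, -, -, -, h⟩⟩
    · left
      simp only [adjC] at h ⊢
      split_ifs at h <;> simp [h]
    · right
      simp only [adjC] at h ⊢
      split_ifs at h <;> simp [h]
  edge_vert := by
    rintro ⟨a, i, j⟩ ⟨b, k, l⟩
      ⟨rfl, rfl, ⟨rfl, rfl, h1, h2, h3, h4, h⟩ | ⟨rfl, rfl, h1, h2, h3, h4, h⟩⟩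
    · left
      exact ⟨rfl, rfl, h1, h2, h3⟩
    · right
      simp only at h1 h2 h
      split_ifs at h <;> exact ⟨rfl, rfl, by simp only; omega, by simp only; omega, h4⟩
  symm := by
    constructor
    intro u v h
    tauto

/-- `columnGraph` is a matching as soon as the transfer relations hold between `X`, `Y`
and `d`. -/
lemma columnGraph_isMatching {n c : ℕ} {X Y : Set ℕ} {d : ℕ → ℕ} (h0 : d 0 = 0)
    (hstep : ∀ k, (d k + indicatorNat X (k + 1)) = d (k + 1) + indicatorNat Y (k + 1))
    (hle : ∀ k, (d k + indicatorNat X (k + 1)) ≤ 1)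
    (hlast : (d n + indicatorNat X (n + 1)) = 1) :
    (columnGraph n c X Y d).IsMatching := by
  rintro ⟨b, i, j⟩ (⟨rfl, rfl, h1, h2, h3⟩ | ⟨rfl, rfl, h1, h2, h3⟩)
  · simp only at h1 h2 h3
    refine ⟨(true, i + (if d i = 0 then 0 else 1), j),
      ⟨rfl, rfl, Or.inl ⟨rfl, rfl, h1, h2, h3, ?_, rfl⟩⟩, ?_⟩
    · obtain ⟨k, rfl⟩ : ∃ k, i = k + 1 := ⟨i - 1, by omega⟩
      have := hstep k
      have := hle (k + 1)
      rw [indicatorNat_of_notMem h3] at *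
      by_cases hd : d (k + 1) = 0
      · rw [if_pos hd]
        intro hX
        simp only [add_zero] at hX
        rw [indicatorNat_of_mem hX] at *
        omega
      · rw [if_neg hd]
        intro hX
        rw [indicatorNat_of_mem hX] at *
        omega
    · rintro ⟨b, k, l⟩ ⟨-, hl, ⟨-, hb, -, -, -, -, hk⟩ | ⟨-, hb, -⟩⟩
      · simp only at hl hb hk
        rw [hl, hb, hk]
      · simp at hb
  · simp only at h1 h2 h3
    obtain ⟨k, rfl⟩ : ∃ k, i = k + 1 := ⟨i - 1, by omega⟩
    have e1 := hstep k
    have e2 := hle k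
    rw [indicatorNat_of_notMem h3] at e1 e2
    by_cases hd : d k = 0
    · have hY : k + 1 ∉ Y := fun h => by
        rw [indicatorNat_of_mem h] at e1
        omega
      have hkn : k ≠ n := by
        rintro rfl
        rw [indicatorNat_of_notMem h3] at hlast
        omega
      rw [indicatorNat_of_notMem hY] at e1
      have hd' : d (k + 1) = 0 := by omega
      refine ⟨(false, k + 1, j), ⟨rfl, rfl, Or.inr ⟨rfl, rfl, h1, by simp only; omega, hY, h3,
        by simp [hd']⟩⟩, ?_⟩
      rintro ⟨b, l, j'⟩ ⟨-, hl, ⟨hb, -⟩ | ⟨hb, -, -, -, -, -, hk⟩⟩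
      · simp at hb
      · simp only at hl hb hk
        split_ifs at hk with hdl
        · rw [hl, hb, hk, add_zero]
        · obtain rfl : k = l := by omega
          exact absurd hd hdl
    · obtain ⟨k, rfl⟩ : ∃ k', k = k' + 1 := by
        rcases k with _ | k
        · exact absurd h0 hd
        · exact ⟨k, rfl⟩
      have e3 := hstep k
      have e4 := hle k
      have hY : k + 1 ∉ Y := fun h => by
        rw [indicatorNat_of_mem h] at e3
        omega
      refine ⟨(false, k + 1, j), ⟨rfl, rfl, Or.inr ⟨rfl, rfl, by simp, by simp only; omega, hY, h3,
        by simp [hd]⟩⟩, ?_⟩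
      rintro ⟨b, l, j'⟩ ⟨-, hl, ⟨hb, -⟩ | ⟨hb, -, -, -, hYl, -, hk⟩⟩
      · simp at hb
      · simp only at hl hb hk
        split_ifs at hk with hdl
        · obtain rfl : l = k + 1 + 1 := by omega
          have : d (k + 1 + 1) ≠ 0 ∨ k + 1 + 1 ∈ Y := by
            by_contra! hcon
            rw [indicatorNat_of_notMem hcon.2] at e1
            omega
          tauto
        · obtain rfl : k + 1 = l := by omega
          rw [hl, hb]

section decomposition

variable {n m : ℕ} {x : Fin (m + 1) → ℕ} {y : Fin m → ℕ}

/-- The column graph joining the teeth `y` of the white-edged rectangle to the dents `x`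
of the black-edged one. -/
noncomputable def lastColumn (n : ℕ) (x : Fin (m + 1) → ℕ) (y : Fin m → ℕ) :
    coloredGrid.Subgraph :=
  columnGraph n (m + 1) (Set.range x) (Set.range y) (fun k => countLE x k - countLE y k)

lemma lastColumn_isMatching (hx : StrictMono x) (hxb : ∀ i, 1 ≤ x i ∧ x i ≤ n + 1)
    (h : ∀ i : Fin m, x i.castSucc ≤ y i ∧ y i < x i.succ) :
    (lastColumn n x y).IsMatching := by
  have hy := strictMono_of_interlacing hx h
  have hc := (interlacing_iff_countLE hx hy).1 h
  refine columnGraph_isMatching ?_ ?_ ?_ ?_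
  · simp [countLE_eq_zero (x := x) (k := 0) fun i => (hxb i).1]
  · intro k
    have := countLE_succ hx k
    have := countLE_succ hy k
    have := hc k
    have := hc (k + 1)
    omega
  · intro k
    have := countLE_succ hx k
    have := hc k
    omega
  · have h1 := countLE_succ hx n
    have h2 := countLE_eq_self (x := x) fun i => (hxb i).2
    have h3 : countLE y n = m := countLE_eq_self fun i => by
      have := (h i).2
      have := (hxb i.succ).2
      omega
    have := hc n
    omega

lemma disjoint_whiteRectVerts_lastColumn :
    Disjoint (whiteRectVerts n m (Set.range y)) (lastColumn n x y).verts := by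
  rw [Set.disjoint_left]
  rintro ⟨b, i, j⟩ h1 h2
  simp only [whiteRectVerts, lastColumn, columnGraph, Set.mem_ofPred_eq] at h1 h2
  rcases h1 with ⟨rfl, ⟨_, _, _, _⟩ | ⟨_, _⟩⟩ | ⟨rfl, _, _, _, _⟩ <;>
    rcases h2 with ⟨h, _, _, _, _⟩ | ⟨h, _, _, _, _⟩ <;> first | omega | contradiction

lemma whiteRectVerts_union_lastColumn (hy : ∀ i, 1 ≤ y i ∧ y i ≤ n) :
    whiteRectVerts n m (Set.range y) ∪ (lastColumn n x y).verts
      = blackRectVerts n (m + 1) (Set.range x) := by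
  have hy' : ∀ i ∈ Set.range y, 1 ≤ i ∧ i ≤ n := by
    rintro _ ⟨i, rfl⟩
    exact hy i
  ext ⟨b, i, j⟩
  simp only [whiteRectVerts, lastColumn, columnGraph, blackRectVerts, Set.mem_ofPred_eq,
    Set.mem_union]
  have := hy' i
  cases b
  · simp only [true_and, Bool.false_eq_true, false_and, or_false]
    by_cases hi : i ∈ Set.range y <;> simp only [hi, not_true, not_false_eq_true, and_true,
      and_false, or_false, forall_true_left] at * <;> omega
  · simp only [true_and, Bool.true_eq_false, false_and, false_or]
    by_cases hi : i ∈ Set.range x <;> simp only [hi, not_true, not_false_eq_true, and_true,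
      and_false, or_false] at * <;> omega

/-- Adding the last column to a matching of a white-edged rectangle. -/
lemma sup_lastColumn_isMatching (hx : StrictMono x) (hxb : ∀ i, 1 ≤ x i ∧ x i ≤ n + 1)
    (h : ∀ i : Fin m, x i.castSucc ≤ y i ∧ y i < x i.succ) {M : coloredGrid.Subgraph}
    (hv : M.verts = whiteRectVerts n m (Set.range y)) (hM : M.IsMatching) :
    (M ⊔ lastColumn n x y).verts = blackRectVerts n (m + 1) (Set.range x) ∧
      (M ⊔ lastColumn n x y).IsMatching := by
  have hC := lastColumn_isMatching hx hxb h
  constructor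
  · rw [SimpleGraph.Subgraph.verts_sup, hv, whiteRectVerts_union_lastColumn]
    intro i
    have := h i
    have := hxb i.castSucc
    have := hxb i.succ
    omega
  · refine hM.sup hC ?_
    rw [hM.support_eq_verts, hC.support_eq_verts, hv]
    exact disjoint_whiteRectVerts_lastColumn

/-- The rows in which a white vertex of column `c` is matched to the column to its left. -/
def leftMatched (M : coloredGrid.Subgraph) (c : ℕ) : Set ℕ :=
  {i | ∃ k, M.Adj (false, i, c + 1) (true, k, c)}

lemma leftMatched_sup_lastColumn {M : coloredGrid.Subgraph}
    (hv : M.verts = whiteRectVerts n m (Set.range y)) (hM : M.IsMatching) :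
    leftMatched (M ⊔ lastColumn n x y) m = Set.range y := by
  ext i
  constructor
  · rintro ⟨k, h | h⟩
    · have := M.edge_vert h
      rw [hv] at this
      rcases this with ⟨-, ⟨-, -, -, h⟩ | ⟨-, h⟩⟩ | ⟨h, -⟩
      · simp at h
      · exact h
      · simp at h
    · have := h.2.1
      simp at this
  · intro hi
    obtain ⟨⟨b, k, l⟩, hadj, -⟩ := hM (v := (false, i, m + 1)) (by
      rw [hv]
      exact Or.inl ⟨rfl, Or.inr ⟨rfl, hi⟩⟩)
    have hmem := M.edge_vert hadj.symm
    rw [hv] at hmem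
    rcases M.adj_sub hadj with ⟨-, hb, hA⟩ | ⟨-, hb, -⟩
    · simp only at hb
      subst hb
      rcases hmem with ⟨h, -⟩ | ⟨-, -, -, -, hl⟩
      · simp at h
      · obtain rfl : l = m := by
          have := hA.2
          simp only at this hl
          omega
        exact ⟨k, Or.inl hadj⟩
    · simp at hb

lemma adj_iff_sup_lastColumn {M : coloredGrid.Subgraph}
    (hv : M.verts = whiteRectVerts n m (Set.range y)) (u v : Bool × ℕ × ℕ) :
    M.Adj u v ↔ (M ⊔ lastColumn n x y).Adj u v ∧ u ∈ whiteRectVerts n m (Set.range y) := by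
  constructor
  · exact fun h => ⟨Or.inl h, hv ▸ M.edge_vert h⟩
  · rintro ⟨h | h, hu⟩
    · exact h
    · exact (Set.disjoint_left.1 disjoint_whiteRectVerts_lastColumn hu
        ((lastColumn n x y).edge_vert h)).elim

end decomposition

section blackRect

variable {n m : ℕ} {X : Set ℕ} {M : coloredGrid.Subgraph}

lemma leftMatched_subset (hv : M.verts = blackRectVerts n (m + 1) X) {i : ℕ}
    (hi : i ∈ leftMatched M m) : 1 ≤ i ∧ i ≤ n := by
  obtain ⟨k, hk⟩ := hi
  have := M.edge_vert hk
  rw [hv] at this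
  rcases this with ⟨-, h1, h2, -⟩ | ⟨h, -⟩
  · exact ⟨h1, h2⟩
  · simp at h

/-- Indicator of an edge from the white vertex `(i, m + 1)` down to `(i + 1, m + 1)`. -/
noncomputable def downEdge (M : coloredGrid.Subgraph) (m i : ℕ) : ℕ :=
  if M.Adj (false, i, m + 1) (true, i + 1, m + 1) then 1 else 0

/-- Indicator of an edge from the white vertex `(i, m + 1)` to `(i, m + 1)`. -/
noncomputable def sideEdge (M : coloredGrid.Subgraph) (m i : ℕ) : ℕ :=
  if M.Adj (false, i, m + 1) (true, i, m + 1) then 1 else 0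

lemma white_balance (hv : M.verts = blackRectVerts n (m + 1) X) (hM : M.IsMatching) {i : ℕ}
    (h1 : 1 ≤ i) (hi : i ≤ n) :
    indicatorNat (leftMatched M m) i + downEdge M m i + sideEdge M m i = 1 := by
  obtain ⟨⟨b, k, l⟩, hadj, huniq⟩ := hM (v := (false, i, m + 1)) (by
    rw [hv]
    exact Or.inl ⟨rfl, h1, hi, by simp, by simp⟩)
  have hL : i ∈ leftMatched M m ↔ l = m := by
    constructor
    · rintro ⟨k', hk'⟩
      have := huniq _ hk'
      simp only [Prod.mk.injEq] at this
      omega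
    · rintro rfl
      rcases M.adj_sub hadj with ⟨-, hb, -⟩ | ⟨-, hb, -⟩
      · simp only at hb
        subst hb
        exact ⟨k, hadj⟩
      · simp at hb
  have key : ∀ k' l', M.Adj (false, i, m + 1) (true, k', l') ↔ k' = k ∧ l' = l := by
    intro k' l'
    constructor
    · intro h
      have := huniq _ h
      simp only [Prod.mk.injEq] at this
      exact this.2
    · rintro ⟨rfl, rfl⟩
      rcases M.adj_sub hadj with ⟨-, hb, -⟩ | ⟨-, hb, -⟩
      · simp only at hb
        subst hb
        exact hadj
      · simp at hb
  rcases M.adj_sub hadj with ⟨-, -, hA⟩ | ⟨-, hb, -⟩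
  · obtain ⟨hA1, hA2⟩ := hA
    simp only at hA1 hA2
    simp only [indicatorNat, hL, downEdge, sideEdge, key]
    split_ifs <;> omega
  · simp at hb

lemma black_balance (hv : M.verts = blackRectVerts n (m + 1) X) (hM : M.IsMatching) {k : ℕ}
    (hk : k ≤ n) :
    indicatorNat X (k + 1) + downEdge M m k + sideEdge M m (k + 1) = 1 := by
  by_cases hX : k + 1 ∈ X
  · have key : ∀ v, ¬ M.Adj v (true, k + 1, m + 1) := by
      intro v h
      have := M.edge_vert h.symm
      rw [hv] at this
      rcases this with ⟨h, -⟩ | ⟨-, -, -, ⟨-, h⟩ | ⟨-, h⟩⟩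
      · simp at h
      · simp at h
      · exact h hX
    simp [downEdge, sideEdge, key, indicatorNat_of_mem hX]
  · obtain ⟨⟨b, i, l⟩, hadj, huniq⟩ := hM (v := (true, k + 1, m + 1)) (by
      rw [hv]
      exact Or.inr ⟨rfl, by simp, by simpa using hk, Or.inr ⟨rfl, hX⟩⟩)
    have hmem := M.edge_vert hadj.symm
    rw [hv] at hmem
    rcases M.adj_sub hadj with ⟨hb, -⟩ | ⟨hb, -, hA⟩
    · simp at hb
    · simp only at hb
      subst hb
      have key : ∀ i' l', M.Adj (false, i', l') (true, k + 1, m + 1) ↔ i' = i ∧ l' = l := by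
        intro k' l'
        constructor
        · intro h
          have := huniq _ h.symm
          simp only [Prod.mk.injEq] at this
          exact this.2
        · rintro ⟨rfl, rfl⟩
          exact hadj.symm
      obtain ⟨hA1, hA2⟩ := hA
      simp only at hA1 hA2
      rcases hmem with ⟨-, -, -, -, hl⟩ | ⟨h, -⟩
      · simp only at hl
        simp only [downEdge, sideEdge, key, indicatorNat_of_notMem hX]
        split_ifs <;> omega
      · simp at h

lemma edges_eq_zero_of_row_outside (hv : M.verts = blackRectVerts n (m + 1) X) {i : ℕ}
    (hi : i = 0 ∨ n < i) : downEdge M m i = 0 ∧ sideEdge M m i = 0 := by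
  have key : ∀ v, ¬ M.Adj (false, i, m + 1) v := by
    intro v h
    have := M.edge_vert h
    rw [hv] at this
    rcases this with ⟨-, h1, h2, -⟩ | ⟨h, -⟩
    · simp only at h1 h2
      omega
    · simp at h
  simp [downEdge, sideEdge, key]

/-- The left-matched rows of a matching of the black-edged rectangle interlace the dents, and
the matching determines the counting functions. -/
lemma exists_interlacing {x : Fin (m + 1) → ℕ} (hx : StrictMono x)
    (hxb : ∀ i, 1 ≤ x i ∧ x i ≤ n + 1)
    (hv : M.verts = blackRectVerts n (m + 1) (Set.range x)) (hM : M.IsMatching) :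
    ∃ y : Fin m → ℕ, (∀ i : Fin m, x i.castSucc ≤ y i ∧ y i < x i.succ) ∧
      Set.range y = leftMatched M m ∧
      ∀ k ≤ n, countLE x k = countLE y k + downEdge M m k := by
  obtain ⟨r, y, hy, hrange⟩ : ∃ (r : ℕ) (y : Fin r → ℕ), StrictMono y ∧
      Set.range y = leftMatched M m := by
    have hfin : (leftMatched M m).Finite :=
      (Set.finite_Iic n).subset fun i hi => (leftMatched_subset hv hi).2
    refine ⟨_, hfin.toFinset.orderEmbOfFin rfl, OrderEmbedding.strictMono _, ?_⟩
    rw [Finset.range_orderEmbOfFin, Set.Finite.coe_toFinset]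
  have hyb : ∀ i, 1 ≤ y i ∧ y i ≤ n := fun i =>
    leftMatched_subset hv (hrange ▸ Set.mem_range_self i)
  have hcount : ∀ k ≤ n, countLE x k = countLE y k + downEdge M m k := by
    intro k
    induction k with
    | zero =>
      intro _
      rw [countLE_eq_zero fun i => (hxb i).1, countLE_eq_zero fun i => (hyb i).1,
        (edges_eq_zero_of_row_outside hv (Or.inl rfl)).1]
    | succ k ih =>
      intro hk
      have := ih (by omega)
      have := countLE_succ hx k
      have := countLE_succ hy k
      have h1 := white_balance hv hM (i := k + 1) (by omega) hk
      have h2 := black_balance hv hM (k := k) (by omega)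
      rw [← hrange] at h1
      omega
  have hxn := countLE_succ hx n
  have hxn' : countLE x (n + 1) = m + 1 := countLE_eq_self fun i => (hxb i).2
  have hyn : countLE y n = r := countLE_eq_self fun i => (hyb i).2
  have hlast := black_balance hv hM (k := n) le_rfl
  have hside := (edges_eq_zero_of_row_outside hv (i := n + 1) (Or.inr (by omega))).2
  have hn := hcount n le_rfl
  obtain rfl : r = m := by omega
  refine ⟨y, (interlacing_iff_countLE hx hy).2 fun k => ?_, hrange, hcount⟩
  rcases le_or_gt k n with hk | hk
  · have := hcount k hk
    have := countLE_succ hx k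
    have := black_balance hv hM hk
    omega
  · have h1 : countLE y k = r := countLE_eq_self fun i => (hyb i).2.trans hk.le
    have h2 : countLE x k = r + 1 := countLE_eq_self fun i => (hxb i).2.trans hk
    have := countLE_le (x := x) (k + 1)
    omega

/-- Every matching of the black-edged rectangle is a matching of a white-edged rectangle
together with the last column. -/
lemma exists_eq_sup_lastColumn {x : Fin (m + 1) → ℕ} (hx : StrictMono x)
    (hxb : ∀ i, 1 ≤ x i ∧ x i ≤ n + 1)
    (hv : M.verts = blackRectVerts n (m + 1) (Set.range x)) (hM : M.IsMatching) :
    ∃ y : Fin m → ℕ, (∀ i : Fin m, x i.castSucc ≤ y i ∧ y i < x i.succ) ∧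
      ∃ N : coloredGrid.Subgraph, N.verts = whiteRectVerts n m (Set.range y) ∧
        N.IsMatching ∧ N ⊔ lastColumn n x y = M := by
  obtain ⟨y, hxy, hrange, hcount⟩ := exists_interlacing hx hxb hv hM
  have hyb : ∀ i, 1 ≤ y i ∧ y i ≤ n := fun i =>
    leftMatched_subset hv (hrange ▸ Set.mem_range_self i)
  have hsub : whiteRectVerts n m (Set.range y) ⊆ M.verts := by
    rw [hv, ← whiteRectVerts_union_lastColumn hyb]
    exact Set.subset_union_left
  have hN : (M.induce (whiteRectVerts n m (Set.range y))).IsMatching := by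
    refine hM.induce hsub ?_
    rintro ⟨a, i, j⟩ hu ⟨b, k, l⟩ hadj
    have hmem := M.edge_vert hadj.symm
    rw [hv] at hmem
    rcases M.adj_sub hadj with ⟨ha, hb, hA⟩ | ⟨hb, ha, hA⟩
    · simp only at ha hb
      subst ha hb
      obtain ⟨hA1, hA2⟩ := hA
      rcases hmem with ⟨h, -⟩ | ⟨-, hk1, hk2, hl⟩
      · simp at h
      simp only at hA1 hA2 hk1 hk2 hl
      refine Or.inr ⟨rfl, hk1, hk2, ?_⟩
      rcases hu with ⟨-, ⟨hi1, hi2, hj1, hj2⟩ | ⟨hj, hi⟩⟩ | ⟨h, -⟩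
      · simp only at hj1 hj2 ⊢
        omega
      · simp only at hj hi ⊢
        subst hj
        rw [hrange] at hi
        obtain ⟨k', hk'⟩ := hi
        have := hM.eq_of_adj_left hk' hadj
        simp only [Prod.mk.injEq, true_and] at this
        rcases hl with hl | hl <;> omega
      · simp at h
    · simp only at ha hb
      subst ha hb
      obtain ⟨hA1, hA2⟩ := hA
      rcases hmem with ⟨-, hk1, hk2, hl1, hl2⟩ | ⟨h, -⟩
      swap
      · simp at h
      rcases hu with ⟨h, -⟩ | ⟨-, hi1, hi2, hj1, hj2⟩
      · simp at h
      simp only at hA1 hA2 hk1 hk2 hl1 hl2 hi1 hi2 hj1 hj2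
      refine Or.inl ⟨rfl, ?_⟩
      rcases Nat.lt_or_ge m l with hl | hl
      · obtain rfl : l = m + 1 := by omega
        obtain rfl : j = m := by omega
        exact Or.inr ⟨rfl, hrange ▸ ⟨i, hadj.symm⟩⟩
      · exact Or.inl ⟨hk1, hk2, hl1, hl⟩
  have hedge : ∀ i, 1 ≤ i → i ≤ n → i ∉ Set.range y → ∀ k,
      (k = i + if countLE x i - countLE y i = 0 then 0 else 1) →
      M.Adj (false, i, m + 1) (true, k, m + 1) := by
    rintro i h1 h2 h3 k rfl
    have hbal := white_balance hv hM h1 h2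
    rw [← hrange, indicatorNat_of_notMem h3] at hbal
    have hc := hcount i h2
    have hc' : countLE x i - countLE y i = downEdge M m i := by omega
    rw [hc']
    by_cases hd : downEdge M m i = 0
    · have hs : sideEdge M m i ≠ 0 := by omega
      rw [if_pos hd]
      simpa [sideEdge] using hs
    · rw [if_neg hd]
      simpa [downEdge] using hd
  obtain ⟨hsv, hsM⟩ := sup_lastColumn_isMatching hx hxb hxy rfl hN
  refine ⟨y, hxy, _, rfl, hN, hsM.eq_of_le hM ⟨(hsv.trans hv.symm).le, ?_⟩ (hsv.trans hv.symm)⟩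
  rintro ⟨a, i, j⟩ ⟨b, k, l⟩ (h | h)
  · exact h.2.2
  · obtain ⟨hj, hl, ⟨ha, hb, h1, h2, h3, -, h4⟩ | ⟨ha, hb, h1, h2, h3, -, h4⟩⟩ := h
    · simp only at *
      subst ha hb hj hl
      exact hedge i h1 h2 h3 k h4
    · simp only at *
      subst ha hb hj hl
      exact (hedge k h1 h2 h3 i h4).symm

end blackRect

/-- `D_{n,m+1}(x 1, …, x (m+1))` equals the sum, over all tuples `(y 1, …, y m)` with
`x i ≤ y i ≤ x (i+1) - 1` for each `i`, of `E_{n,m}(y 1, …, y m)`. -/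
theorem black_rect_as_sum_of_white_rects (n m : ℕ) (hn : 1 ≤ n) (hm : 1 ≤ m) (hmn : m ≤ n)
    (x : Fin (m + 1) → ℕ) (hx : StrictMono x) (hxb : ∀ i, 1 ≤ x i ∧ x i ≤ n + 1) :
    matchCount coloredGrid (blackRectVerts n (m + 1) (Set.range x))
      = ∑ y ∈ Fintype.piFinset (fun i : Fin m => Finset.Icc (x i.castSucc) (x i.succ - 1)),
          matchCount coloredGrid (whiteRectVerts n m (Set.range y)) := by
  set T := Fintype.piFinset (fun i : Fin m => Finset.Icc (x i.castSucc) (x i.succ - 1)) with hT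
  have hmem : ∀ y, y ∈ T ↔ ∀ i : Fin m, x i.castSucc ≤ y i ∧ y i < x i.succ := by
    intro y
    simp only [hT, Fintype.mem_piFinset, Finset.mem_Icc]
    refine forall_congr' fun i => ?_
    have := (hxb i.succ).1
    omega
  have hfin : ∀ y : T, Finite {M : coloredGrid.Subgraph //
      M.verts = whiteRectVerts n m (Set.range y.1) ∧ M.IsMatching} := fun y =>
    finite_matchings (whiteRectVerts_finite n m (Set.finite_range _))
  rw [← Finset.sum_coe_sort]
  unfold matchCount
  rw [← Nat.card_sigma]
  refine (Nat.card_congr (Equiv.ofBijective (fun p => ⟨p.2.1 ⊔ lastColumn n x p.1.1,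
    sup_lastColumn_isMatching hx hxb ((hmem _).1 p.1.2) p.2.2.1 p.2.2.2⟩) ⟨?_, ?_⟩)).symm
  · rintro ⟨⟨y, hy⟩, M, hMv, hM⟩ ⟨⟨z, hz⟩, N, hNv, hN⟩ h
    have h' : M ⊔ lastColumn n x y = N ⊔ lastColumn n x z := congrArg Subtype.val h
    have hrange : Set.range y = Set.range z := by
      rw [← leftMatched_sup_lastColumn (x := x) hMv hM, h', leftMatched_sup_lastColumn hNv hN]
    obtain rfl : y = z := ((strictMono_of_interlacing hx ((hmem y).1 hy)).range_inj
      (strictMono_of_interlacing hx ((hmem z).1 hz))).1 hrange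
    obtain rfl : M = N := by
      refine SimpleGraph.Subgraph.ext (hMv.trans hNv.symm) ?_
      funext u v
      rw [adj_iff_sup_lastColumn (x := x) hMv, adj_iff_sup_lastColumn (x := x) hNv, h']
    rfl
  · rintro ⟨M, hMv, hM⟩
    obtain ⟨y, hxy, N, hNv, hN, hsup⟩ := exists_eq_sup_lastColumn hx hxb hMv hM
    exact ⟨⟨⟨y, (hmem y).2 hxy⟩, N, hNv, hN⟩, Subtype.ext hsup⟩
end

section
/- (Weighted count for holes on the edge.) Let n ≥ 1 and let w_1, d_0, d_1 be integers with d_0 ≥ 1, d_1 ≥ 1, 1 ≤ w_1 ≤ n, w_1 + d_1 ≤ n+1, and d_0 + 1 ≤ n+1. Let G' be the induced subgraph of the Aztec diamond graph AD_n obtained by deleting the white vertex (1, w_1 + d_1) and the black vertex (d_0 + 1, w_1). For a perfect matching T of G', let w(T) be the number of edges of T that join a black vertex (i, w_1) with 1 ≤ i ≤ d_0 to a white vertex (i-1, w_1+1) or to a white vertex (i, w_1+1). Then the sum of (-1)^{w(T)} over all perfect matchings T of G' equals (-1)^{w_1 + 1} · Kr(w_1 - 1, n-1, n - d_0) · 2^{n(n-1)/2}.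 -/
open scoped Classical

def aztecVerts (n : ℕ) : Set (Bool × ℕ × ℕ) :=
  {v | (v.1 = false ∧ 1 ≤ v.2.1 ∧ v.2.1 ≤ n ∧ 1 ≤ v.2.2 ∧ v.2.2 ≤ n + 1) ∨
       (v.1 = true ∧ 1 ≤ v.2.1 ∧ v.2.1 ≤ n + 1 ∧ 1 ≤ v.2.2 ∧ v.2.2 ≤ n)}

noncomputable def Kr (a b c : ℕ) : ℤ :=
  ((1 - Polynomial.X) ^ c * (1 + Polynomial.X) ^ (b - c) : Polynomial ℤ).coeff a

open Polynomial Finset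

/-- Value at `(a, b)` of the degree-`m` homogenization of a polynomial `p`. -/
noncomputable def homogEval (m : ℕ) (p : ℤ[X]) (a b : ℤ[X]) : ℤ[X] :=
  ∑ k ∈ range (m + 1), (p.coeff k : ℤ[X]) * a ^ k * b ^ (m - k)

lemma homogEval_linear_mul (m : ℕ) (t : ℤ) (p : ℤ[X]) (hp : p.natDegree ≤ m) (a b : ℤ[X]) :
    homogEval (m + 1) ((1 + C t * X) * p) a b = (b + C t * a) * homogEval m p a b := by
  have hcoeff (k : ℕ) : ((1 + C t * X) * p).coeff (k + 1) = p.coeff (k + 1) + t * p.coeff k := by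
    rw [add_mul, one_mul, mul_assoc, coeff_add, coeff_C_mul, coeff_X_mul]
  have hzero : ((1 + C t * X) * p).coeff 0 = p.coeff 0 := by simp [add_mul, mul_assoc]
  have htop : p.coeff (m + 1) = 0 := coeff_eq_zero_of_natDegree_lt (by omega)
  have hb : b * homogEval m p a b =
      ∑ k ∈ range (m + 2), (p.coeff k : ℤ[X]) * a ^ k * b ^ (m + 1 - k) := by
    rw [sum_range_succ, htop, homogEval, mul_sum]
    simp only [Int.cast_zero, zero_mul, add_zero]
    refine sum_congr rfl fun k hk => ?_
    rw [show m + 1 - k = (m - k) + 1 by have := mem_range.1 hk; omega]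
    ring
  rw [add_mul (b : ℤ[X]), hb, homogEval, sum_range_succ', sum_range_succ' (n := m + 1), hzero, homogEval]
  rw [mul_sum, add_right_comm, ← sum_add_distrib]
  congr 1
  refine sum_congr rfl fun k hk => ?_
  rw [hcoeff, Nat.add_sub_add_right]
  simp only [Int.cast_add, Int.cast_mul, eq_intCast]
  ring

lemma natDegree_one_sub_X_pow_mul_le (i j : ℕ) :
    ((1 - X) ^ i * (1 + X) ^ j : ℤ[X]).natDegree ≤ i + j := by
  compute_degree

lemma homogEval_one_sub_X_pow_mul (i j : ℕ) (a b : ℤ[X]) :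
    homogEval (i + j) ((1 - X) ^ i * (1 + X) ^ j) a b = (b - a) ^ i * (b + a) ^ j := by
  induction i with
  | zero =>
    induction j with
    | zero => simp [homogEval]
    | succ j ih =>
      have h := homogEval_linear_mul (0 + j) 1 ((1 - X) ^ 0 * (1 + X) ^ j)
        (natDegree_one_sub_X_pow_mul_le 0 j) a b
      rw [ih] at h
      convert h using 1
      · congr 1
        simp only [map_one]; ring
      · simp only [map_one]; ring
  | succ i ih =>
    have h := homogEval_linear_mul (i + j) (-1) ((1 - X) ^ i * (1 + X) ^ j)
      (natDegree_one_sub_X_pow_mul_le i j) a b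
    rw [ih] at h
    convert h using 1
    · rw [Nat.add_right_comm]
      congr 1
      simp only [map_neg, map_one]; ring
    · simp only [map_neg, map_one]; ring

/-- The matrix of coefficients of `(1 - X) ^ k * (1 + X) ^ (m - k)`, `k ≤ m`. -/
noncomputable def krawMatrix (m : ℕ) : Matrix (Fin (m + 1)) (Fin (m + 1)) ℤ :=
  fun i k => ((1 - X) ^ (k : ℕ) * (1 + X) ^ (m - k) : ℤ[X]).coeff i

lemma krawMatrix_mul_self (m : ℕ) : krawMatrix m * krawMatrix m = (2 ^ m : ℤ) • 1 := by
  ext i j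
  have hj : (j : ℕ) + (m - j) = m := by omega
  have h := homogEval_one_sub_X_pow_mul j (m - j) (1 - X) (1 + X)
  rw [hj, show (1 + X - (1 - X) : ℤ[X]) = C 2 * X by simp only [map_ofNat]; ring,
    show (1 + X + (1 - X) : ℤ[X]) = C 2 by simp only [map_ofNat]; ring, mul_pow, mul_right_comm,
    ← pow_add, hj, ← C_pow] at h
  have h' := congrArg (coeff · (i : ℕ)) h
  simp only [homogEval, finsetSum_coeff, coeff_C_mul, coeff_X_pow] at h'
  rw [← Fin.sum_univ_eq_sum_range (fun k => coeff (_ * _ * _) _)] at h'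
  rw [Matrix.mul_apply, Matrix.smul_apply, Matrix.one_apply]
  simp only [Fin.ext_iff, smul_eq_mul]
  rw [← h']
  refine sum_congr rfl fun k _ => ?_
  rw [mul_assoc, ← eq_intCast (C : ℤ →+* ℤ[X]), coeff_C_mul, mul_comm]
  rfl

lemma det_krawMatrix_sq (m : ℕ) : (krawMatrix m).det ^ 2 = 2 ^ (m * (m + 1)) := by
  rw [sq, ← Matrix.det_mul, krawMatrix_mul_self, Matrix.det_smul, Matrix.det_one, mul_one,
    Fintype.card_fin, pow_mul]

/-- White vertices of the Aztec diamond, as pairs `(row, position)` counted from `0`. -/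
abbrev White (n : ℕ) : Type := Fin (n + 1) × Fin n

/-- Black vertices of the Aztec diamond, as pairs `(row, position)` counted from `0`. -/
abbrev Black (n : ℕ) : Type := Fin n × Fin (n + 1)

/-- The signed adjacency matrix in which the edges between black row `y` and white row `y + 1`
carry the weights `γ y` and `-γ y`. -/
def kast (n : ℕ) (γ : ℕ → ℤ) : Matrix (Black n) (White n) ℤ := fun b w =>
  (if (w.1 : ℕ) = b.1 then
    (if (b.2 : ℕ) = w.2 then 1 else 0) + (if (b.2 : ℕ) = w.2 + 1 then 1 else 0) else 0) +
  (if (w.1 : ℕ) = b.1 + 1 then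
    γ b.1 * ((if (b.2 : ℕ) = w.2 then 1 else 0) - (if (b.2 : ℕ) = w.2 + 1 then 1 else 0)) else 0)

/-- The matrix of `kast` in the bases `(1 - X) ^ k * (1 + X) ^ (m - k)`. -/
def kastKraw (n : ℕ) (γ : ℕ → ℤ) : Matrix (Black n) (White n) ℤ := fun b w =>
  (if (w.1 : ℕ) = b.1 then (if (b.2 : ℕ) = w.2 then 1 else 0) else 0) +
  (if (w.1 : ℕ) = b.1 + 1 then γ b.1 * (if (b.2 : ℕ) = w.2 + 1 then 1 else 0) else 0)

lemma sum_white_row {n : ℕ} (f : White n → ℤ) (y : ℕ) (hy : y < n + 1) :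
    ∑ w : White n, (if (w.1 : ℕ) = y then f w else 0) = ∑ x, f (⟨y, hy⟩, x) := by
  rw [Fintype.sum_prod_type, sum_eq_single ⟨y, hy⟩]
  · simp
  · intro y' _ hne
    refine sum_eq_zero fun x _ => if_neg fun h => hne (Fin.ext h)
  · simp

lemma sum_fin_ite_coeff {n : ℕ} (p : ℤ[X]) (hp : p.natDegree < n) (k : ℕ) :
    ∑ x : Fin n, (if k = (x : ℕ) then 1 else 0) * p.coeff x = p.coeff k := by
  rw [Fin.sum_univ_eq_sum_range (fun x => (if k = x then 1 else 0) * p.coeff x)]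
  by_cases hk : k < n
  · simp [hk]
  · simp [hk, coeff_eq_zero_of_natDegree_lt (show p.natDegree < k by omega)]

lemma sum_fin_ite_succ_coeff {n : ℕ} (p : ℤ[X]) (hp : p.natDegree < n) (k : ℕ) :
    ∑ x : Fin n, (if k = (x : ℕ) + 1 then 1 else 0) * p.coeff x = (X * p).coeff k := by
  cases k with
  | zero => simp
  | succ k => simpa using sum_fin_ite_coeff p hp k

/-- In terms of generating polynomials of the rows, `kast` is `f ↦ (1+X) f_y + γ_y (1-X) f_{y+1}`. -/
lemma kast_mulVec_coeff {n : ℕ} (γ : ℕ → ℤ) (F : ℕ → ℤ[X]) (hF : ∀ y ≤ n, (F y).natDegree < n)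
    (b : Black n) :
    ∑ w : White n, kast n γ b w * (F w.1).coeff w.2 =
      ((1 + X) * F b.1 + C (γ b.1) * ((1 - X) * F (b.1 + 1))).coeff b.2 := by
  have h₁ : (b.1 : ℕ) < n + 1 := by omega
  have h₂ : (b.1 : ℕ) + 1 < n + 1 := by omega
  simp only [kast, add_mul, ite_mul, zero_mul, sum_add_distrib]
  rw [sum_white_row _ _ h₁, sum_white_row _ _ h₂]
  simp only [mul_assoc, sub_mul, ← mul_sum, sum_add_distrib, sum_sub_distrib]
  have e₁ := sum_fin_ite_coeff (F b.1) (hF _ (by omega)) b.2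
  have e₂ := sum_fin_ite_succ_coeff (F b.1) (hF _ (by omega)) b.2
  have e₃ := sum_fin_ite_coeff (F (b.1 + 1)) (hF _ (by omega)) b.2
  have e₄ := sum_fin_ite_succ_coeff (F (b.1 + 1)) (hF _ (by omega)) b.2
  simp only [ite_mul, one_mul, zero_mul] at e₁ e₂ e₃ e₄ ⊢
  rw [e₁, e₂, e₃, e₄]
  simp only [coeff_add, coeff_C_mul, coeff_sub]

open Kronecker in
lemma kast_mul_kraw (m : ℕ) (γ : ℕ → ℤ) :
    kast (m + 1) γ * ((1 : Matrix (Fin (m + 2)) (Fin (m + 2)) ℤ) ⊗ₖ krawMatrix m) =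
      ((1 : Matrix (Fin (m + 1)) (Fin (m + 1)) ℤ) ⊗ₖ krawMatrix (m + 1)) *
        kastKraw (m + 1) γ := by
  ext b ⟨y, k⟩
  let p : ℤ[X] := (1 - X) ^ (k : ℕ) * (1 + X) ^ (m - k)
  have hp : p.natDegree < m + 1 := by
    have := natDegree_one_sub_X_pow_mul_le k (m - k)
    change p.natDegree ≤ _ at this
    omega
  have h := kast_mulVec_coeff (n := m + 1) γ (fun y' => if y' = y then p else 0)
    (fun y' _ => by split_ifs <;> simp [hp]) b
  have hl : (kast (m + 1) γ * ((1 : Matrix (Fin (m + 2)) (Fin (m + 2)) ℤ) ⊗ₖ krawMatrix m))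
      b (y, k) = ∑ w : White (m + 1), kast (m + 1) γ b w *
        (if (w.1 : ℕ) = y then p else 0).coeff w.2 := by
    rw [Matrix.mul_apply]
    refine sum_congr rfl fun w _ => ?_
    rw [Matrix.kroneckerMap_apply, Matrix.one_apply]
    by_cases hw : w.1 = y
    · simp [hw, krawMatrix, p]
    · simp [hw, Fin.val_inj]
  have hr : (((1 : Matrix (Fin (m + 1)) (Fin (m + 1)) ℤ) ⊗ₖ krawMatrix (m + 1)) *
        kastKraw (m + 1) γ) b (y, k) =
      ∑ j, krawMatrix (m + 1) b.2 j * kastKraw (m + 1) γ (b.1, j) (y, k) := by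
    rw [Matrix.mul_apply, Fintype.sum_prod_type, sum_eq_single b.1]
    · simp
    · intro y' _ hne
      refine sum_eq_zero fun x _ => ?_
      simp [Matrix.kroneckerMap_apply, hne.symm]
    · simp
  have e₁ : ∑ j : Fin (m + 2), krawMatrix (m + 1) b.2 j * (if (j : ℕ) = k then 1 else 0) =
      ((1 + X) * p).coeff b.2 := by
    rw [sum_eq_single k.castSucc]
    · simp only [krawMatrix, p, Fin.val_castSucc, if_true, mul_one]
      rw [show m + 1 - (k : ℕ) = m - k + 1 by omega]
      ring_nf
    · intro j _ hj
      rw [if_neg (fun h => hj (Fin.ext (by simpa using h))), mul_zero]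
    · simp
  have e₂ : ∑ j : Fin (m + 2), krawMatrix (m + 1) b.2 j * (if (j : ℕ) = k + 1 then 1 else 0) =
      ((1 - X) * p).coeff b.2 := by
    rw [sum_eq_single k.succ]
    · simp only [krawMatrix, p, Fin.val_succ, if_true, mul_one]
      rw [show m + 1 - ((k : ℕ) + 1) = m - k by omega]
      ring_nf
    · intro j _ hj
      rw [if_neg (fun h => hj (Fin.ext (by simpa using h))), mul_zero]
    · simp
  rw [hl, h, hr]
  simp only [kastKraw, mul_add, sum_add_distrib, coeff_add, coeff_C_mul]
  congr 1
  · by_cases hy : (b.1 : ℕ) = y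
    · simp only [hy, if_true]; exact e₁.symm
    · simp [hy, Ne.symm hy]
  · by_cases hy : (b.1 : ℕ) + 1 = y
    · simp only [hy, if_true, mul_left_comm _ (γ _), ← mul_sum]
      rw [e₂]
    · simp [hy, Ne.symm hy]

/-- Partial products of the signs `-γ`. -/
def signGauge (γ : ℕ → ℤ) (y : ℕ) : ℤ := ∏ i ∈ range y, -γ i

lemma signGauge_succ (γ : ℕ → ℤ) (y : ℕ) : signGauge γ (y + 1) = -γ y * signGauge γ y := by
  rw [signGauge, prod_range_succ, mul_comm, signGauge]

lemma signGauge_mul_self {γ : ℕ → ℤ} (hγ : ∀ y, γ y * γ y = 1) (y : ℕ) :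
    signGauge γ y * signGauge γ y = 1 := by
  rw [signGauge, ← prod_mul_distrib]
  exact prod_eq_one fun i _ => by rw [neg_mul_neg, hγ]

/-- A right inverse of `kastKraw`. -/
def kastKrawInv (n : ℕ) (γ : ℕ → ℤ) : Matrix (White n) (Black n) ℤ := fun w b =>
  if (w.1 : ℕ) + w.2 = b.1 + b.2 then
    if (b.1 : ℕ) + b.2 < n then (if (w.1 : ℕ) ≤ b.1 then signGauge γ b.1 * signGauge γ w.1 else 0)
    else (if (b.1 : ℕ) < w.1 then -(signGauge γ b.1 * signGauge γ w.1) else 0)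
  else 0

lemma sum_fin_ite_eq {n : ℕ} (f : ℕ → ℤ) (k : ℕ) :
    ∑ x : Fin n, (if k = (x : ℕ) then f x else 0) = if k < n then f k else 0 := by
  rw [Fin.sum_univ_eq_sum_range (fun x => if k = x then f x else 0)]
  simp

lemma kastKraw_mul_inv {n : ℕ} {γ : ℕ → ℤ} (hγ : ∀ y, γ y * γ y = 1) :
    kastKraw n γ * kastKrawInv n γ = 1 := by
  ext b b'
  have h₁ : (b.1 : ℕ) < n + 1 := by omega
  have h₂ : (b.1 : ℕ) + 1 < n + 1 := by omega
  let g : ℕ → ℕ → ℤ := fun y x => if y + x = b'.1 + b'.2 then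
    if (b'.1 : ℕ) + b'.2 < n then (if y ≤ b'.1 then signGauge γ b'.1 * signGauge γ y else 0)
    else (if (b'.1 : ℕ) < y then -(signGauge γ b'.1 * signGauge γ y) else 0)
  else 0
  have hg (w : White n) : kastKrawInv n γ w b' = g w.1 w.2 := rfl
  rw [Matrix.mul_apply]
  simp only [kastKraw, hg, add_mul, ite_mul, zero_mul, sum_add_distrib]
  rw [sum_white_row _ _ h₁, sum_white_row _ _ h₂]
  simp only [mul_assoc, ite_mul, one_mul, zero_mul, ← mul_sum]
  rw [sum_fin_ite_eq (fun x => g b.1 x)]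
  have e : ∑ x : Fin n, (if (b.2 : ℕ) = x + 1 then g (b.1 + 1) x else 0) =
      if (b.2 : ℕ) = 0 then 0 else g (b.1 + 1) (b.2 - 1) := by
    rcases hb : (b.2 : ℕ) with _ | k
    · simp
    · have := sum_fin_ite_eq (n := n) (fun x => g (b.1 + 1) x) k
      simp only [Nat.add_right_cancel_iff]
      rw [this, if_pos (by omega)]
      simp
  rw [e, Matrix.one_apply]
  have hs := signGauge_succ γ b.1
  have hm := signGauge_mul_self hγ b'.1
  have hγb := hγ b.1
  have hb1 := b.1.2
  have hb2 := b.2.2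
  have hb1' := b'.1.2
  have hb2' := b'.2.2
  have hbb : (b = b') ↔ ((b.1 : ℕ) = b'.1 ∧ (b.2 : ℕ) = b'.2) := by
    rw [Prod.ext_iff, Fin.ext_iff, Fin.ext_iff]
  simp only [hbb]
  simp only [g, hs]
  clear hs e g hg hbb
  generalize hA : (b.1 : ℕ) = p at *
  generalize hB : (b.2 : ℕ) = q at *
  generalize hA' : (b'.1 : ℕ) = p' at *
  generalize hB' : (b'.2 : ℕ) = q' at *
  by_cases hc : p + q = p' + q'
  · have hc' : q ≠ 0 → p + 1 + (q - 1) = p' + q' := by omega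
    rcases Nat.lt_trichotomy p p' with hlt | rfl | hgt
    · have : ¬ (p = p' ∧ q = q') := by omega
      have a1 : p ≤ p' := by omega
      have a2 : ¬ p' < p := by omega
      have a3 : p + 1 ≤ p' := by omega
      have a4 : ¬ p' < p + 1 := by omega
      have hq : q ≠ 0 := by omega
      rw [if_neg this]
      simp only [hc, hc' hq, hq, a1, a2, a3, a4, if_true, if_false]
      by_cases hn : p' + q' < n
      · have : q < n := by omega
        simp only [hn, this, if_true]
        linear_combination (-signGauge γ p' * signGauge γ p) * hγb
      · simp [hn]
    · have hqq : q = q' := by omega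
      subst hqq
      by_cases hn : p + q < n
      · have : q < n := by omega
        simp [hn, this, hm]
      · have hq : q ≠ 0 := by omega
        simp only [hc' hq, hq, hn, if_true, if_false]
        simp
        linear_combination γ p * γ p * hm + hγb
    · have : ¬ (p = p' ∧ q = q') := by omega
      have a1 : ¬ p ≤ p' := by omega
      have a2 : p' < p := by omega
      have a3 : ¬ p + 1 ≤ p' := by omega
      have a4 : p' < p + 1 := by omega
      rw [if_neg this]
      by_cases hn : p' + q' < n
      · simp [hn, a1, a3]
      · have hq : q ≠ 0 := by omega
        have : q < n := by omega
        simp only [hc, hc' hq, hq, a2, a4, hn, this, if_true, if_false]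
        linear_combination (signGauge γ p' * signGauge γ p) * hγb
  · have hne : ¬ (p = p' ∧ q = q') := by omega
    rw [if_neg hc, if_neg hne]
    by_cases hq : q = 0
    · simp [hq]
    · have hc' : ¬ p + 1 + (q - 1) = p' + q' := by omega
      simp [hq, hc']

open Kronecker in
/-- The square of the determinant of `kast`, with black rows matched to white columns by `e`. -/
lemma det_kast_sq {n : ℕ} {γ : ℕ → ℤ} (hn : 1 ≤ n) (hγ : ∀ y, γ y * γ y = 1)
    (e : White n ≃ Black n) :
    ((kast n γ).submatrix e id).det ^ 2 = 2 ^ (n * (n + 1)) := by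
  obtain ⟨m, rfl⟩ : ∃ m, n = m + 1 := ⟨n - 1, by omega⟩
  have hunit : ((kastKraw (m + 1) γ).submatrix e id).det ^ 2 = 1 := by
    have h : (kastKraw (m + 1) γ).submatrix e id * (kastKrawInv (m + 1) γ).submatrix id e = 1 := by
      rw [← Matrix.submatrix_mul _ _ e id e Function.bijective_id, kastKraw_mul_inv hγ]
      simp
    have h' := congrArg Matrix.det h
    rw [Matrix.det_mul, Matrix.det_one] at h'
    have := Int.isUnit_iff.1 (IsUnit.of_mul_eq_one _ h')
    rcases this with h | h <;> rw [h] <;> norm_num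
  have h := congrArg (fun M => (M.submatrix e id).det ^ 2) (kast_mul_kraw m γ)
  rw [Matrix.submatrix_mul _ _ e id id Function.bijective_id,
    Matrix.submatrix_mul _ _ e e id e.bijective] at h
  rw [Matrix.det_mul, Matrix.det_mul, Matrix.submatrix_id_id, Matrix.det_submatrix_equiv_self,
    Matrix.det_kronecker, Matrix.det_kronecker] at h
  simp only [Matrix.det_one, one_pow, one_mul, Fintype.card_fin, mul_pow, hunit, mul_one] at h
  rw [← pow_mul, ← pow_mul, mul_comm (m + 2) 2, mul_comm (m + 1) 2, pow_mul, pow_mul,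
    det_krawMatrix_sq, det_krawMatrix_sq, ← pow_mul, ← pow_mul] at h
  have h2 : (0 : ℤ) < 2 ^ (m * (m + 1) * (m + 2)) := by positivity
  refine mul_right_cancel₀ h2.ne' (h.trans ?_)
  rw [← pow_add]
  ring_nf

lemma natDegree_homogEval_le (m : ℕ) (p a b : ℤ[X]) (ha : a.natDegree ≤ 1) (hb : b.natDegree ≤ 1) :
    (homogEval m p a b).natDegree ≤ m := by
  refine natDegree_sum_le_of_forall_le _ _ fun k hk => ?_
  have hk' : k ≤ m := by have := mem_range.1 hk; omega
  have h₁ := natDegree_pow_le_of_le k ha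
  have h₂ := natDegree_pow_le_of_le (m - k) hb
  have h₃ : ((p.coeff k : ℤ[X])).natDegree ≤ 0 := (natDegree_intCast _).le
  refine (natDegree_mul_le_of_le (natDegree_mul_le_of_le h₃ h₁) h₂).trans (by omega)

lemma homogEval_split (p a b : ℤ[X]) (w m : ℕ) :
    homogEval (w + 1 + m) p a b =
      b ^ (m + 1) * homogEval w p a b + a ^ (w + 1) * homogEval m (divX^[w + 1] p) a b := by
  have hdiv (j k : ℕ) : (divX^[j] p).coeff k = p.coeff (j + k) := by
    induction j generalizing k with
    | zero => simp
    | succ j ih => rw [Function.iterate_succ_apply', coeff_divX, ih]; congr 1; ring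
  rw [homogEval, show w + 1 + m + 1 = (w + 1) + (m + 1) by ring, sum_range_add]
  congr 1
  · rw [homogEval, mul_sum]
    refine sum_congr rfl fun k hk => ?_
    rw [show w + 1 + m - k = (m + 1) + (w - k) by have := mem_range.1 hk; omega, pow_add]
    ring
  · rw [homogEval, mul_sum]
    refine sum_congr rfl fun k hk => ?_
    rw [show w + 1 + m - (w + 1 + k) = m - k by omega, hdiv, pow_add]
    ring

/-- The alternating partial sums of the coefficients of `(1 + X) * p` are coefficients of `p`. -/
lemma sum_alternating_coeff (p : ℤ[X]) (w : ℕ) :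
    ∑ k ∈ range (w + 1), ((1 + X) * p).coeff k * (-1) ^ k = (-1) ^ w * p.coeff w := by
  induction w with
  | zero => simp [add_mul]
  | succ w ih =>
    rw [sum_range_succ, ih, add_mul, one_mul, coeff_add, coeff_X_mul, pow_succ]
    ring

/-- Row polynomials of a column of the inverse of `kast`, up to a scalar. -/
noncomputable def inverseRow (n : ℕ) (γ : ℕ → ℤ) (w d : ℕ) (y : ℕ) : ℤ[X] :=
  if y ≤ w then
    C (signGauge γ w * signGauge γ y * (-1) ^ (w + 1)) * ((1 - X) ^ (w - y) * (1 + X) ^ y *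
      homogEval (n - 1 - w) (divX^[w + 1] ((1 - X) ^ (n - d) * (1 + X) ^ d)) (-(1 + X)) (1 - X))
  else
    C (-(signGauge γ w * signGauge γ y)) * ((1 - X) ^ (n - y) * (1 + X) ^ (y - w - 1) *
      homogEval w ((1 - X) ^ (n - d) * (1 + X) ^ d) (-(1 + X)) (1 - X))

lemma natDegree_inverseRow_lt {n : ℕ} (γ : ℕ → ℤ) {w : ℕ} (d : ℕ) {y : ℕ} (hw : w < n)
    (hy : y ≤ n) : (inverseRow n γ w d y).natDegree < n := by
  have ha : (-(1 + X) : ℤ[X]).natDegree ≤ 1 := by compute_degree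
  have hb : (1 - X : ℤ[X]).natDegree ≤ 1 := by compute_degree
  rw [inverseRow]
  split_ifs with h
  · have := natDegree_mul_le_of_le (natDegree_one_sub_X_pow_mul_le (w - y) y)
      (natDegree_homogEval_le (n - 1 - w) (divX^[w + 1] ((1 - X) ^ (n - d) * (1 + X) ^ d)) _ _ ha hb)
    exact ((natDegree_C_mul_le _ _).trans this).trans_lt (by omega)
  · have := natDegree_mul_le_of_le (natDegree_one_sub_X_pow_mul_le (n - y) (y - w - 1))
      (natDegree_homogEval_le w ((1 - X) ^ (n - d) * (1 + X) ^ d) _ _ ha hb)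
    exact ((natDegree_C_mul_le _ _).trans this).trans_lt (by omega)

lemma inverseRow_relation {n : ℕ} {γ : ℕ → ℤ} (hγ : ∀ y, γ y * γ y = 1) {w d y : ℕ} (hw : w < n)
    (hd : d ≤ n) (hy : y < n) :
    (1 + X) * inverseRow n γ w d y + C (γ y) * ((1 - X) * inverseRow n γ w d (y + 1)) =
      if y = w then C ((-1) ^ d * 2 ^ n) * X ^ d else 0 := by
  have hγ' : (C (γ y) * C (γ y) : ℤ[X]) = 1 := by rw [← C_mul, hγ, C_1]
  rcases Nat.lt_trichotomy y w with h | rfl | h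
  · rw [if_neg h.ne, inverseRow, inverseRow, if_pos h.le, if_pos (show y + 1 ≤ w by omega),
      signGauge_succ, show w - y = w - (y + 1) + 1 by omega]
    simp only [C_mul, C_neg]
    linear_combination (-(C (signGauge γ w) * C (signGauge γ y) * C ((-1) ^ (w + 1)) *
      ((1 - X) ^ (w - (y + 1) + 1) * (1 + X) ^ (y + 1)) *
      homogEval (n - 1 - w) (divX^[w + 1] ((1 - X) ^ (n - d) * (1 + X) ^ d)) (-(1 + X)) (1 - X))) *
      hγ'
  · have hs : (C (signGauge γ y) * C (signGauge γ y) : ℤ[X]) = 1 := by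
      rw [← C_mul, signGauge_mul_self hγ, C_1]
    have hsplit := homogEval_split ((1 - X) ^ (n - d) * (1 + X) ^ d) (-(1 + X)) (1 - X) y
      (n - 1 - y)
    have hval := homogEval_one_sub_X_pow_mul (n - d) d (-(1 + X)) (1 - X)
    rw [show y + 1 + (n - 1 - y) = n by omega] at hsplit
    rw [show n - d + d = n by omega] at hval
    rw [hval, neg_pow, show n - 1 - y + 1 = n - y by omega,
      show (1 - X - -(1 + X) : ℤ[X]) = C 2 by simp only [map_ofNat]; ring,
      show (1 - X + -(1 + X) : ℤ[X]) = C (-1) * C 2 * X by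
        simp only [map_ofNat, map_neg, map_one]; ring] at hsplit
    rw [if_pos rfl, inverseRow, inverseRow, if_pos le_rfl, if_neg (by omega), signGauge_succ,
      Nat.sub_self, show y + 1 - y - 1 = 0 by omega, show n - y = n - (y + 1) + 1 by omega,
      show n = n - d + d by omega] at *
    generalize homogEval (n - d + d - 1 - y) _ _ _ = Q at *
    generalize homogEval y _ _ _ = R at *
    simp only [C_mul, C_neg, C_pow, C_1, pow_zero, Nat.add_sub_cancel] at *
    linear_combination ((-1) ^ (y + 1) * (1 + X) ^ (y + 1) * Q +
      C (γ y) * C (γ y) * (1 - X) ^ (n - d + d - (y + 1) + 1) * R) * hs +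
      (1 - X) ^ (n - d + d - (y + 1) + 1) * R * hγ' - hsplit
  · rw [if_neg h.ne', inverseRow, inverseRow, if_neg (by omega), if_neg (by omega),
      signGauge_succ, show n - y = n - (y + 1) + 1 by omega,
      show y + 1 - w - 1 = y - w - 1 + 1 by omega]
    simp only [C_mul, C_neg]
    linear_combination ((C (signGauge γ w) * C (signGauge γ y) *
      ((1 - X) ^ (n - (y + 1) + 1) * (1 + X) ^ (y - w - 1 + 1)) *
      homogEval w ((1 - X) ^ (n - d) * (1 + X) ^ d) (-(1 + X)) (1 - X))) * hγ'

lemma inverseRow_coeff_zero {n : ℕ} (γ : ℕ → ℤ) {w d y : ℕ} (hd : 1 ≤ d) (hdn : d ≤ n)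
    (hy : w < y) :
    (inverseRow n γ w d y).coeff 0 =
      -(signGauge γ w * signGauge γ y) * ((-1) ^ w * Kr w (n - 1) (n - d)) := by
  obtain ⟨e, rfl⟩ : ∃ e, d = e + 1 := ⟨d - 1, by omega⟩
  rw [inverseRow, if_neg (by omega), coeff_C_mul, mul_coeff_zero]
  congr 1
  have h : (homogEval w ((1 - X) ^ (n - (e + 1)) * (1 + X) ^ (e + 1)) (-(1 + X)) (1 - X)).coeff 0 =
      ∑ k ∈ range (w + 1), ((1 + X) * ((1 - X) ^ (n - (e + 1)) * (1 + X) ^ e) : ℤ[X]).coeff k *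
        (-1) ^ k := by
    rw [homogEval, finsetSum_coeff]
    refine sum_congr rfl fun k _ => ?_
    rw [show ((1 - X) ^ (n - (e + 1)) * (1 + X) ^ (e + 1) : ℤ[X]) =
      (1 + X) * ((1 - X) ^ (n - (e + 1)) * (1 + X) ^ e) by ring]
    generalize ((1 + X) * ((1 - X) ^ (n - (e + 1)) * (1 + X) ^ e) : ℤ[X]).coeff k = c
    rw [coeff_zero_eq_eval_zero]
    simp
  rw [h, sum_alternating_coeff, coeff_zero_eq_eval_zero, Kr,
    show n - 1 - (n - (e + 1)) = e by omega]
  simp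

/-- The number of inversions of `π` whose second element is `j`. -/
def invBelow {N : ℕ} (π : Equiv.Perm (Fin N)) (j : Fin N) : ℕ := #{i | i < j ∧ π j < π i}

lemma sign_eq_neg_one_pow_sum_invBelow {N : ℕ} (π : Equiv.Perm (Fin N)) :
    (Equiv.Perm.sign π : ℤ) = (-1) ^ ∑ j, invBelow π j := by
  rw [π.sign_eq_prod_prod_Iio, ← prod_pow_eq_pow_sum]
  push_cast
  refine prod_congr rfl fun j _ => ?_
  rw [invBelow, ← prod_const, prod_filter]
  rw [← prod_subset (subset_univ (Iio j))]
  · refine prod_congr rfl fun i hi => ?_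
    have hij := mem_Iio.1 hi
    have : π i ≠ π j := fun h => hij.ne (π.injective h)
    by_cases h : π i < π j
    · simp [h, h.not_gt]
    · have h' : π j < π i := lt_of_le_of_ne (not_lt.1 h) this.symm
      simp [h, hij, h']
  · intro i _ hi
    have : ¬ i < j := fun h => hi (mem_Iio.2 h)
    simp [this]

lemma invBelow_add {N : ℕ} (π : Equiv.Perm (Fin N)) (j : Fin N) :
    invBelow π j + π j = j + #{k | j < k ∧ π k < π j} := by
  have h₁ : #{i | i < j} = (j : ℕ) := by
    rw [show (univ.filter (fun i => i < j)) = Iio j by ext; simp, Fin.card_Iio]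
  have h₂ : #{i | π i < π j} = (π j : ℕ) := by
    rw [show (univ.filter (fun i => π i < π j)) = (Iio (π j)).map π.symm.toEmbedding by
      ext i
      simp only [mem_filter, mem_univ, true_and, mem_map, mem_Iio]
      exact ⟨fun h => ⟨π i, h, by simp⟩, by rintro ⟨a, ha, rfl⟩; simpa using ha⟩]
    rw [card_map, Fin.card_Iio]
  have h₃ := card_filter_add_card_filter_not (s := univ.filter (fun i => i < j))
    (fun i => π i < π j)
  have h₄ := card_filter_add_card_filter_not (s := univ.filter (fun i => π i < π j))
    (fun i => i < j)
  rw [filter_filter, filter_filter, h₁] at h₃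
  rw [filter_filter, filter_filter, h₂] at h₄
  have e₁ : #{i | i < j ∧ ¬ π i < π j} = invBelow π j := by
    refine congrArg card (filter_congr fun i _ => and_congr_right fun hi => ?_)
    have : π i ≠ π j := fun h => hi.ne (π.injective h)
    exact ⟨fun h => lt_of_le_of_ne (not_lt.1 h) this.symm, fun h => h.not_gt⟩
  have e₂ : #{i | π i < π j ∧ ¬ i < j} = #{k | j < k ∧ π k < π j} := by
    refine congrArg card (filter_congr fun i _ => ?_)
    constructor
    · rintro ⟨h, h'⟩
      exact ⟨lt_of_le_of_ne (not_lt.1 h') (by rintro rfl; exact h.false), h⟩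
    · rintro ⟨h, h'⟩
      exact ⟨h', h.not_gt⟩
  have e₃ : #{i | i < j ∧ π i < π j} = #{i | π i < π j ∧ i < j} :=
    congrArg card (filter_congr fun i _ => and_comm)
  omega

/-- If every inversion `i < j`, `π j < π i` has `j ∈ U ∪ {h}`, and `j = h` whenever `i ∈ U`, then
the sign of `π` is determined by the positions and values on `U` and the inversions ending in `h`
and starting outside `U`. -/
lemma sign_eq_of_inversions {N : ℕ} (π : Equiv.Perm (Fin N)) (U : Finset (Fin N)) (h : Fin N)
    (hU : h ∉ U) (hsnd : ∀ i j, i < j → π j < π i → j ∈ U ∨ j = h)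
    (hfst : ∀ i j, i < j → π j < π i → i ∈ U → j = h) :
    (Equiv.Perm.sign π : ℤ) =
      (∏ j ∈ U, (-1) ^ ((j : ℕ) + π j)) * (-1) ^ #{i | i ∉ U ∧ i < h ∧ π h < π i} := by
  have hzero : ∀ j ∉ insert h U, invBelow π j = 0 := by
    intro j hj
    rw [invBelow, card_eq_zero, filter_eq_empty_iff]
    rintro i - ⟨hij, hπ⟩
    rw [mem_insert, not_or] at hj
    exact (hsnd i j hij hπ).elim hj.2 hj.1
  have hsum : ∑ j, invBelow π j = invBelow π h + ∑ j ∈ U, invBelow π j := by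
    rw [← sum_subset (subset_univ (insert h U)) (fun j _ hj => hzero j hj), sum_insert hU]
  have hC : ∀ j ∈ U, #{k | j < k ∧ π k < π j} = if j < h ∧ π h < π j then 1 else 0 := by
    intro j hj
    split_ifs with hc
    · rw [card_eq_one]
      refine ⟨h, ?_⟩
      ext k
      simp only [mem_filter, mem_univ, true_and, mem_singleton]
      exact ⟨fun hk => hfst j k hk.1 hk.2 hj, by rintro rfl; exact hc⟩
    · rw [card_eq_zero, filter_eq_empty_iff]
      rintro k - hk
      obtain rfl := hfst j k hk.1 hk.2 hj
      exact hc hk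
  have hj : ∀ j ∈ U, (-1 : ℤ) ^ invBelow π j =
      (-1) ^ ((j : ℕ) + π j) * (-1) ^ (if j < h ∧ π h < π j then 1 else 0) := by
    intro j hj
    have h₁ := invBelow_add π j
    rw [hC j hj] at h₁
    rw [← pow_add]
    refine neg_one_pow_congr ?_
    generalize (if j < h ∧ π h < π j then 1 else 0) = c at *
    simp only [Nat.even_iff]
    omega
  have hcard : invBelow π h = #{i | i ∉ U ∧ i < h ∧ π h < π i} +
      #{i ∈ U | i < h ∧ π h < π i} := by
    rw [invBelow, ← card_filter_add_card_filter_not (fun i => i ∈ U), filter_filter,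
      filter_filter, add_comm]
    congr 2
    · ext i; simp only [mem_filter, mem_univ, true_and]; tauto
    · ext i; simp only [mem_filter, mem_univ, true_and]; tauto
  rw [sign_eq_neg_one_pow_sum_invBelow, hsum, pow_add, ← prod_pow_eq_pow_sum, prod_congr rfl hj,
    prod_mul_distrib, prod_pow_eq_pow_sum U (fun j => if j < h ∧ π h < π j then 1 else 0),
    ← card_filter, hcard, pow_add]
  have : ((-1 : ℤ) ^ #{i ∈ U | i < h ∧ π h < π i}) * (-1) ^ #{i ∈ U | i < h ∧ π h < π i} = 1 := by
    rw [← mul_pow]; simp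
  linear_combination ((-1) ^ #{i | i ∉ U ∧ i < h ∧ π h < π i} *
    ∏ j ∈ U, (-1) ^ ((j : ℕ) + π j)) * this

/-- Row-by-row numbering of the white vertices. -/
def whiteIdx (n : ℕ) : White n ≃ Fin ((n + 1) * n) := finProdFinEquiv

/-- Row-by-row numbering of the black vertices. -/
def blackIdx (n : ℕ) : Black n ≃ Fin ((n + 1) * n) :=
  finProdFinEquiv.trans (finCongr (mul_comm _ _))

lemma whiteIdx_val {n : ℕ} (w : White n) : (whiteIdx n w : ℕ) = w.2 + n * w.1 := rfl

lemma blackIdx_val {n : ℕ} (b : Black n) : (blackIdx n b : ℕ) = b.2 + (n + 1) * b.1 := rfl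

lemma add_mul_lt_add_mul_iff {n a b y z : ℕ} (ha : a < n) (hb : b < n) :
    a + n * y < b + n * z ↔ y < z ∨ (y = z ∧ a < b) := by
  rcases Nat.lt_trichotomy y z with h | rfl | h
  · have : n * (y + 1) ≤ n * z := Nat.mul_le_mul_left n h
    rw [Nat.mul_add] at this
    constructor <;> intro <;> omega
  · omega
  · have : n * (z + 1) ≤ n * y := Nat.mul_le_mul_left n h
    rw [Nat.mul_add] at this
    constructor <;> intro <;> omega

lemma whiteIdx_lt_iff {n : ℕ} (v w : White n) :
    whiteIdx n v < whiteIdx n w ↔ (v.1 : ℕ) < w.1 ∨ ((v.1 : ℕ) = w.1 ∧ (v.2 : ℕ) < w.2) := by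
  rw [Fin.lt_def, whiteIdx_val, whiteIdx_val, add_mul_lt_add_mul_iff v.2.2 w.2.2]

lemma blackIdx_lt_iff {n : ℕ} (a b : Black n) :
    blackIdx n a < blackIdx n b ↔ (a.1 : ℕ) < b.1 ∨ ((a.1 : ℕ) = b.1 ∧ (a.2 : ℕ) < b.2) := by
  rw [Fin.lt_def, blackIdx_val, blackIdx_val, add_mul_lt_add_mul_iff a.2.2 b.2.2]

/-- Adjacency in the Aztec diamond. -/
def Linked {n : ℕ} (b : Black n) (w : White n) : Prop :=
  ((b.2 : ℕ) = w.2 ∨ (b.2 : ℕ) = w.2 + 1) ∧ ((b.1 : ℕ) + 1 = w.1 ∨ (b.1 : ℕ) = w.1)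

/-- `σ` sends `h` to `b` and matches every other white vertex to an adjacent black vertex. -/
def IsHoleMatching {n : ℕ} (h : White n) (b : Black n) (σ : White n ≃ Black n) : Prop :=
  σ h = b ∧ ∀ w, w ≠ h → Linked (σ w) w

/-- `w` is matched to the black row below it. -/
def MatchedDown {n : ℕ} (h : White n) (σ : White n ≃ Black n) (w : White n) : Prop :=
  w ≠ h ∧ ((σ w).1 : ℕ) + 1 = w.1

/-- A bijection of white and black vertices as a permutation of their numbers. -/
def permOf {n : ℕ} (σ : White n ≃ Black n) : Equiv.Perm (Fin ((n + 1) * n)) :=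
  ((whiteIdx n).symm.trans σ).trans (blackIdx n)

lemma permOf_whiteIdx {n : ℕ} (σ : White n ≃ Black n) (w : White n) :
    permOf σ (whiteIdx n w) = blackIdx n (σ w) := by simp [permOf]

lemma sign_permOf {n : ℕ} {h : White n} {b : Black n} {σ : White n ≃ Black n}
    (hσ : IsHoleMatching h b σ) (hbh : (b.1 : ℕ) < h.1) :
    (Equiv.Perm.sign (permOf σ) : ℤ) =
      (∏ w with MatchedDown h σ w, (-1) ^ ((whiteIdx n w : ℕ) + blackIdx n (σ w))) *
        (-1) ^ #{w | ¬ MatchedDown h σ w ∧ whiteIdx n w < whiteIdx n h ∧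
          blackIdx n b < blackIdx n (σ w)} := by
  have key := sign_eq_of_inversions (permOf σ)
    ((univ.filter (MatchedDown h σ)).map (whiteIdx n).toEmbedding) (whiteIdx n h)
    (by simp [MatchedDown]) ?_ ?_
  · rw [key, prod_map]
    congr 1
    · refine prod_congr rfl fun w _ => ?_
      simp [permOf]
    · congr 1
      rw [← card_map (whiteIdx n).toEmbedding]
      congr 1
      ext i
      obtain ⟨w, rfl⟩ := (whiteIdx n).surjective i
      simp [permOf, hσ.1]
  · intro i j hij hπ
    obtain ⟨v, rfl⟩ := (whiteIdx n).surjective i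
    obtain ⟨w, rfl⟩ := (whiteIdx n).surjective j
    rw [permOf_whiteIdx, permOf_whiteIdx, blackIdx_lt_iff] at hπ
    rw [whiteIdx_lt_iff] at hij
    by_cases hw : w = h
    · exact Or.inr (by rw [hw])
    left
    simp only [mem_map_equiv, Equiv.symm_apply_apply, mem_filter, mem_univ, true_and, MatchedDown]
    refine ⟨hw, ?_⟩
    have hlw := hσ.2 w hw
    by_cases hv : v = h
    · subst hv
      rw [hσ.1] at hπ
      unfold Linked at hlw
      omega
    · have hlv := hσ.2 v hv
      unfold Linked at hlw hlv
      omega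
  · intro i j hij hπ hi
    obtain ⟨v, rfl⟩ := (whiteIdx n).surjective i
    obtain ⟨w, rfl⟩ := (whiteIdx n).surjective j
    rw [permOf_whiteIdx, permOf_whiteIdx, blackIdx_lt_iff] at hπ
    rw [whiteIdx_lt_iff] at hij
    simp only [mem_map_equiv, Equiv.symm_apply_apply, mem_filter, mem_univ, true_and,
      MatchedDown] at hi
    by_contra hw
    have hlw := hσ.2 w (fun h' => hw (by rw [h']))
    have hlv := hσ.2 v hi.1
    unfold Linked at hlw hlv
    omega

/-- The sign weights of the edges between consecutive rows. -/
def rowSign (n : ℕ) (y : ℕ) : ℤ := (-1) ^ (n + y)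

lemma rowSign_mul_self (n y : ℕ) : rowSign n y * rowSign n y = 1 := by
  rw [rowSign, ← mul_pow]; simp

lemma prod_kast {n : ℕ} {h : White n} {b : Black n} {σ : White n ≃ Black n}
    (hσ : IsHoleMatching h b σ) :
    ∏ w ∈ univ.erase h, kast n (rowSign n) (σ w) w =
      ∏ w with MatchedDown h σ w, (-1) ^ ((whiteIdx n w : ℕ) + blackIdx n (σ w)) := by
  symm
  refine prod_subset_one_on_sdiff (fun w hw => ?_) (fun w hw => ?_) (fun w hw => ?_)
  · exact mem_erase.2 ⟨(mem_filter.1 hw).2.1, mem_univ w⟩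
  · rw [mem_sdiff, mem_erase, mem_filter] at hw
    obtain ⟨⟨hwh, -⟩, hdown⟩ := hw
    have hl := hσ.2 w hwh
    have h₁ : (w.1 : ℕ) = (σ w).1 := by
      have : ¬ ((σ w).1 : ℕ) + 1 = w.1 := fun h' => hdown ⟨mem_univ w, hwh, h'⟩
      unfold Linked at hl
      omega
    rcases hl.1 with h₂ | h₂ <;> simp [kast, h₁, h₂]
  · obtain ⟨hwh, hrow⟩ := (mem_filter.1 hw).2
    have hl := hσ.2 w hwh
    have h₁ : (w.1 : ℕ) = (σ w).1 + 1 := hrow.symm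
    rw [whiteIdx_val, blackIdx_val]
    rcases hl.1 with h₂ | h₂
    · have hk : kast n (rowSign n) (σ w) w = (-1) ^ (n + (σ w).1) := by
        simp [kast, h₁, h₂, rowSign]
      rw [hk, h₁, h₂]
      refine neg_one_pow_congr ?_
      simp only [Nat.even_iff]
      ring_nf
      omega
    · have hk : kast n (rowSign n) (σ w) w = (-1) ^ (n + (σ w).1 + 1) := by
        simp [kast, h₁, h₂, rowSign, pow_succ]
      rw [hk, h₁, h₂]
      refine neg_one_pow_congr ?_
      simp only [Nat.even_iff]
      ring_nf
      omega

lemma card_white_row {n y : ℕ} (hy : y < n + 1) :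
    ∑ w : White n, (if (w.1 : ℕ) = y then 1 else 0) = n := by
  rw [Fintype.sum_prod_type, sum_eq_single ⟨y, hy⟩]
  · simp
  · intro z _ hz
    exact sum_eq_zero fun x _ => if_neg fun h => hz (Fin.ext h)
  · simp

lemma card_black_row {n y : ℕ} (hy : y < n) :
    ∑ b : Black n, (if (b.1 : ℕ) = y then 1 else 0) = n + 1 := by
  rw [Fintype.sum_prod_type, sum_eq_single ⟨y, hy⟩]
  · simp
  · intro z _ hz
    exact sum_eq_zero fun x _ => if_neg fun h => hz (Fin.ext h)
  · simp

lemma card_black_row_lt {n : ℕ} (b : Black n) :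
    ∑ b' : Black n, (if (b'.1 : ℕ) = b.1 ∧ (b'.2 : ℕ) < b.2 then 1 else 0) = (b.2 : ℕ) := by
  rw [Fintype.sum_prod_type, sum_eq_single b.1]
  · simp only [true_and]
    rw [Fin.sum_univ_eq_sum_range (fun i => if i < (b.2 : ℕ) then 1 else 0), ← card_filter]
    have : (range (n + 1)).filter (· < (b.2 : ℕ)) = range b.2 := by
      ext i; simp only [mem_filter, mem_range]; omega
    rw [this, card_range]
  · intro y _ hy
    simp [Fin.val_inj, hy]
  · simp

lemma hole_cases {n : ℕ} {h : White n} {b : Black n} {σ : White n ≃ Black n}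
    (hσ : IsHoleMatching h b σ) (w : White n) :
    (w = h ∧ (w.1 : ℕ) = h.1 ∧ ((σ w).1 : ℕ) = b.1 ∧ ((σ w).2 : ℕ) = b.2) ∨
    (w ≠ h ∧ (((σ w).1 : ℕ) + 1 = w.1 ∨ ((σ w).1 : ℕ) = w.1) ∧
      ¬ (((σ w).1 : ℕ) = b.1 ∧ ((σ w).2 : ℕ) = b.2)) := by
  by_cases hw : w = h
  · subst hw; simp [hσ.1]
  · refine Or.inr ⟨hw, (hσ.2 w hw).2, fun hb => hw (σ.injective ?_)⟩
    rw [hσ.1]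
    exact Prod.ext (Fin.ext hb.1) (Fin.ext hb.2)

/-- The number of vertices of each white row matched to the black row below. -/
lemma card_matchedDown_row {n : ℕ} {h : White n} {b : Black n} {σ : White n ≃ Black n}
    (hσ : IsHoleMatching h b σ) (hbh : (b.1 : ℕ) < h.1) (y : ℕ) (hy : y ≤ h.1) :
    ∑ w, (if MatchedDown h σ w ∧ (w.1 : ℕ) = y then 1 else 0) + (if (b.1 : ℕ) < y then 1 else 0) =
      y := by
  induction y with
  | zero =>
    simp only [Nat.not_lt_zero, if_false, add_zero]
    refine sum_eq_zero fun w _ => if_neg ?_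
    rintro ⟨⟨-, h₁⟩, h₂⟩
    omega
  | succ y ih =>
    have hlt : (h.1 : ℕ) < n + 1 := h.1.2
    have ih := ih (by omega)
    have hwhite : ∑ w, (if MatchedDown h σ w ∧ (w.1 : ℕ) = y then 1 else 0) +
        ∑ w, (if ¬ MatchedDown h σ w ∧ (w.1 : ℕ) = y then 1 else 0) = n := by
      rw [← sum_add_distrib]
      refine Eq.trans ?_ (card_white_row (n := n) (y := y) (by omega))
      refine sum_congr rfl fun w _ => ?_
      split_ifs <;> tauto
    have hblack : ∑ w, (if MatchedDown h σ w ∧ (w.1 : ℕ) = y + 1 then 1 else 0) +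
        ∑ w, (if ¬ MatchedDown h σ w ∧ (w.1 : ℕ) = y then 1 else 0) +
        (if (b.1 : ℕ) = y then 1 else 0) = n + 1 := by
      have hb : (if (b.1 : ℕ) = y then 1 else 0) =
          ∑ w, (if w = h ∧ (b.1 : ℕ) = y then 1 else 0) := by
        rw [sum_eq_single h]
        · simp
        · intro w _ hw; simp [hw]
        · simp
      rw [hb, ← sum_add_distrib, ← sum_add_distrib]
      refine Eq.trans ?_ ((Equiv.sum_comp σ _).trans (card_black_row (n := n) (y := y) (by omega)))
      refine sum_congr rfl fun w _ => ?_
      simp only [MatchedDown]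
      rcases hole_cases hσ w with ⟨h₀, h₁, h₂, h₃⟩ | ⟨h₀, h₁, h₂⟩
      · simp only [h₀, ne_eq, not_true_eq_false, false_and, not_false_eq_true, true_and, if_false]
        subst h₀
        split_ifs <;> omega
      · simp only [h₀, ne_eq, not_false_eq_true, true_and, false_and, if_false]
        split_ifs <;> omega
    split_ifs at * <;> omega

/-- The parity of the number of inversions ending in the hole. -/
lemma neg_one_pow_card_inversions {n : ℕ} {h : White n} {b : Black n} {σ : White n ≃ Black n}
    (hσ : IsHoleMatching h b σ) (hbh : (b.1 : ℕ) < h.1) (h0 : (h.2 : ℕ) = 0) :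
    (-1 : ℤ) ^ #{w | ¬ MatchedDown h σ w ∧ whiteIdx n w < whiteIdx n h ∧
          blackIdx n b < blackIdx n (σ w)} =
      -((-1) ^ (b.2 : ℕ) * signGauge (rowSign n) b.1 * signGauge (rowSign n) h.1) *
        (-1) ^ #{w | MatchedDown h σ w ∧ (σ w).1 = b.1 ∧ (σ w).2 < b.2} := by
  let N : ℕ → ℕ := fun y => ∑ w, (if ¬ MatchedDown h σ w ∧ (w.1 : ℕ) = y then 1 else 0)
  have hlt : (h.1 : ℕ) < n + 1 := h.1.2
  have hN (y : ℕ) (hy : y < h.1) : N y + y = n + (if (b.1 : ℕ) < y then 1 else 0) := by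
    have h₁ := card_matchedDown_row hσ hbh y hy.le
    have h₂ : ∑ w, (if MatchedDown h σ w ∧ (w.1 : ℕ) = y then 1 else 0) + N y = n := by
      rw [← sum_add_distrib]
      refine Eq.trans ?_ (card_white_row (n := n) (y := y) (by omega))
      refine sum_congr rfl fun w _ => ?_
      split_ifs <;> tauto
    omega
  have hcount : #{w | ¬ MatchedDown h σ w ∧ whiteIdx n w < whiteIdx n h ∧
        blackIdx n b < blackIdx n (σ w)} + b.2 =
      ∑ y ∈ Ico (b.1 : ℕ) h.1, N y +
        #{w | MatchedDown h σ w ∧ (σ w).1 = b.1 ∧ (σ w).2 < b.2} := by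
    rw [← card_black_row_lt b, card_filter, card_filter, sum_comm, ← sum_add_distrib,
      ← Equiv.sum_comp σ, ← sum_add_distrib]
    refine sum_congr rfl fun w _ => ?_
    have hin : ∑ y ∈ Ico (b.1 : ℕ) h.1, (if ¬ MatchedDown h σ w ∧ (w.1 : ℕ) = y then 1 else 0) =
        if ¬ MatchedDown h σ w ∧ (b.1 : ℕ) ≤ w.1 ∧ (w.1 : ℕ) < h.1 then 1 else 0 := by
      by_cases hd : MatchedDown h σ w
      · simp [hd]
      · simp [hd]
    rw [hin]
    simp only [whiteIdx_lt_iff, blackIdx_lt_iff, h0, not_lt_zero, and_false, or_false]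
    simp only [MatchedDown, Fin.ext_iff, Fin.lt_def]
    rcases hole_cases hσ w with ⟨h₀, h₁, h₂, h₃⟩ | ⟨h₀, h₁, h₂⟩
    · simp only [h₀, ne_eq, not_true_eq_false, false_and, not_false_eq_true, true_and, if_false]
      subst h₀
      split_ifs <;> omega
    · simp only [h₀, ne_eq, not_false_eq_true, true_and]
      split_ifs <;> omega
  have hprod : (-1 : ℤ) ^ ∑ y ∈ Ico (b.1 : ℕ) h.1, N y =
      -(signGauge (rowSign n) b.1 * signGauge (rowSign n) h.1) := by
    have hg : signGauge (rowSign n) h.1 =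
        signGauge (rowSign n) b.1 * ∏ y ∈ Ico (b.1 : ℕ) h.1, -rowSign n y := by
      rw [signGauge, signGauge, prod_range_mul_prod_Ico _ hbh.le]
    rw [hg, ← mul_assoc, signGauge_mul_self (rowSign_mul_self n), one_mul, ← prod_pow_eq_pow_sum,
      prod_eq_prod_Ico_succ_bot hbh, prod_eq_prod_Ico_succ_bot hbh, neg_mul, neg_neg]
    congr 1
    · rw [rowSign]
      refine neg_one_pow_congr ?_
      have := hN b.1 hbh
      simp only [lt_irrefl, if_false] at this
      simp only [Nat.even_iff]
      omega
    · refine prod_congr rfl fun y hy => ?_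
      rw [mem_Ico] at hy
      have := hN y hy.2
      rw [if_pos (by omega)] at this
      rw [show -rowSign n y = (-1) ^ (n + y + 1) by rw [rowSign, pow_succ]; ring]
      refine neg_one_pow_congr ?_
      simp only [Nat.even_iff]
      omega
  have hpow := congrArg (fun k => (-1 : ℤ) ^ k) hcount
  simp only [pow_add, hprod] at hpow
  have hsq : ((-1 : ℤ) ^ (b.2 : ℕ)) * (-1) ^ (b.2 : ℕ) = 1 := by rw [← mul_pow]; simp
  generalize (-1 : ℤ) ^ (b.2 : ℕ) = s at *
  linear_combination s * hpow - (-1 : ℤ) ^ #{w | ¬ MatchedDown h σ w ∧ whiteIdx n w < whiteIdx n h ∧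
    blackIdx n b < blackIdx n (σ w)} * hsq

/-- The signed weight of a matching with holes. -/
lemma sign_mul_prod_kast {n : ℕ} {h : White n} {b : Black n} {σ : White n ≃ Black n}
    (hσ : IsHoleMatching h b σ) (hbh : (b.1 : ℕ) < h.1) (h0 : (h.2 : ℕ) = 0) :
    (Equiv.Perm.sign (permOf σ) : ℤ) * ∏ w ∈ univ.erase h, kast n (rowSign n) (σ w) w =
      -((-1) ^ (b.2 : ℕ) * signGauge (rowSign n) b.1 * signGauge (rowSign n) h.1) *
        (-1) ^ #{w | MatchedDown h σ w ∧ (σ w).1 = b.1 ∧ (σ w).2 < b.2} := by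
  rw [← neg_one_pow_card_inversions hσ hbh h0, sign_permOf hσ hbh, prod_kast hσ, mul_right_comm,
    ← prod_mul_distrib]
  have : ∏ w with MatchedDown h σ w, ((-1 : ℤ) ^ ((whiteIdx n w : ℕ) + blackIdx n (σ w)) *
      (-1) ^ ((whiteIdx n w : ℕ) + blackIdx n (σ w))) = 1 :=
    prod_eq_one fun w _ => by rw [← mul_pow]; simp
  rw [this, one_mul]

/-- The signed count of the matchings with holes `h` and `b`. -/
noncomputable def signedCount {n : ℕ} (h : White n) (b : Black n) : ℤ :=
  ∑ σ with IsHoleMatching h b σ,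
    (-1) ^ #{w | MatchedDown h σ w ∧ (σ w).1 = b.1 ∧ (σ w).2 < b.2}

/-- `kast` as a square matrix, with the rows and columns numbered. -/
def kastSquare (n : ℕ) (γ : ℕ → ℤ) : Matrix (Fin ((n + 1) * n)) (Fin ((n + 1) * n)) ℤ :=
  (kast n γ).submatrix (blackIdx n).symm (whiteIdx n).symm

lemma linked_of_kast_ne_zero {n : ℕ} {γ : ℕ → ℤ} {b : Black n} {w : White n}
    (h : kast n γ b w ≠ 0) : Linked b w := by
  by_contra hl
  refine h ?_
  unfold Linked at hl
  simp only [kast]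
  split_ifs <;> omega

/-- The expansion of the determinant with the column of `h` replaced by the unit vector at `b`. -/
lemma det_updateCol_kastSquare {n : ℕ} (γ : ℕ → ℤ) (h : White n) (b : Black n) :
    ((kastSquare n γ).updateCol (whiteIdx n h) (Pi.single (blackIdx n b) 1)).det =
      ∑ σ with IsHoleMatching h b σ,
        (Equiv.Perm.sign (permOf σ) : ℤ) * ∏ w ∈ univ.erase h, kast n γ (σ w) w := by
  rw [Matrix.det_apply', ← Equiv.sum_comp ((whiteIdx n).equivCongr (blackIdx n)), sum_filter]
  refine sum_congr rfl fun σ _ => ?_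
  change (Equiv.Perm.sign (permOf σ) : ℤ) * ∏ i, Matrix.updateCol _ _ _ (permOf σ i) i = _
  rw [← Equiv.prod_comp (whiteIdx n), ← mul_prod_erase univ _ (mem_univ h)]
  have hcol : ∏ w ∈ univ.erase h, (kastSquare n γ).updateCol (whiteIdx n h)
      (Pi.single (blackIdx n b) 1) (permOf σ (whiteIdx n w)) (whiteIdx n w) =
      ∏ w ∈ univ.erase h, kast n γ (σ w) w := by
    refine prod_congr rfl fun w hw => ?_
    rw [Matrix.updateCol_ne ((whiteIdx n).injective.ne (ne_of_mem_erase hw)), permOf_whiteIdx]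
    simp [kastSquare]
  rw [hcol, permOf_whiteIdx, Matrix.updateCol_self]
  split_ifs with hσ
  · rw [hσ.1, Pi.single_eq_same, one_mul]
  · by_cases hb : σ h = b
    · have : ∃ w, w ≠ h ∧ ¬ Linked (σ w) w := by
        by_contra! hall
        exact hσ ⟨hb, hall⟩
      obtain ⟨w, hw, hl⟩ := this
      have hzero : ∏ w ∈ univ.erase h, kast n γ (σ w) w = 0 :=
        prod_eq_zero (mem_erase.2 ⟨hw, mem_univ w⟩) (not_not.1 (mt linked_of_kast_ne_zero hl))
      rw [hzero, mul_zero, mul_zero]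
    · rw [Pi.single_eq_of_ne ((blackIdx n).injective.ne hb), zero_mul, mul_zero]

lemma kastSquare_mulVec_inverseRow {n : ℕ} {γ : ℕ → ℤ} (hγ : ∀ y, γ y * γ y = 1) (b : Black n) :
    (kastSquare n γ).mulVec (fun i => (inverseRow n γ b.1 b.2 ((whiteIdx n).symm i).1).coeff
      ((whiteIdx n).symm i).2) =
      ((-1 : ℤ) ^ (b.2 : ℕ) * 2 ^ n) • Pi.single (blackIdx n b) 1 := by
  ext j
  obtain ⟨a, rfl⟩ := (blackIdx n).surjective j
  rw [Matrix.mulVec, dotProduct, ← Equiv.sum_comp (whiteIdx n)]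
  simp only [kastSquare, Matrix.submatrix_apply, Equiv.symm_apply_apply]
  rw [kast_mulVec_coeff γ _ (fun y hy => natDegree_inverseRow_lt γ _ b.1.2 hy),
    inverseRow_relation hγ b.1.2 (Nat.lt_succ_iff.1 b.2.2) a.1.2]
  by_cases hab : a = b
  · subst hab
    rw [if_pos rfl, coeff_C_mul, coeff_X_pow_self]
    simp
  · rw [Pi.smul_apply, Pi.single_eq_of_ne ((blackIdx n).injective.ne hab), smul_zero]
    split_ifs with h₁
    · rw [coeff_C_mul, coeff_X_pow, if_neg, mul_zero]
      exact fun h₂ => hab (Prod.ext (Fin.ext h₁) (Fin.ext h₂))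
    · simp

lemma det_kastSquare_mul_inverseRow {n : ℕ} {γ : ℕ → ℤ} (hγ : ∀ y, γ y * γ y = 1)
    (h : White n) (b : Black n) :
    (kastSquare n γ).det * (inverseRow n γ b.1 b.2 h.1).coeff h.2 =
      (-1) ^ (b.2 : ℕ) * 2 ^ n *
        ((kastSquare n γ).updateCol (whiteIdx n h) (Pi.single (blackIdx n b) 1)).det := by
  have hc := congrArg (fun v => Matrix.cramer (kastSquare n γ) v (whiteIdx n h))
    (kastSquare_mulVec_inverseRow hγ b)
  simp only [map_smul, Pi.smul_apply, Matrix.cramer_apply _ (Pi.single _ _), smul_eq_mul] at hc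
  rw [← hc, Matrix.cramer_eq_adjugate_mulVec, Matrix.mulVec_mulVec, Matrix.adjugate_mul,
    Matrix.smul_mulVec, Matrix.one_mulVec]
  simp

lemma det_mul_Kr {n : ℕ} {h : White n} {b : Black n} (hbh : (b.1 : ℕ) < h.1)
    (h0 : (h.2 : ℕ) = 0) (hb : 1 ≤ (b.2 : ℕ)) :
    (kastSquare n (rowSign n)).det * ((-1) ^ (b.1 : ℕ) * Kr b.1 (n - 1) (n - b.2)) =
      2 ^ n * signedCount h b := by
  have hγ := rowSign_mul_self n
  have key := det_kastSquare_mul_inverseRow hγ h b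
  rw [det_updateCol_kastSquare, h0, inverseRow_coeff_zero _ hb (Nat.lt_succ_iff.1 b.2.2) hbh,
    sum_congr rfl fun σ hσ => sign_mul_prod_kast (mem_filter.1 hσ).2 hbh h0, ← mul_sum] at key
  change _ = _ * (_ * signedCount h b) at key
  have hs : ((-1 : ℤ) ^ (b.2 : ℕ)) * (-1) ^ (b.2 : ℕ) = 1 := by rw [← mul_pow]; simp
  have hb₁ := signGauge_mul_self hγ b.1
  have hh₁ := signGauge_mul_self hγ h.1
  generalize signGauge (rowSign n) b.1 = x at *
  generalize signGauge (rowSign n) h.1 = z at *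
  generalize (-1 : ℤ) ^ (b.2 : ℕ) = s at *
  generalize (kastSquare n (rowSign n)).det = D at *
  generalize (-1 : ℤ) ^ (b.1 : ℕ) * Kr b.1 (n - 1) (n - b.2) = k at *
  generalize signedCount h b = Z at *
  linear_combination (-x * z) * key + (2 ^ n * Z * x * x * z * z) * hs +
    (2 ^ n * Z * x * x - D * k * x * x) * hh₁ + (2 ^ n * Z - D * k) * hb₁

lemma signedCount_nonneg {n : ℕ} {h : White n} {b : Black n} (hb : (b.1 : ℕ) = 0)
    (hh : (h.1 : ℕ) = 1) : 0 ≤ signedCount h b := by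
  refine sum_nonneg fun σ hσ => ?_
  have hσ := (mem_filter.1 hσ).2
  have hrow := card_matchedDown_row hσ (by omega) 1 hh.ge
  rw [if_pos (by omega), Nat.add_eq_right, sum_eq_zero_iff] at hrow
  rw [filter_false_of_mem]
  · simp
  · rintro w - ⟨hw, h₁, -⟩
    have := hrow w (mem_univ w)
    rw [if_pos ⟨hw, by have := hw.2; rw [h₁] at this; omega⟩] at this
    omega

lemma det_kastSquare {n : ℕ} (hn : 1 ≤ n) :
    (kastSquare n (rowSign n)).det = 2 ^ (n * (n + 1) / 2) := by
  have hsq : (kastSquare n (rowSign n)).det ^ 2 = (2 ^ (n * (n + 1) / 2)) ^ 2 := by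
    rw [← pow_mul, Nat.div_mul_cancel (Nat.even_mul_succ_self n).two_dvd,
      ← det_kast_sq hn (rowSign_mul_self n) ((whiteIdx n).trans (blackIdx n).symm),
      ← Matrix.det_submatrix_equiv_self (whiteIdx n)]
    congr 2
    ext i j
    simp [kastSquare]
  have hpos := det_mul_Kr (n := n) (h := (⟨1, by omega⟩, ⟨0, by omega⟩))
    (b := (⟨0, by omega⟩, ⟨1, by omega⟩)) (by simp) rfl le_rfl
  have hKr : Kr 0 (n - 1) (n - 1) = 1 := by simp [Kr, coeff_zero_eq_eval_zero]
  simp only [hKr, pow_zero, mul_one] at hpos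
  have hnonneg : 0 ≤ (kastSquare n (rowSign n)).det :=
    hpos ▸ mul_nonneg (by positivity) (signedCount_nonneg rfl rfl)
  exact (pow_left_inj₀ hnonneg (by positivity) two_ne_zero).1 hsq

lemma signedCount_eq {n : ℕ} {h : White n} {b : Black n} (hbh : (b.1 : ℕ) < h.1)
    (h0 : (h.2 : ℕ) = 0) (hb : 1 ≤ (b.2 : ℕ)) :
    signedCount h b =
      (-1) ^ (b.1 : ℕ) * Kr b.1 (n - 1) (n - b.2) * 2 ^ (n * (n - 1) / 2) := by
  have hn : 1 ≤ n := by have := b.1.2; omega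
  have key := det_mul_Kr hbh h0 hb
  have hexp : n * (n + 1) / 2 = n + n * (n - 1) / 2 := by
    obtain ⟨m, rfl⟩ : ∃ m, n = m + 1 := ⟨n - 1, by omega⟩
    rw [show (m + 1) * (m + 1 + 1) = (m + 1) * m + (m + 1) * 2 by ring,
      Nat.add_mul_div_right _ _ two_pos, Nat.add_sub_cancel, add_comm]
  rw [det_kastSquare hn, hexp, pow_add, mul_assoc] at key
  rw [← mul_left_cancel₀ (by positivity) key]
  ring

/-- The vertex of `coloredGrid` corresponding to a white vertex. -/
def whitePt {n : ℕ} (w : White n) : Bool × ℕ × ℕ := (false, ((w.2 : ℕ) + 1, (w.1 : ℕ) + 1))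

/-- The vertex of `coloredGrid` corresponding to a black vertex. -/
def blackPt {n : ℕ} (b : Black n) : Bool × ℕ × ℕ := (true, ((b.2 : ℕ) + 1, (b.1 : ℕ) + 1))

lemma whitePt_injective {n : ℕ} : Function.Injective (whitePt (n := n)) := by
  intro v w h
  simp only [whitePt, Prod.mk.injEq, add_left_inj, true_and] at h
  exact Prod.ext (Fin.ext h.2) (Fin.ext h.1)

lemma blackPt_injective {n : ℕ} : Function.Injective (blackPt (n := n)) := by
  intro v w h
  simp only [blackPt, Prod.mk.injEq, add_left_inj, true_and] at h
  exact Prod.ext (Fin.ext h.2) (Fin.ext h.1)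

lemma whitePt_ne_blackPt {n : ℕ} (w : White n) (b : Black n) : whitePt w ≠ blackPt b := by
  simp [whitePt, blackPt]

lemma coloredGrid_adj_iff {n : ℕ} (w : White n) (b : Black n) :
    coloredGrid.Adj (whitePt w) (blackPt b) ↔ Linked b w := by
  simp [coloredGrid, whitePt, blackPt, adjC, Linked]

lemma mem_aztecVerts_iff {n : ℕ} (v : Bool × ℕ × ℕ) :
    v ∈ aztecVerts n ↔ (∃ w : White n, v = whitePt w) ∨ ∃ b : Black n, v = blackPt b := by
  obtain ⟨c, x, y⟩ := v
  constructor
  · rintro (⟨h, h₁, h₂, h₃, h₄⟩ | ⟨h, h₁, h₂, h₃, h₄⟩) <;> simp only at h h₁ h₂ h₃ h₄ <;> subst h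
    · refine Or.inl ⟨(⟨y - 1, by omega⟩, ⟨x - 1, by omega⟩), ?_⟩
      simp only [whitePt, Prod.mk.injEq, true_and]
      omega
    · refine Or.inr ⟨(⟨y - 1, by omega⟩, ⟨x - 1, by omega⟩), ?_⟩
      simp only [blackPt, Prod.mk.injEq, true_and]
      omega
  · rintro (⟨w, hw⟩ | ⟨b, hb⟩)
    · rw [hw]
      refine Or.inl ⟨rfl, ?_⟩
      simp only [whitePt]
      omega
    · rw [hb]
      refine Or.inr ⟨rfl, ?_⟩
      simp only [blackPt]
      omega

/-- The vertices of the Aztec diamond other than `h` and `b`. -/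
def holeVerts {n : ℕ} (h : White n) (b : Black n) : Set (Bool × ℕ × ℕ) :=
  aztecVerts n \ {whitePt h, blackPt b}

lemma whitePt_mem_holeVerts {n : ℕ} {h : White n} {b : Black n} (w : White n) :
    whitePt w ∈ holeVerts h b ↔ w ≠ h := by
  have : whitePt w ∈ aztecVerts n := (mem_aztecVerts_iff _).2 (Or.inl ⟨w, rfl⟩)
  simp [holeVerts, this, whitePt_ne_blackPt, whitePt_injective.eq_iff]

lemma blackPt_mem_holeVerts {n : ℕ} {h : White n} {b : Black n} (a : Black n) :
    blackPt a ∈ holeVerts h b ↔ a ≠ b := by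
  have : blackPt a ∈ aztecVerts n := (mem_aztecVerts_iff _).2 (Or.inr ⟨a, rfl⟩)
  simp [holeVerts, this, (whitePt_ne_blackPt _ _).symm, blackPt_injective.eq_iff]

lemma mem_holeVerts_cases {n : ℕ} {h : White n} {b : Black n} {v : Bool × ℕ × ℕ}
    (hv : v ∈ holeVerts h b) :
    (∃ w, w ≠ h ∧ v = whitePt w) ∨ ∃ a, a ≠ b ∧ v = blackPt a := by
  rcases (mem_aztecVerts_iff v).1 hv.1 with ⟨w, rfl⟩ | ⟨a, rfl⟩
  · exact Or.inl ⟨w, (whitePt_mem_holeVerts w).1 hv, rfl⟩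
  · exact Or.inr ⟨a, (blackPt_mem_holeVerts a).1 hv, rfl⟩

lemma IsHoleMatching.apply_ne {n : ℕ} {h : White n} {b : Black n} {σ : White n ≃ Black n}
    (hσ : IsHoleMatching h b σ) {w : White n} (hw : w ≠ h) : σ w ≠ b :=
  hσ.1 ▸ σ.injective.ne hw

/-- The subgraph formed by the edges of a matching with holes. -/
def matchingSubgraph {n : ℕ} {h : White n} {b : Black n} {σ : White n ≃ Black n}
    (hσ : IsHoleMatching h b σ) : coloredGrid.Subgraph where
  verts := holeVerts h b
  Adj u v := ∃ w, w ≠ h ∧ ((u = whitePt w ∧ v = blackPt (σ w)) ∨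
    (v = whitePt w ∧ u = blackPt (σ w)))
  adj_sub := by
    rintro u v ⟨w, hw, ⟨rfl, rfl⟩ | ⟨rfl, rfl⟩⟩
    · exact (coloredGrid_adj_iff _ _).2 (hσ.2 w hw)
    · exact ((coloredGrid_adj_iff _ _).2 (hσ.2 w hw)).symm
  edge_vert := by
    rintro u v ⟨w, hw, ⟨rfl, rfl⟩ | ⟨rfl, rfl⟩⟩
    · exact (whitePt_mem_holeVerts w).2 hw
    · exact (blackPt_mem_holeVerts _).2 (hσ.apply_ne hw)
  symm := by
    constructor
    rintro u v ⟨w, hw, h'⟩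
    exact ⟨w, hw, h'.symm⟩

lemma matchingSubgraph_adj_white {n : ℕ} {h : White n} {b : Black n} {σ : White n ≃ Black n}
    (hσ : IsHoleMatching h b σ) (w : White n) (v : Bool × ℕ × ℕ) :
    (matchingSubgraph hσ).Adj (whitePt w) v ↔ w ≠ h ∧ v = blackPt (σ w) := by
  constructor
  · rintro ⟨w', hw', ⟨h₁, rfl⟩ | ⟨-, h₁⟩⟩
    · rw [whitePt_injective h₁]
      exact ⟨hw', rfl⟩
    · exact absurd h₁ (whitePt_ne_blackPt _ _)
  · rintro ⟨hw, rfl⟩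
    exact ⟨w, hw, Or.inl ⟨rfl, rfl⟩⟩

lemma matchingSubgraph_isMatching {n : ℕ} {h : White n} {b : Black n} {σ : White n ≃ Black n}
    (hσ : IsHoleMatching h b σ) : (matchingSubgraph hσ).IsMatching := by
  intro v hv
  rcases mem_holeVerts_cases hv with ⟨w, hw, rfl⟩ | ⟨a, ha, rfl⟩
  · simp only [matchingSubgraph_adj_white]
    exact ⟨_, ⟨hw, rfl⟩, fun _ h' => h'.2⟩
  · refine ⟨whitePt (σ.symm a), ⟨σ.symm a, ?_, Or.inr ⟨rfl, by simp⟩⟩, ?_⟩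
    · rintro h'
      exact ha (by rw [← hσ.1, ← h', σ.apply_symm_apply])
    · rintro u ⟨w, -, ⟨h₁, -⟩ | ⟨rfl, h₁⟩⟩
      · exact absurd h₁.symm (whitePt_ne_blackPt _ _)
      · rw [blackPt_injective h₁, σ.symm_apply_apply]

lemma matchingSubgraph_injective {n : ℕ} {h : White n} {b : Black n} {σ τ : White n ≃ Black n}
    (hσ : IsHoleMatching h b σ) (hτ : IsHoleMatching h b τ)
    (heq : matchingSubgraph hσ = matchingSubgraph hτ) : σ = τ := by
  ext1 w
  by_cases hw : w = h
  · rw [hw, hσ.1, hτ.1]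
  · have hadj := (matchingSubgraph_adj_white hσ w _).2 ⟨hw, rfl⟩
    rw [heq, matchingSubgraph_adj_white] at hadj
    exact blackPt_injective hadj.2

lemma exists_matchingSubgraph_eq {n : ℕ} {h : White n} {b : Black n} (M : coloredGrid.Subgraph)
    (hverts : M.verts = holeVerts h b) (hM : M.IsMatching) :
    ∃ σ, ∃ hσ : IsHoleMatching h b σ, matchingSubgraph hσ = M := by
  have hex (w : White n) : ∃ a : Black n, (w = h → a = b) ∧
      (w ≠ h → a ≠ b ∧ M.Adj (whitePt w) (blackPt a)) := by
    by_cases hw : w = h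
    · exact ⟨b, fun _ => rfl, fun h' => absurd hw h'⟩
    · obtain ⟨v, hv, -⟩ := hM (hverts ▸ (whitePt_mem_holeVerts w).2 hw)
      rcases mem_holeVerts_cases (hverts ▸ M.edge_vert hv.symm) with ⟨w', -, rfl⟩ | ⟨a, ha, rfl⟩
      · have := M.adj_sub hv
        simp [coloredGrid, whitePt] at this
      · exact ⟨a, fun h' => absurd h' hw, fun _ => ⟨ha, hv⟩⟩
  choose f hfh hf using hex
  have hinj : Function.Injective f := by
    intro v w hvw
    by_cases hv : v = h <;> by_cases hw : w = h
    · rw [hv, hw]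
    · exact absurd (hvw ▸ hfh v hv) (hf w hw).1
    · exact absurd (hvw ▸ hfh w hw) (hf v hv).1
    · have h₁ := (hf v hv).2
      have h₂ := (hf w hw).2
      rw [← hvw] at h₂
      exact whitePt_injective (hM.eq_of_adj_right h₁ h₂)
  have hbij : Function.Bijective f :=
    (Fintype.bijective_iff_injective_and_card f).2 ⟨hinj, by simp [mul_comm]⟩
  refine ⟨Equiv.ofBijective f hbij, ⟨hfh h rfl, fun w hw =>
    (coloredGrid_adj_iff _ _).1 (M.adj_sub (hf w hw).2)⟩, ?_⟩
  refine SimpleGraph.Subgraph.ext hverts.symm ?_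
  ext u v
  constructor
  · rintro ⟨w, hw, ⟨rfl, rfl⟩ | ⟨rfl, rfl⟩⟩
    · exact (hf w hw).2
    · exact (hf w hw).2.symm
  · intro huv
    have hwhite (w : White n) (x : Bool × ℕ × ℕ) (hwx : M.Adj (whitePt w) x) :
        w ≠ h ∧ x = blackPt (f w) := by
      have hw : w ≠ h := (whitePt_mem_holeVerts w).1 (hverts ▸ M.edge_vert hwx)
      exact ⟨hw, hM.eq_of_adj_left hwx (hf w hw).2⟩
    rcases mem_holeVerts_cases (hverts ▸ M.edge_vert huv) with ⟨w, -, rfl⟩ | ⟨a, -, rfl⟩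
    · exact ⟨w, (hwhite w v huv).1, Or.inl ⟨rfl, (hwhite w v huv).2⟩⟩
    rcases mem_holeVerts_cases (hverts ▸ M.edge_vert huv.symm) with ⟨w, -, rfl⟩ | ⟨a', -, rfl⟩
    · exact ⟨w, (hwhite w _ huv.symm).1, Or.inr ⟨rfl, (hwhite w _ huv.symm).2⟩⟩
    · have := M.adj_sub huv
      simp [coloredGrid, blackPt] at this

/-- The number of edges from the part of the row of `b` before `b` to the next white row. -/
lemma card_edges_above {n : ℕ} {h : White n} {b : Black n} {σ : White n ≃ Black n}
    (hσ : IsHoleMatching h b σ) :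
    Nat.card {i : ℕ // 1 ≤ i ∧ i ≤ b.2 ∧
      ((matchingSubgraph hσ).Adj (true, (i, (b.1 : ℕ) + 1)) (false, (i - 1, (b.1 : ℕ) + 1 + 1)) ∨
        (matchingSubgraph hσ).Adj (true, (i, (b.1 : ℕ) + 1)) (false, (i, (b.1 : ℕ) + 1 + 1)))} =
      #{w | MatchedDown h σ w ∧ (σ w).1 = b.1 ∧ (σ w).2 < b.2} := by
  rw [Nat.subtype_card ((univ.filter fun w => MatchedDown h σ w ∧ (σ w).1 = b.1 ∧
    (σ w).2 < b.2).image fun w => ((σ w).2 : ℕ) + 1), card_image_of_injOn]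
  · intro v hv w hw hvw
    simp only [coe_filter, mem_univ, true_and, Set.mem_ofPred_eq] at hv hw
    simp only [add_left_inj] at hvw
    exact σ.injective (Prod.ext (hv.2.1.trans hw.2.1.symm) (Fin.ext hvw))
  · intro i
    simp only [mem_image, mem_filter, mem_univ, true_and, MatchedDown, matchingSubgraph, whitePt,
      blackPt, Prod.mk.injEq, Fin.lt_def, Fin.ext_iff, reduceCtorEq, false_and, false_or, true_and]
    constructor
    · rintro ⟨w, ⟨⟨hw, h₁⟩, h₂, h₃⟩, rfl⟩
      refine ⟨by omega, by omega, ?_⟩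
      rcases (hσ.2 w hw).1 with h₄ | h₄
      · exact Or.inr ⟨w, hw, by omega⟩
      · exact Or.inl ⟨w, hw, by omega⟩
    · rintro ⟨h₁, h₂, ⟨w, hw, h₃⟩ | ⟨w, hw, h₃⟩⟩
      · exact ⟨w, ⟨⟨hw, by omega⟩, by omega, by omega⟩, by omega⟩
      · exact ⟨w, ⟨⟨hw, by omega⟩, by omega, by omega⟩, by omega⟩

lemma finsum_matching_eq_signedCount {n : ℕ} (h : White n) (b : Black n) :
    (∑ᶠ M : {M : coloredGrid.Subgraph //
        M.verts = aztecVerts n \ {whitePt h, blackPt b} ∧ M.IsMatching},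
      (-1 : ℤ) ^ (Nat.card {i : ℕ // 1 ≤ i ∧ i ≤ b.2 ∧
          (M.val.Adj (true, (i, (b.1 : ℕ) + 1)) (false, (i - 1, (b.1 : ℕ) + 1 + 1)) ∨
           M.val.Adj (true, (i, (b.1 : ℕ) + 1)) (false, (i, (b.1 : ℕ) + 1 + 1)))})) =
      signedCount h b := by
  rw [signedCount, ← sum_subtype_eq_sum_filter, subtype_univ, ← finsum_eq_sum_of_fintype]
  symm
  refine finsum_eq_of_bijective (fun σ : {σ // IsHoleMatching h b σ} =>
    ⟨matchingSubgraph σ.2, rfl, matchingSubgraph_isMatching σ.2⟩) ⟨?_, ?_⟩ ?_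
  · rintro ⟨σ, hσ⟩ ⟨τ, hτ⟩ heq
    exact Subtype.ext (matchingSubgraph_injective hσ hτ (congrArg Subtype.val heq))
  · rintro ⟨M, hverts, hM⟩
    obtain ⟨σ, hσ, heq⟩ := exists_matchingSubgraph_eq M hverts hM
    exact ⟨⟨σ, hσ⟩, Subtype.ext heq⟩
  · rintro ⟨σ, hσ⟩
    rw [card_edges_above hσ]

/-- Weighted count for holes on the edge: for the Aztec diamond of order `n` with the white
vertex `(1, w₁+d₁)` and the black vertex `(d₀+1, w₁)` deleted, the sum of `(-1)^(w T)` over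
all perfect matchings `T` — where `w T` counts the edges of `T` joining a black vertex
`(i, w₁)` with `1 ≤ i ≤ d₀` to the white vertex `(i-1, w₁+1)` or `(i, w₁+1)` — equals
`(-1)^(w₁+1) · Kr (w₁-1) (n-1) (n-d₀) · 2^(n(n-1)/2)`. -/
theorem weighted_count_edge_holes (n w₁ d₀ d₁ : ℕ) (hn : 1 ≤ n)
    (hd₀ : 1 ≤ d₀) (hd₁ : 1 ≤ d₁) (hw₁ : 1 ≤ w₁) (hw₁n : w₁ ≤ n)
    (hsum : w₁ + d₁ ≤ n + 1) (hd₀n : d₀ + 1 ≤ n + 1) :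
    (∑ᶠ M : {M : coloredGrid.Subgraph //
        M.verts = aztecVerts n \
          {((false : Bool), (1, w₁ + d₁)), ((true : Bool), (d₀ + 1, w₁))} ∧
        M.IsMatching},
      (-1 : ℤ) ^ (Nat.card {i : ℕ // 1 ≤ i ∧ i ≤ d₀ ∧
          (M.val.Adj (true, (i, w₁)) (false, (i - 1, w₁ + 1)) ∨
           M.val.Adj (true, (i, w₁)) (false, (i, w₁ + 1)))}))
    = (-1 : ℤ) ^ (w₁ + 1) * Kr (w₁ - 1) (n - 1) (n - d₀) * 2 ^ (n * (n - 1) / 2) := by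

  obtain ⟨k, rfl⟩ : ∃ k, w₁ = k + 1 := ⟨w₁ - 1, by omega⟩
  let h : White n := (⟨k + d₁, by omega⟩, ⟨0, by omega⟩)
  let b : Black n := (⟨k, by omega⟩, ⟨d₀, by omega⟩)
  have hh : ((false : Bool), (1, k + 1 + d₁)) = whitePt h := by
    simp only [whitePt, h, Prod.mk.injEq, true_and]
    omega
  rw [hh]
  refine (finsum_matching_eq_signedCount h b).trans ?_
  rw [signedCount_eq (show k < k + d₁ by omega) rfl hd₀]
  simp only [b, Nat.add_sub_cancel, pow_succ]
  ring
end
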